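/- arXiv:0904.0262 — 2 statements merged into one kernel-verified Lean document; each statement's English description precedes it below -/
import Mathlib

section
/- For every integer ℓ ≥ 2, every finite set of at least ES(((2ℓ−1)^ℓ − 1)/(2ℓ−2)) points in the plane contains ℓ collinear points or a 5-hole (an empty pentagon). -/
noncomputable section

/-- A point in the plane. -/
abbrev Pt : Type := EuclideanSpace ℝ (Fin 2)

noncomputable instance : DecidableEq Pt := Classical.decEq _

/-- A finite point set is in general position if no three of its points are collinear. -/
def GenPos (P : Finset Pt) : Prop :=
  ∀ S ⊆ P, S.card = 3 → ¬ Collinear ℝ (S : Set Pt)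

/-- A finite point set is in convex position if every point lies on the boundary
of the convex hull of the set. -/
def ConvexPos (P : Finset Pt) : Prop :=
  ∀ p ∈ P, p ∈ frontier (convexHull ℝ (P : Set Pt))

/-- `v` is a corner of `P` if removing it changes the convex hull. -/
def IsCornerOf (P : Finset Pt) (v : Pt) : Prop :=
  convexHull ℝ ((P : Set Pt) \ {v}) ≠ convexHull ℝ (P : Set Pt)

/-- A finite point set is in strictly convex position if each of its points is a corner. -/
def StrictConvexPos (P : Finset Pt) : Prop :=
  ∀ v ∈ P, IsCornerOf P v

/-- `P` contains `k` points in convex position. -/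
def HasConvex (P : Finset Pt) (k : ℕ) : Prop :=
  ∃ S ⊆ P, S.card = k ∧ ConvexPos S

/-- `P` contains `k` points in strictly convex position. -/
def HasStrictConvex (P : Finset Pt) (k : ℕ) : Prop :=
  ∃ S ⊆ P, S.card = k ∧ StrictConvexPos S

/-- `P` contains `l` collinear points. -/
def HasCollinear (P : Finset Pt) (l : ℕ) : Prop :=
  ∃ S ⊆ P, S.card = l ∧ Collinear ℝ (S : Set Pt)

/-- The Erdős–Szekeres number: the least `n` such that every finite set of at least `n`
points in general position contains `k` points in convex position. -/
def ES (k : ℕ) : ℕ :=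
  sInf {n : ℕ | ∀ P : Finset Pt, GenPos P → n ≤ P.card → HasConvex P k}

/-- `X` is a `k`-hole of `P`: `k` points of `P` in strictly convex position whose
convex hull contains no other point of `P`. -/
def IsHole (P X : Finset Pt) (k : ℕ) : Prop :=
  X ⊆ P ∧ X.card = k ∧ StrictConvexPos X ∧
    convexHull ℝ (X : Set Pt) ∩ (P : Set Pt) = (X : Set Pt)

/-- `v` and `w` are visible with respect to `P`. -/
def Visible (P : Finset Pt) (v w : Pt) : Prop :=
  v ≠ w ∧ (P : Set Pt) ∩ segment ℝ v w = {v, w}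

end

/-- signed area -/
def cr (a b c : Pt) : ℝ := (b 0 - a 0) * (c 1 - a 1) - (b 1 - a 1) * (c 0 - a 0)

lemma pt_ext {p q : Pt} (h0 : p 0 = q 0) (h1 : p 1 = q 1) : p = q := by
  ext i; fin_cases i <;> simpa

lemma pt_ne {p q : Pt} (h : p ≠ q) : p 0 - q 0 ≠ 0 ∨ p 1 - q 1 ≠ 0 := by
  by_contra! hh
  exact h (pt_ext (by linarith) (by linarith))

lemma convex_lin_ge (a b c : ℝ) : Convex ℝ {q : Pt | c ≤ a * q 0 + b * q 1} := by
  intro p hp q hq s t hs ht hst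
  simp only [Set.mem_ofPred_eq, PiLp.add_apply, PiLp.smul_apply, smul_eq_mul] at *
  have : c = s * c + t * c := by rw [← add_mul, hst, one_mul]
  nlinarith [mul_le_mul_of_nonneg_left hp hs, mul_le_mul_of_nonneg_left hq ht]

lemma lin_ge_hull {S : Set Pt} {a b c : ℝ} (h : ∀ q ∈ S, c ≤ a * q 0 + b * q 1) :
    ∀ q ∈ convexHull ℝ S, c ≤ a * q 0 + b * q 1 :=
  fun q hq => convexHull_min (t := {q : Pt | c ≤ a * q 0 + b * q 1}) h (convex_lin_ge a b c) hq

lemma lin_gt_int {S : Set Pt} {a b c : ℝ} (hab : a ≠ 0 ∨ b ≠ 0)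
    (h : ∀ q ∈ S, c ≤ a * q 0 + b * q 1) {q : Pt} (hq : q ∈ interior S) :
    c < a * q 0 + b * q 1 := by
  have hcont : Continuous (fun t : ℝ => q - t • (!₂[a, b] : Pt)) := by fun_prop
  have hmem : ∀ᶠ t in nhds (0:ℝ), q - t • (!₂[a, b] : Pt) ∈ interior S := by
    apply hcont.continuousAt.eventually_mem
    simpa using isOpen_interior.mem_nhds hq
  obtain ⟨ε, hε, hb⟩ := Metric.eventually_nhds_iff.1 hmem
  have h1 := h _ (interior_subset (hb (y := ε / 2) (by simp [abs_of_pos hε]; linarith)))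
  simp at h1
  have : 0 < a ^ 2 + b ^ 2 := by
    rcases hab with h | h
    · have := pow_pos (abs_pos.2 h) 2
      rw [sq_abs] at this; positivity
    · have := pow_pos (abs_pos.2 h) 2
      rw [sq_abs] at this; positivity
  nlinarith

lemma cr_lin (a b q : Pt) : cr a b q = (-(b 1 - a 1)) * q 0 + (b 0 - a 0) * q 1
    - ((b 0 - a 0) * a 1 - (b 1 - a 1) * a 0) := by unfold cr; ring

lemma cr_ge_hull {S : Set Pt} {a b : Pt} (h : ∀ q ∈ S, 0 ≤ cr a b q) :
    ∀ q ∈ convexHull ℝ S, 0 ≤ cr a b q := by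
  intro q hq
  have := lin_ge_hull (S := S) (a := -(b 1 - a 1)) (b := b 0 - a 0)
    (c := (b 0 - a 0) * a 1 - (b 1 - a 1) * a 0) (fun q hq => by
      have := h q hq; rw [cr_lin] at this; linarith) q hq
  rw [cr_lin]; linarith

lemma cr_gt_int {S : Set Pt} {a b : Pt} (hab : a ≠ b) (h : ∀ q ∈ S, 0 ≤ cr a b q)
    {q : Pt} (hq : q ∈ interior S) : 0 < cr a b q := by
  have := lin_gt_int (S := S) (a := -(b 1 - a 1)) (b := b 0 - a 0)
    (c := (b 0 - a 0) * a 1 - (b 1 - a 1) * a 0) (by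
      rcases pt_ne hab.symm with h | h
      · right; exact h
      · left; exact neg_ne_zero.2 h)
    (fun q hq => by
      have := h q hq; rw [cr_lin] at this; linarith) hq
  rw [cr_lin]; linarith

lemma cr_le_hull {S : Set Pt} {a b : Pt} {c : ℝ} (h : ∀ q ∈ S, cr a b q ≤ c) :
    ∀ q ∈ convexHull ℝ S, cr a b q ≤ c := by
  intro q hq
  have := lin_ge_hull (S := S) (a := (b 1 - a 1)) (b := -(b 0 - a 0))
    (c := -c-((b 0 - a 0) * a 1 - (b 1 - a 1) * a 0)) (fun q hq => by
      have := h q hq; rw [cr_lin] at this; linarith) q hq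
  rw [cr_lin]; linarith

lemma cr_lt_int {S : Set Pt} {a b : Pt} {c : ℝ} (hab : a ≠ b) (h : ∀ q ∈ S, cr a b q ≤ c)
    {q : Pt} (hq : q ∈ interior S) : cr a b q < c := by
  have := lin_gt_int (S := S) (a := (b 1 - a 1)) (b := -(b 0 - a 0))
    (c := -c-((b 0 - a 0) * a 1 - (b 1 - a 1) * a 0)) (by
      rcases pt_ne hab.symm with h | h
      · right; exact neg_ne_zero.2 h
      · left; exact h)
    (fun q hq => by
      have := h q hq; rw [cr_lin] at this; linarith) hq
  rw [cr_lin]; linarith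

lemma lin_of_clm (f : Pt →L[ℝ] ℝ) : ∃ a b : ℝ, ∀ q : Pt, f q = a * q 0 + b * q 1 := by
  refine ⟨f !₂[1, 0], f !₂[0, 1], fun q => ?_⟩
  have : q = q 0 • (!₂[1, 0] : Pt) + q 1 • (!₂[0, 1] : Pt) := by
    apply pt_ext <;> simp
  conv_lhs => rw [this]
  simp [mul_comm]

/-- supporting functional -/
lemma support {S : Set Pt} (hne : (interior (convexHull ℝ S)).Nonempty) {p : Pt}
    (hp : p ∉ interior (convexHull ℝ S)) :
    ∃ a b : ℝ, (a ≠ 0 ∨ b ≠ 0) ∧ (∀ q ∈ interior (convexHull ℝ S), a * q 0 + b * q 1 < a * p 0 + b * p 1) ∧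
      ∀ q ∈ convexHull ℝ S, a * q 0 + b * q 1 ≤ a * p 0 + b * p 1 := by
  obtain ⟨f, hf⟩ := geometric_hahn_banach_open_point (convex_convexHull ℝ S).interior
    isOpen_interior hp
  obtain ⟨a, b, hab⟩ := lin_of_clm f
  refine ⟨a, b, ?_, ?_, ?_⟩
  · obtain ⟨q, hq⟩ := hne
    have := hf q hq
    by_contra! h
    rw [hab, hab, h.1, h.2] at this
    simp at this
  · intro q hq; rw [← hab, ← hab]; exact hf q hq
  · intro q hq
    have h1 : q ∈ closure (interior (convexHull ℝ S)) := by
      rw [(convex_convexHull ℝ S).closure_interior_eq_closure_of_nonempty_interior hne]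
      exact subset_closure hq
    have h2 : closure (interior (convexHull ℝ S)) ⊆ {q | f q ≤ f p} :=
      closure_minimal (fun q hq => (hf q hq).le) (isClosed_le f.continuous continuous_const)
    have := h2 h1
    rw [← hab, ← hab]; exact this

/-- hull lies in the open half plane or in the hull of the face -/
lemma hull_face {T : Set Pt} {a b c : ℝ} (h : ∀ q ∈ T, a * q 0 + b * q 1 ≤ c) {v : Pt}
    (hv : v ∈ convexHull ℝ T) (hvc : c ≤ a * v 0 + b * v 1) :
    v ∈ convexHull ℝ {t ∈ T | a * t 0 + b * t 1 = c} := by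
  set F := {t ∈ T | a * t 0 + b * t 1 = c} with hF
  have hFc : ∀ q ∈ convexHull ℝ F, a * q 0 + b * q 1 = c := by
    intro q hq
    apply le_antisymm
    · have := lin_ge_hull (S := F) (a := -a) (b := -b) (c := -c) (fun q hq => by
        have := hq.2; linarith) q hq
      linarith
    · exact lin_ge_hull (S := F) (fun q hq => hq.2.ge) q hq
  have hconv : Convex ℝ {q : Pt | a * q 0 + b * q 1 < c ∨ q ∈ convexHull ℝ F} := by
    intro p hp q hq s t hs ht hst
    by_cases hboth : p ∈ convexHull ℝ F ∧ q ∈ convexHull ℝ F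
    · right; exact convex_convexHull ℝ F hboth.1 hboth.2 hs ht hst
    have hp' : a * p 0 + b * p 1 ≤ c := by
      rcases hp with h | h
      · exact h.le
      · exact (hFc p h).le
    have hq' : a * q 0 + b * q 1 ≤ c := by
      rcases hq with h | h
      · exact h.le
      · exact (hFc q h).le
    rcases hs.eq_or_lt with hs0 | hs0
    · have : t = 1 := by linarith
      subst this; rw [← hs0]; simpa using hq
    rcases ht.eq_or_lt with ht0 | ht0
    · have : s = 1 := by linarith
      subst this; rw [← ht0]; simpa using hp
    left
    simp only [PiLp.add_apply, PiLp.smul_apply, smul_eq_mul]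
    have e : c = s * c + t * c := by rw [← add_mul, hst, one_mul]
    have hlt : a * p 0 + b * p 1 < c ∨ a * q 0 + b * q 1 < c := by
      by_contra! hh
      apply hboth
      constructor
      · rcases hp with h | h
        · linarith
        · exact h
      · rcases hq with h | h
        · linarith
        · exact h
    rcases hlt with h | h
    · nlinarith [mul_lt_mul_of_pos_left h hs0, mul_le_mul_of_nonneg_left hq' ht]
    · nlinarith [mul_lt_mul_of_pos_left h ht0, mul_le_mul_of_nonneg_left hp' hs]
  have := convexHull_min (s := T) (t := {q : Pt | a * q 0 + b * q 1 < c ∨ q ∈ convexHull ℝ F})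
    (fun q hq => by
      rcases (h q hq).lt_or_eq with h' | h'
      · left; exact h'
      · right; exact subset_convexHull ℝ F ⟨hq, h'⟩) hconv hv
  rcases this with h | h
  · linarith
  · exact h

lemma hull_face_single {T : Set Pt} {a b c : ℝ} (h : ∀ q ∈ T, a * q 0 + b * q 1 ≤ c) {v u : Pt}
    (hv : v ∈ convexHull ℝ T) (hvc : c ≤ a * v 0 + b * v 1)
    (hu : ∀ t ∈ T, a * t 0 + b * t 1 = c → t = u) : v = u := by
  have := hull_face h hv hvc
  have h2 : {t ∈ T | a * t 0 + b * t 1 = c} ⊆ {u} := fun t ht => hu t ht.1 ht.2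
  have := convexHull_mono h2 this
  simpa using this

lemma cr_face_single {T : Set Pt} {a b : Pt} (h : ∀ q ∈ T, 0 ≤ cr a b q) {v u : Pt}
    (hv : v ∈ convexHull ℝ T) (hvc : cr a b v ≤ 0)
    (hu : ∀ t ∈ T, cr a b t = 0 → t = u) : v = u := by
  refine hull_face_single (T := T) (a := b 1 - a 1) (b := -(b 0 - a 0))
    (c := -((b 0 - a 0) * a 1 - (b 1 - a 1) * a 0)) ?_ hv ?_ ?_
  · intro q hq; have := h q hq; rw [cr_lin] at this; linarith
  · rw [cr_lin] at hvc; linarith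
  · intro t ht h'; apply hu t ht; rw [cr_lin]; linarith

lemma collinear_of_cr {S : Set Pt} {a b : Pt} (hab : a ≠ b) (h : ∀ q ∈ S, cr a b q = 0) :
    Collinear ℝ S := by
  rw [collinear_iff_exists_forall_eq_smul_vadd]
  refine ⟨a, b - a, fun p hp => ?_⟩
  have h1 := h p hp
  unfold cr at h1
  rcases pt_ne hab.symm with h0 | h0
  · refine ⟨(p 0 - a 0) / (b 0 - a 0), ?_⟩
    apply pt_ext
    · simp; field_simp; ring
    · simp; field_simp; linarith
  · refine ⟨(p 1 - a 1) / (b 1 - a 1), ?_⟩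
    apply pt_ext
    · simp; field_simp; linarith
    · simp; field_simp; ring

lemma cr_of_collinear {S : Set Pt} (h : Collinear ℝ S) {a b c : Pt} (ha : a ∈ S) (hb : b ∈ S)
    (hc : c ∈ S) : cr a b c = 0 := by
  rw [collinear_iff_of_mem ha] at h
  obtain ⟨v, hv⟩ := h
  obtain ⟨r, hr⟩ := hv b hb
  obtain ⟨s, hs⟩ := hv c hc
  subst hr hs
  unfold cr
  simp; ring

lemma collinear_of_triples {S : Set Pt} (h : ∀ a ∈ S, ∀ b ∈ S, ∀ c ∈ S, cr a b c = 0) :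
    Collinear ℝ S := by
  rcases S.subsingleton_or_nontrivial with hs | ⟨a, ha, b, hb, hab⟩
  · rcases hs.eq_empty_or_singleton with rfl | ⟨x, rfl⟩
    · exact collinear_empty ℝ _
    · exact collinear_singleton ℝ _
  · exact collinear_of_cr hab (fun q hq => h a ha b hb q hq)

lemma interior_of_cr {S : Set Pt} {a b c : Pt} (ha : a ∈ S) (hb : b ∈ S) (hc : c ∈ S)
    (h : cr a b c ≠ 0) : (interior (convexHull ℝ S)).Nonempty := by
  rw [interior_convexHull_nonempty_iff_affineSpan_eq_top]
  have hai : AffineIndependent ℝ ![a, b, c] := by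
    rw [affineIndependent_iff_not_collinear_set]
    intro hcol
    exact h (cr_of_collinear hcol (by simp) (by simp) (by simp))
  have h1 : affineSpan ℝ (Set.range ![a, b, c]) = ⊤ := by
    rw [hai.affineSpan_eq_top_iff_card_eq_finrank_add_one]
    simp
  rw [eq_top_iff, ← h1]
  apply affineSpan_mono
  rintro _ ⟨i, rfl⟩
  fin_cases i <;> simpa

lemma exists_line_of_interior_empty {S : Set Pt} (h : ¬ (interior (convexHull ℝ S)).Nonempty) :
    ∃ a b : Pt, a ≠ b ∧ ∀ q ∈ S, cr a b q = 0 := by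
  rcases S.subsingleton_or_nontrivial with hs | ⟨a, ha, b, hb, hab⟩
  · rcases hs.eq_empty_or_singleton with rfl | ⟨x, rfl⟩
    · exact ⟨0, !₂[1, 0], fun h => by simpa using congrArg (fun p : Pt => p 0) h, by simp⟩
    · refine ⟨x, x + !₂[1, 0], fun h => by simpa using congrArg (fun p : Pt => p 0) h, ?_⟩
      intro q hq; simp at hq; subst hq; simp [cr]
  · refine ⟨a, b, hab, fun q hq => ?_⟩
    by_contra hne
    exact h (interior_of_cr ha hb hq hne)

/-- interior absorbs positive combinations -/
lemma comb_interior {S : Set Pt} {z u w p : Pt} (hz : z ∈ interior (convexHull ℝ S))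
    (hu : u ∈ convexHull ℝ S) (hw : w ∈ convexHull ℝ S) {α β : ℝ} (hα : 0 ≤ α) (hβ : 0 ≤ β)
    (hab : α + β < 1) (h0 : p 0 - z 0 = α * (u 0 - z 0) + β * (w 0 - z 0))
    (h1 : p 1 - z 1 = α * (u 1 - z 1) + β * (w 1 - z 1)) : p ∈ interior (convexHull ℝ S) := by
  by_contra hp
  obtain ⟨a, b, -, hi, hc⟩ := support ⟨z, hz⟩ hp
  have h2 := hi z hz
  have h3 := hc u hu
  have h4 := hc w hw
  have : a * (p 0 - z 0) + b * (p 1 - z 1)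
    = α * (a * (u 0 - z 0) + b * (u 1 - z 1)) + β * (a * (w 0 - z 0) + b * (w 1 - z 1)) := by
    rw [h0, h1]; ring
  nlinarith [mul_le_mul_of_nonneg_left h3 hα, mul_le_mul_of_nonneg_left h4 hβ]
def SC (X : Finset Pt) : Prop := ∀ v ∈ X, v ∉ convexHull ℝ ((X : Set Pt) \ {v})

lemma SC.strict {X : Finset Pt} (h : SC X) : StrictConvexPos X := by
  intro v hv heq
  apply h v hv
  rw [heq]
  exact subset_convexHull ℝ _ (by simpa using hv)

/-- no three collinear points on the boundary are strictly convex -/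
lemma SC_of_boundary {R : Set Pt} {X : Finset Pt} (hXR : ∀ v ∈ X, v ∈ convexHull ℝ R)
    (hne : (interior (convexHull ℝ R)).Nonempty)
    (hX : ∀ v ∈ X, v ∉ interior (convexHull ℝ R))
    (h3 : ∀ u ∈ X, ∀ v ∈ X, ∀ w ∈ X, u ≠ v → v ≠ w → u ≠ w → cr u v w ≠ 0) : SC X := by
  intro v hv hmem
  obtain ⟨a, b, hab, -, hc⟩ := support hne (hX v hv)
  set T : Set Pt := (X : Set Pt) \ {v}
  have hle : ∀ q ∈ T, a * q 0 + b * q 1 ≤ a * v 0 + b * v 1 := fun q hq => hc q (hXR q hq.1)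
  have hF := hull_face hle hmem le_rfl
  have hFn : {t ∈ T | a * t 0 + b * t 1 = a * v 0 + b * v 1}.Nonempty := by
    rw [← convexHull_nonempty_iff (𝕜 := ℝ)]; exact ⟨v, hF⟩
  obtain ⟨u, huT, hu⟩ := hFn
  have := hull_face_single hle hmem le_rfl (u := u) (by
    intro t ht he
    by_contra htu
    refine h3 t ht.1 u huT.1 v hv htu huT.2 ht.2 ?_
    unfold cr
    rcases hab with h | h
    · have e1 : t 0 = (a * v 0 + b * v 1 - b * t 1) / a := by field_simp; linarith
      have e2 : u 0 = (a * v 0 + b * v 1 - b * u 1) / a := by field_simp; linarith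
      rw [e1, e2]; field_simp; ring
    · have e1 : t 1 = (a * v 0 + b * v 1 - a * t 0) / b := by field_simp; linarith
      have e2 : u 1 = (a * v 0 + b * v 1 - a * u 0) / b := by field_simp; linarith
      rw [e1, e2]; field_simp; ring)
  exact huT.2 this.symm

/-- a strictly between point -/
def SBw (a u b : Pt) : Prop := ∃ t : ℝ, 0 < t ∧ t < 1 ∧ u = (1 - t) • a + t • b

lemma SBw.symm {a u b : Pt} (h : SBw a u b) : SBw b u a := by
  obtain ⟨t, h0, h1, rfl⟩ := h
  exact ⟨1 - t, by linarith, by linarith, by rw [sub_sub_cancel, add_comm]⟩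

lemma SBw.mem_hull {a u b : Pt} (h : SBw a u b) {S : Set Pt} (ha : a ∈ convexHull ℝ S)
    (hb : b ∈ convexHull ℝ S) : u ∈ convexHull ℝ S := by
  obtain ⟨t, h0, h1, rfl⟩ := h
  exact convex_convexHull ℝ S ha hb (by linarith) (by linarith) (by ring)

lemma btw_of_cr {a b c : Pt} (hab : a ≠ b) (hbc : b ≠ c) (hac : a ≠ c) (h : cr a b c = 0) :
    SBw a b c ∨ SBw b c a ∨ SBw c a b := by
  have hcol : Collinear ℝ ({a, b, c} : Set Pt) := by
    apply collinear_of_cr hab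
    intro q hq
    simp at hq
    rcases hq with rfl | rfl | rfl
    · simp [cr]
    · simp [cr]; ring
    · exact h
  have key : ∀ x y z : Pt, x ≠ y → y ≠ z → Wbtw ℝ x y z → SBw x y z := by
    rintro x y z hxy hyz ⟨t, ht, hy⟩
    refine ⟨t, lt_of_le_of_ne ht.1 ?_, lt_of_le_of_ne ht.2 ?_, ?_⟩
    · rintro rfl; simp at hy; exact hxy hy
    · rintro rfl; simp at hy; exact hyz hy.symm
    · rw [← hy, AffineMap.lineMap_apply_module]
  rcases hcol.wbtw_or_wbtw_or_wbtw with h | h | h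
  · exact Or.inl (key _ _ _ hab hbc h)
  · exact Or.inr (Or.inl (key _ _ _ hbc hac.symm h))
  · exact Or.inr (Or.inr (key _ _ _ hac.symm hab h))

/-- if `b` is a hull combination of `u` (strictly between `a`,`b`) and other points, then it is a
combination of `a` and the other points -/
lemma btw_elim {a u b : Pt} (h : SBw a u b) {S : Set Pt} 
    (hb : b ∈ convexHull ℝ (insert u S)) : b ∈ convexHull ℝ (insert a S) := by
  obtain ⟨t, h0, h1, rfl⟩ := h
  rcases S.eq_empty_or_nonempty with rfl | hS
  · simp at hb ⊢
    have : (1 - t) • b = (1 - t) • a := by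
      have e : (1 - t) • b = b - t • b := by rw [sub_smul, one_smul]
      rw [e]; nth_rewrite 1 [hb]; simp
    exact smul_right_injective _ (by linarith : (1 - t) ≠ 0) this
  rw [convexHull_insert hS, mem_convexJoin] at hb ⊢
  obtain ⟨x, hx, c, hc, hbc⟩ := hb
  simp at hx; subst hx
  refine ⟨a, rfl, c, hc, ?_⟩
  obtain ⟨l, m, hl, hm, hlm, hb⟩ := hbc
  have hlt : 0 < 1 - l * t := by
    have : l ≤ 1 := by linarith
    nlinarith
  refine ⟨l * (1 - t) / (1 - l * t), m / (1 - l * t), ?_, ?_, ?_, ?_⟩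
  · apply div_nonneg _ hlt.le; apply mul_nonneg hl; linarith
  · exact div_nonneg hm hlt.le
  · field_simp; linarith
  · have h0 := congrArg (fun p : Pt => p 0) hb
    have h1 := congrArg (fun p : Pt => p 1) hb
    simp at h0 h1
    apply pt_ext
    · simp; field_simp; linarith
    · simp; field_simp; linarith

/-- pentagon whose interior contains no point of `P` gives a hole -/
lemma hole_of_SC (P : Finset Pt) (X : Finset Pt) (hXP : X ⊆ P) (hc : X.card = 5) (hSC : SC X)
    (hint : ∀ w ∈ P, w ∉ interior (convexHull ℝ (X : Set Pt))) : ∃ X : Finset Pt, IsHole P X 5 := by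
  classical
  induction hn : (P.filter (fun w => w ∈ convexHull ℝ (X : Set Pt))).card using
    Nat.strong_induction_on generalizing X with
  | _ n ih =>
  by_cases hall : ∀ u ∈ P, u ∈ convexHull ℝ (X : Set Pt) → u ∈ X
  · refine ⟨X, hXP, hc, hSC.strict, ?_⟩
    ext u
    constructor
    · rintro ⟨h1, h2⟩; exact hall u h2 h1
    · intro h; exact ⟨subset_convexHull ℝ _ h, hXP h⟩
  push Not at hall
  obtain ⟨u, huP, huc, huX⟩ := hall
  -- no three points of X are collinear
  have hnb : ∀ a ∈ X, ∀ b ∈ X, ∀ c ∈ X, a ≠ b → b ≠ c → ¬ SBw a b c := by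
    intro a ha b hb c hc' hab hbc hB
    exact hSC b hb (hB.mem_hull (subset_convexHull ℝ _ ⟨ha, hab⟩)
      (subset_convexHull ℝ _ ⟨hc', hbc.symm⟩))
  have h3 : ∀ a ∈ X, ∀ b ∈ X, ∀ c ∈ X, a ≠ b → b ≠ c → a ≠ c → cr a b c ≠ 0 := by
    intro a ha b hb c hc' hab hbc hac h0
    rcases btw_of_cr hab hbc hac h0 with h | h | h
    · exact hnb a ha b hb c hc' hab hbc h
    · exact hnb b hb c hc' a ha hbc hac.symm h
    · exact hnb c hc' a ha b hb hac.symm hab h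
  have hne : (interior (convexHull ℝ (X : Set Pt))).Nonempty := by
    obtain ⟨a, b, c, ha, hb, hc', hab, hac, hbc⟩ := Finset.two_lt_card_iff.1 (by omega : 2 < X.card)
    exact interior_of_cr (Finset.mem_coe.2 ha) hb hc' (h3 a ha b hb c hc' hab hbc hac)
  obtain ⟨α, β, hab0, -, hsup⟩ := support hne (hint u huP)
  have hle : ∀ q ∈ (X : Set Pt), α * q 0 + β * q 1 ≤ α * u 0 + β * u 1 :=
    fun q hq => hsup q (subset_convexHull ℝ _ hq)
  have hF := hull_face hle huc le_rfl
  have hlinecr : ∀ p q r : Pt, α * p 0 + β * p 1 = α * u 0 + β * u 1 →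
      α * q 0 + β * q 1 = α * u 0 + β * u 1 → α * r 0 + β * r 1 = α * u 0 + β * u 1 →
      cr p q r = 0 := by
    intro p q r hp hq hr
    unfold cr
    rcases hab0 with h | h
    · have e1 : p 0 = (α * u 0 + β * u 1 - β * p 1) / α := by field_simp; linarith
      have e2 : q 0 = (α * u 0 + β * u 1 - β * q 1) / α := by field_simp; linarith
      have e3 : r 0 = (α * u 0 + β * u 1 - β * r 1) / α := by field_simp; linarith
      rw [e1, e2, e3]; field_simp; ring
    · have e1 : p 1 = (α * u 0 + β * u 1 - α * p 0) / β := by field_simp; linarith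
      have e2 : q 1 = (α * u 0 + β * u 1 - α * q 0) / β := by field_simp; linarith
      have e3 : r 1 = (α * u 0 + β * u 1 - α * r 0) / β := by field_simp; linarith
      rw [e1, e2, e3]; field_simp; ring
  -- face is contained in {a,b}
  have hFn : {t ∈ (X : Set Pt) | α * t 0 + β * t 1 = α * u 0 + β * u 1}.Nonempty := by
    rw [← convexHull_nonempty_iff (𝕜 := ℝ)]; exact ⟨u, hF⟩
  obtain ⟨a, haX, ha⟩ := hFn
  have hex : ∃ b ∈ X, b ≠ a ∧ α * b 0 + β * b 1 = α * u 0 + β * u 1 := by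
    by_contra! hno
    have := hull_face_single hle huc le_rfl (u := a) (by
      intro t ht he
      by_contra hta
      exact hno t ht hta he)
    exact huX (this ▸ haX)
  obtain ⟨b, hbX, hba, hb⟩ := hex
  have hFsub : {t ∈ (X : Set Pt) | α * t 0 + β * t 1 = α * u 0 + β * u 1} ⊆ {a, b} := by
    rintro t ⟨htX, ht⟩
    by_contra hh
    simp at hh
    push Not at hh
    exact h3 t htX a haX b hbX hh.1 hba.symm hh.2 (hlinecr _ _ _ ht ha hb)
  have hua : u ≠ a := fun h => huX (h ▸ haX)
  have hub : u ≠ b := fun h => huX (h ▸ hbX)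
  have hB : SBw a u b := by
    have h1 := convexHull_mono hFsub hF
    rw [convexHull_pair, segment_eq_image] at h1
    obtain ⟨t, ht, h1⟩ := h1
    refine ⟨t, lt_of_le_of_ne ht.1 ?_, lt_of_le_of_ne ht.2 ?_, h1.symm⟩
    · rintro rfl; simp at h1; exact hua h1.symm
    · rintro rfl; simp at h1; exact hub h1.symm
  set X' := insert u (X.erase a) with hX'
  have hX'hull : convexHull ℝ (X' : Set Pt) ⊆ convexHull ℝ (X : Set Pt) := by
    apply convexHull_min _ (convex_convexHull ℝ _)
    intro q hq
    simp [hX'] at hq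
    rcases hq with rfl | hq
    · exact huc
    · exact subset_convexHull ℝ _ hq.1
  refine ih _ ?_ X' ?_ ?_ ?_ ?_ rfl
  · rw [← hn]
    apply Finset.card_lt_card
    refine ⟨?_, ?_⟩
    · intro w hw
      simp at hw ⊢
      exact ⟨hw.1, hX'hull hw.2⟩
    · intro hsub
      have haa : a ∈ P.filter (fun w => w ∈ convexHull ℝ (X' : Set Pt)) :=
        hsub (by simp; exact ⟨hXP haX, subset_convexHull ℝ _ haX⟩)
      simp only [Finset.mem_filter] at haa
      have h2 := haa.2
      rw [hX', Finset.coe_insert] at h2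
      have h4 := btw_elim hB.symm h2
      apply hSC a haX
      refine convexHull_mono ?_ h4
      intro q hq
      simp at hq ⊢
      rcases hq with rfl | hq
      · exact ⟨hbX, hba⟩
      · exact hq
  · intro q hq
    simp [hX'] at hq
    rcases hq with rfl | hq
    · exact huP
    · exact hXP hq.2
  · rw [hX', Finset.card_insert_of_notMem (by simp [huX]), Finset.card_erase_of_mem haX, hc]
  · intro v hv hmem
    rcases Finset.mem_insert.1 hv with rfl | hv'
    · have hsub : (X' : Set Pt) \ {v} ⊆ (X : Set Pt) \ {a} := by
        intro q hq
        simp [hX'] at hq ⊢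
        exact hq.1
      have h1 := convexHull_mono hsub hmem
      have := hull_face_single (fun q hq => hle q hq.1) h1 le_rfl (u := b) (by
        intro t ht he
        have := hFsub ⟨ht.1, he⟩
        simp at this
        rcases this with h | h
        · exact absurd h ht.2
        · exact h)
      exact hub this
    · have hvX := Finset.mem_of_mem_erase hv'
      have hva := Finset.ne_of_mem_erase hv'
      by_cases hvb : v = b
      · subst hvb
        have hsub : (X' : Set Pt) \ {v} ⊆ insert u ((X : Set Pt) \ {v}) := by
          intro q hq
          simp [hX'] at hq ⊢
          tauto
        have h4 := btw_elim hB (convexHull_mono hsub hmem)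
        rw [Set.insert_eq_of_mem (by exact ⟨haX, hba.symm⟩)] at h4
        exact hSC v hvX h4
      · apply hSC v hvX
        refine convexHull_min ?_ (convex_convexHull ℝ _) hmem
        intro q hq
        simp [hX'] at hq
        rcases hq.1 with rfl | h
        · exact hB.mem_hull (subset_convexHull ℝ _ ⟨haX, fun h => hva h.symm⟩)
            (subset_convexHull ℝ _ ⟨hbX, fun h => hvb h.symm⟩)
        · exact subset_convexHull ℝ _ ⟨h.1, hq.2⟩
  · intro w hw h
    exact hint w hw (interior_mono hX'hull h)
open Classical in
noncomputable def peel (R : Finset Pt) : Finset Pt := R.filter (fun p => p ∈ interior (convexHull ℝ (R : Set Pt)))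

open Classical in
noncomputable def lay (R : Finset Pt) : Finset Pt := R.filter (fun p => p ∉ interior (convexHull ℝ (R : Set Pt)))

lemma mem_peel {R : Finset Pt} {p : Pt} :
    p ∈ peel R ↔ p ∈ R ∧ p ∈ interior (convexHull ℝ (R : Set Pt)) := by simp [peel]

lemma mem_lay {R : Finset Pt} {p : Pt} :
    p ∈ lay R ↔ p ∈ R ∧ p ∉ interior (convexHull ℝ (R : Set Pt)) := by simp [lay]

lemma hull_lay (R : Finset Pt) : convexHull ℝ (lay R : Set Pt) = convexHull ℝ (R : Set Pt) := by
  apply subset_antisymm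
  · apply convexHull_mono
    intro p hp
    exact (mem_lay.1 hp).1
  · have hK : IsCompact (convexHull ℝ (R : Set Pt)) := R.finite_toSet.isCompact_convexHull ℝ
    rw [← closure_convexHull_extremePoints hK (convex_convexHull ℝ _)]
    have hK2 : IsCompact (convexHull ℝ (lay R : Set Pt)) :=
      (lay R).finite_toSet.isCompact_convexHull ℝ
    apply closure_minimal _ hK2.isClosed
    apply convexHull_mono
    intro p hp
    refine Finset.mem_coe.2 (mem_lay.2 ⟨extremePoints_convexHull_subset hp, fun hi => ?_⟩)
    exact (disjoint_interior_extremePoints _).le_bot ⟨hi, hp⟩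

lemma hull_peel (R : Finset Pt) :
    convexHull ℝ (peel R : Set Pt) ⊆ interior (convexHull ℝ (R : Set Pt)) :=
  convexHull_min (fun p hp => (mem_peel.1 hp).2) (convex_convexHull ℝ _).interior

def ClosedIn (P R : Finset Pt) : Prop := R ⊆ P ∧ ∀ p ∈ P, p ∈ convexHull ℝ (R : Set Pt) → p ∈ R

lemma closed_peel {P R : Finset Pt} (h : ClosedIn P R) : ClosedIn P (peel R) := by
  refine ⟨fun p hp => h.1 (mem_peel.1 hp).1, fun p hp hc => ?_⟩
  have := hull_peel R hc
  exact mem_peel.2 ⟨h.2 p hp (interior_subset this), this⟩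

lemma plu (z a b c d : Pt) :
    cr z a b * cr z c d - cr z a c * cr z b d + cr z a d * cr z b c = 0 := by
  unfold cr; ring

lemma cr_swap (z a b : Pt) : cr z b a = - cr z a b := by unfold cr; ring

/-- angularly consecutive pair -/
structure Cone (z : Pt) (Q : Finset Pt) (x y : Pt) : Prop where
  hx : x ∈ Q
  hy : y ∈ Q
  pos : 0 < cr z x y
  emp : ∀ q ∈ Q, 0 < cr z x q → 0 < cr z q y → False

lemma exists_cr_pos {Q : Set Pt} {z d : Pt} (hz : z ∈ interior (convexHull ℝ Q))
    (hd : d ≠ z) : ∃ q ∈ Q, 0 < cr z d q := by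
  by_contra! h
  have h1 := cr_lt_int (a := z) (b := d) (c := 0) hd.symm (cr_le_hull h) hz
  simp [cr] at h1

lemma exists_pair {Q : Finset Pt} {z d : Pt} (hz : z ∈ interior (convexHull ℝ (Q : Set Pt)))
    (hd : d ≠ z) : ∃ x ∈ Q, ∃ y ∈ Q, 0 < cr z x y ∧ 0 ≤ cr z x d ∧ 0 ≤ cr z d y := by
  classical
  -- points strictly right of d
  have hr : (Q.filter (fun q => 0 < cr z q d)).Nonempty := by
    set d' : Pt := z - (d - z) with hd'
    obtain ⟨q, hq, h⟩ := exists_cr_pos (d := d') hz (by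
      intro h; apply hd; rw [hd'] at h; simpa [sub_eq_zero] using h)
    have hh : cr z d' q = cr z q d := by rw [hd']; simp [cr]; ring
    exact ⟨q, Finset.mem_filter.2 ⟨hq, by linarith⟩⟩
  obtain ⟨x, hx, hmax⟩ := Finset.exists_max_image _
    (fun q : Pt => ((q 0 - z 0) * (d 0 - z 0) + (q 1 - z 1) * (d 1 - z 1)) / cr z q d) hr
  simp only [Finset.mem_filter] at hx hmax
  obtain ⟨y, hy, hxy⟩ := exists_cr_pos (d := x) hz (by rintro rfl; simp [cr] at hx)
  refine ⟨x, hx.1, y, hy, hxy, hx.2.le, ?_⟩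
  by_contra! hneg
  have hyd : 0 < cr z y d := by rw [cr_swap]; linarith
  have := hmax y ⟨hy, hyd⟩
  rw [div_le_div_iff₀ hyd hx.2] at this
  have hdd : 0 < (d 0 - z 0) ^ 2 + (d 1 - z 1) ^ 2 := by
    rcases pt_ne hd with h | h
    · have := sq_pos_of_ne_zero h; positivity
    · have := sq_pos_of_ne_zero h; positivity
  have e : ((y 0 - z 0) * (d 0 - z 0) + (y 1 - z 1) * (d 1 - z 1)) * cr z x d
    - ((x 0 - z 0) * (d 0 - z 0) + (x 1 - z 1) * (d 1 - z 1)) * cr z y d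
    = cr z x y * ((d 0 - z 0) ^ 2 + (d 1 - z 1) ^ 2) := by unfold cr; ring
  nlinarith [mul_pos hxy hdd]

lemma exists_cone {Q : Finset Pt} {z d : Pt} (hz : z ∈ interior (convexHull ℝ (Q : Set Pt)))
    (hd : d ≠ z) : ∃ x y, Cone z Q x y ∧ 0 ≤ cr z x d ∧ 0 ≤ cr z d y := by
  classical
  set S := (Q ×ˢ Q).filter (fun e => 0 < cr z e.1 e.2 ∧ 0 ≤ cr z e.1 d ∧ 0 ≤ cr z d e.2) with hS
  have hSn : S.Nonempty := by
    obtain ⟨x, hx, y, hy, h⟩ := exists_pair hz hd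
    exact ⟨(x, y), by simp [hS, hx, hy, h]⟩
  obtain ⟨⟨x, y⟩, hxy, hmin⟩ := Finset.exists_min_image S
    (fun e => (Q.filter (fun q => 0 ≤ cr z e.1 q ∧ 0 ≤ cr z q e.2)).card) hSn
  simp only [hS, Finset.mem_filter, Finset.mem_product] at hxy
  obtain ⟨⟨hx, hy⟩, hpos, h1, h2⟩ := hxy
  have self : ∀ a, cr z a a = 0 := fun a => by unfold cr; ring
  refine ⟨x, y, ⟨hx, hy, hpos, ?_⟩, h1, h2⟩
  intro q hq hxq hqy
  rcases le_total 0 (cr z q d) with hqd | hqd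
  · have := hmin (q, y) (by simp [hS, hq, hy, hqy, hqd, h2])
    apply absurd this
    push Not
    apply Finset.card_lt_card
    refine ⟨?_, fun hsub => ?_⟩
    · intro r hr
      simp only [Finset.mem_filter] at hr ⊢
      refine ⟨hr.1, ?_, hr.2.2⟩
      have := plu z x q r y
      -- [xq][ry] - [xr][qy] + [xy][qr] = 0
      have a1 := mul_nonneg hxq.le hr.2.2
      have a2 := mul_nonneg hpos.le hr.2.1
      by_contra! hh
      nlinarith [mul_pos_of_neg_of_neg hh (neg_lt_zero.2 hqy)]
    · have := hsub (show x ∈ _ by simp [hx, self, hpos.le])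
      simp only [Finset.mem_filter] at this
      have h3 := this.2.1
      rw [cr_swap] at h3; linarith
  · have hdq : 0 ≤ cr z d q := by rw [cr_swap]; linarith
    have := hmin (x, q) (by simp [hS, hq, hx, hxq, hdq, h1])
    apply absurd this
    push Not
    apply Finset.card_lt_card
    refine ⟨?_, fun hsub => ?_⟩
    · intro r hr
      simp only [Finset.mem_filter] at hr ⊢
      refine ⟨hr.1, hr.2.1, ?_⟩
      have := plu z x r q y
      -- [xr][qy] - [xq][ry] + [xy][rq] = 0
      have a1 := mul_nonneg hr.2.1 hqy.le
      have a2 := mul_nonneg hpos.le hr.2.2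
      by_contra! hh
      nlinarith [mul_pos_of_neg_of_neg hh (neg_lt_zero.2 hxq)]
    · have := hsub (show y ∈ _ by simp [hy, self, hpos.le])
      simp only [Finset.mem_filter] at this
      have h3 := this.2.2
      rw [cr_swap] at h3; linarith

/-- coordinates of a point w.r.t. a cone -/
lemma cone_coord {z x y : Pt} (h : 0 < cr z x y) (q : Pt) :
    q 0 - z 0 = (cr z q y / cr z x y) * (x 0 - z 0) + (cr z x q / cr z x y) * (y 0 - z 0) ∧
    q 1 - z 1 = (cr z q y / cr z x y) * (x 1 - z 1) + (cr z x q / cr z x y) * (y 1 - z 1) := by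
  constructor
  · field_simp; unfold cr; ring
  · field_simp; unfold cr; ring

lemma cr_expand (z x y q : Pt) : cr x y q = cr z x y - cr z q y - cr z x q := by
  unfold cr; ring

/-- boundary points on the same ray are equal -/
lemma ray_eq {R : Set Pt} {z p q : Pt} (hz : z ∈ interior (convexHull ℝ R))
    (hp : p ∈ convexHull ℝ R) (hq : q ∈ convexHull ℝ R)
    (hp' : p ∉ interior (convexHull ℝ R)) (hq' : q ∉ interior (convexHull ℝ R))
    {s : ℝ} (hs : 0 < s) (h0 : p 0 - z 0 = s * (q 0 - z 0)) (h1 : p 1 - z 1 = s * (q 1 - z 1)) :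
    p = q := by
  rcases lt_trichotomy s 1 with h | h | h
  · exact absurd (comb_interior (p := p) hz hq hq hs.le le_rfl (by linarith : s + 0 < 1)
      (by linarith) (by linarith)) hp'
  · subst h
    exact pt_ext (by linarith) (by linarith)
  · refine absurd (comb_interior (p := q) (α := 1 / s) (β := 0) hz hp hp (by positivity) le_rfl ?_
      ?_ ?_) hq'
    · rw [add_zero, div_lt_one hs]; exact h
    · rw [h0]; field_simp; ring
    · rw [h1]; field_simp; ring

lemma ray_eq' {R : Set Pt} {z p q x : Pt} (hz : z ∈ interior (convexHull ℝ R))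
    (hp : p ∈ convexHull ℝ R) (hq : q ∈ convexHull ℝ R)
    (hp' : p ∉ interior (convexHull ℝ R)) (hq' : q ∉ interior (convexHull ℝ R))
    (hpx : 0 < cr z x p) (hqx : 0 < cr z x q) (h : cr z p q = 0) : p = q := by
  refine ray_eq hz hp hq hp' hq' (s := cr z x p / cr z x q) (by positivity) ?_ ?_
  · field_simp
    have : (p 0 - z 0) * cr z x q - cr z x p * (q 0 - z 0) = - cr z p q * (x 0 - z 0) * (-1) := by
      unfold cr; ring
    rw [h] at this; linarith
  · field_simp
    have : (p 1 - z 1) * cr z x q - cr z x p * (q 1 - z 1) = - cr z p q * (x 1 - z 1) * (-1) := by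
      unfold cr; ring
    rw [h] at this; linarith

lemma cone_unique {R : Finset Pt} {z x y y' : Pt} (hz : z ∈ interior (convexHull ℝ (R : Set Pt)))
    (h : Cone z (lay R) x y) (h' : Cone z (lay R) x y') : y = y' := by
  have hy := mem_lay.1 h.hy
  have hy' := mem_lay.1 h'.hy
  refine ray_eq' hz (subset_convexHull ℝ _ hy.1) (subset_convexHull ℝ _ hy'.1) hy.2 hy'.2
    h.pos h'.pos ?_
  rcases lt_trichotomy (cr z y y') 0 with h1 | h1 | h1
  · exact (h.emp y' h'.hy h'.pos (by rw [cr_swap]; linarith)).elim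
  · exact h1
  · exact (h'.emp y h.hy h.pos h1).elim

lemma cone_support {R : Finset Pt} {z x y : Pt} (hz : z ∈ interior (convexHull ℝ (R : Set Pt)))
    (h : Cone z (lay R) x y) : ∀ q ∈ lay R, 0 ≤ cr x y q := by
  intro q hq
  by_contra! hneg
  have hx := mem_lay.1 h.hx
  have hy := mem_lay.1 h.hy
  have hq1 := mem_lay.1 hq
  have hxc := subset_convexHull ℝ _ (Finset.mem_coe.2 hx.1)
  have hyc := subset_convexHull ℝ _ (Finset.mem_coe.2 hy.1)
  have hqc := subset_convexHull ℝ _ (Finset.mem_coe.2 hq1.1)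
  rw [cr_expand z] at hneg
  have hp := h.pos
  by_cases hA : 0 < cr z q y
  · by_cases hB : 0 < cr z x q
    · exact h.emp q hq hB hA
    · -- x is combination of q and y
      push Not at hB
      refine hx.2 (comb_interior (p := x) (u := q) (w := y) (α := cr z x y / cr z q y)
        (β := - cr z x q / cr z q y) hz hqc hyc (by positivity) ?_ ?_ ?_ ?_)
      · apply div_nonneg _ hA.le; linarith
      · rw [← add_div, div_lt_one hA]; linarith
      · field_simp; unfold cr; ring
      · field_simp; unfold cr; ring
  · push Not at hA
    have hB : 0 < cr z x q := by linarith
    refine hy.2 (comb_interior (p := y) (u := q) (w := x) (α := cr z x y / cr z x q)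
        (β := - cr z q y / cr z x q) hz hqc hxc (by positivity) ?_ ?_ ?_ ?_)
    · apply div_nonneg _ hB.le; linarith
    · rw [← add_div, div_lt_one hB]; linarith
    · field_simp; unfold cr; ring
    · field_simp; unfold cr; ring

lemma cone_support' {R : Finset Pt} {z x y : Pt} (hz : z ∈ interior (convexHull ℝ (R : Set Pt)))
    (h : Cone z (lay R) x y) : ∀ q ∈ convexHull ℝ (R : Set Pt), 0 ≤ cr x y q := by
  rw [← hull_lay]
  exact cr_ge_hull (cone_support hz h)

/-- outer points in the cone are strictly beyond -/
lemma cone_beyond {S : Set Pt} {z x y p : Pt} (hz : z ∈ interior (convexHull ℝ S))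
    (hx : x ∈ interior (convexHull ℝ S)) (hy : y ∈ interior (convexHull ℝ S))
    (hxy : 0 < cr z x y) (hp : p ∉ interior (convexHull ℝ S)) (h1 : 0 ≤ cr z x p)
    (h2 : 0 ≤ cr z p y) : cr x y p < 0 := by
  by_contra! hge
  rw [cr_expand z] at hge
  obtain ⟨c0, c1⟩ := cone_coord hxy p
  set α := cr z p y / cr z x y
  set β := cr z x p / cr z x y
  have hα : 0 ≤ α := div_nonneg h2 hxy.le
  have hβ : 0 ≤ β := div_nonneg h1 hxy.le
  have hs : α + β ≤ 1 := by rw [← add_div, div_le_one hxy]; linarith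
  apply hp
  have hconv := (convex_convexHull ℝ S).interior
  have : p = (1 - α - β) • z + α • x + β • y := by
    apply pt_ext <;> simp <;> linarith
  rw [this]
  have := hconv.sum_mem (t := Finset.univ) (w := ![1 - α - β, α, β]) (z := ![z, x, y])
    (by intro i _; fin_cases i <;> simp <;> linarith) (by simp [Fin.sum_univ_three]; try ring)
    (by intro i _; fin_cases i <;> simpa)
  simpa [Fin.sum_univ_three] using this
lemma cr_rot (a b c : Pt) : cr b c a = cr a b c := by unfold cr; ring
lemma cr_flip (a b c : Pt) : cr b a c = - cr a b c := by unfold cr; ring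
lemma cr_flip' (a b c : Pt) : cr c b a = - cr a b c := by unfold cr; ring
lemma cr_self1 (a b : Pt) : cr a a b = 0 := by unfold cr; ring
lemma cr_self2 (a b : Pt) : cr a b b = 0 := by unfold cr; ring
lemma cr_self3 (a b : Pt) : cr a b a = 0 := by unfold cr; ring

lemma int_hull_of_peel {R : Finset Pt} {z : Pt} (hz : z ∈ interior (convexHull ℝ (peel R : Set Pt))) :
    z ∈ interior (convexHull ℝ (R : Set Pt)) := hull_peel R (interior_subset hz)

lemma lay_peel_int {R : Finset Pt} {x : Pt} (hx : x ∈ lay (peel R)) :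
    x ∈ interior (convexHull ℝ (R : Set Pt)) := (mem_peel.1 (mem_lay.1 hx).1).2

lemma not_mem_aux {R T : Set Pt} {u v w x y : Pt} (hx : x ∈ interior (convexHull ℝ R))
    (hy : y ∈ interior (convexHull ℝ R)) (hu : u ∉ interior (convexHull ℝ R))
    (hv : v ∈ convexHull ℝ R) (hw : w ∈ convexHull ℝ R)
    (hT : ∀ t ∈ T, t = x ∨ t = y ∨ t = v ∨ t = w) (h : cr u v w ≠ 0) : u ∉ convexHull ℝ T := by
  intro hm
  obtain ⟨a, b, hab, hi, hc⟩ := support ⟨x, hx⟩ hu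
  have hF := hull_face (c := a * u 0 + b * u 1) (T := T) (fun q hq => by
    rcases hT q hq with rfl | rfl | rfl | rfl
    · exact (hi _ hx).le
    · exact (hi _ hy).le
    · exact hc _ hv
    · exact hc _ hw) hm le_rfl
  have hz : ∀ q ∈ {t ∈ T | a * t 0 + b * t 1 = a * u 0 + b * u 1}, cr v w q = 0 := by
    rintro q ⟨hq, he⟩
    rcases hT q hq with rfl | rfl | rfl | rfl
    · exact absurd he (hi _ hx).ne
    · exact absurd he (hi _ hy).ne
    · exact cr_self3 _ _
    · exact cr_self2 _ _
  apply h
  have h1 := cr_ge_hull (fun q hq => (hz q hq).ge) u hF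
  have h2 := cr_le_hull (fun q hq => (hz q hq).le) u hF
  rw [← cr_rot]; linarith

lemma pentA {P R : Finset Pt} (hcl : ClosedIn P R) {z x y : Pt}
    (hz : z ∈ interior (convexHull ℝ (peel R : Set Pt))) (hco : Cone z (lay (peel R)) x y)
    {u v w : Pt} (hu : u ∈ lay R) (hv : v ∈ lay R) (hw : w ∈ lay R)
    (hu1 : 0 ≤ cr z x u) (hu2 : 0 ≤ cr z u y) (hv1 : 0 ≤ cr z x v) (hv2 : 0 ≤ cr z v y)
    (hw1 : 0 ≤ cr z x w) (hw2 : 0 ≤ cr z w y) (h : cr u v w ≠ 0) :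
    ∃ X : Finset Pt, IsHole P X 5 := by
  have hz' := int_hull_of_peel hz
  have hx := lay_peel_int hco.hx
  have hy := lay_peel_int hco.hy
  have bu := cone_beyond hz' hx hy hco.pos (mem_lay.1 hu).2 hu1 hu2
  have bv := cone_beyond hz' hx hy hco.pos (mem_lay.1 hv).2 hv1 hv2
  have bw := cone_beyond hz' hx hy hco.pos (mem_lay.1 hw).2 hw1 hw2
  have hxy : x ≠ y := by rintro rfl; have := hco.pos; rw [cr_self2] at this; exact lt_irrefl _ this
  have uv : u ≠ v := by rintro rfl; exact h (cr_self1 _ _)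
  have vw : v ≠ w := by rintro rfl; exact h (cr_self2 _ _)
  have uw : u ≠ w := by rintro rfl; exact h (cr_self3 _ _)
  have nx : ∀ t, cr x y t < 0 → t ≠ x := by rintro t ht rfl; rw [cr_self3] at ht; linarith
  have ny : ∀ t, cr x y t < 0 → t ≠ y := by rintro t ht rfl; rw [cr_self2] at ht; linarith
  have cu := subset_convexHull ℝ _ (Finset.mem_coe.2 (mem_lay.1 hu).1)
  have cv := subset_convexHull ℝ _ (Finset.mem_coe.2 (mem_lay.1 hv).1)
  have cw := subset_convexHull ℝ _ (Finset.mem_coe.2 (mem_lay.1 hw).1)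
  have hsub : ({x, y, u, v, w} : Finset Pt) ⊆ R := by
    intro t ht
    simp only [Finset.mem_insert, Finset.mem_singleton] at ht
    rcases ht with rfl | rfl | rfl | rfl | rfl
    · exact (mem_peel.1 (mem_lay.1 hco.hx).1).1
    · exact (mem_peel.1 (mem_lay.1 hco.hy).1).1
    · exact (mem_lay.1 hu).1
    · exact (mem_lay.1 hv).1
    · exact (mem_lay.1 hw).1
  refine hole_of_SC P {x, y, u, v, w} (hsub.trans hcl.1) ?_ ?_ ?_
  · rw [Finset.card_insert_of_notMem, Finset.card_insert_of_notMem, Finset.card_insert_of_notMem,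
      Finset.card_insert_of_notMem, Finset.card_singleton]
    · simpa using vw
    · simp [uv, uw]
    · simp [(ny u bu).symm, (ny v bv).symm, (ny w bw).symm]
    · simp [hxy, (nx u bu).symm, (nx v bv).symm, (nx w bw).symm]
  · intro t ht
    simp only [Finset.mem_insert, Finset.mem_singleton] at ht
    rcases ht with rfl | rfl | rfl | rfl | rfl
    · intro hm
      refine hxy (cr_face_single (a := y) (b := t) (u := y) ?_ hm (cr_self2 _ _).le ?_)
      · rintro q ⟨hq, -⟩
        simp only [Finset.coe_insert, Finset.coe_singleton, Set.mem_insert_iff, Set.mem_singleton_iff] at hq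
        rcases hq with rfl | rfl | rfl | rfl | rfl
        · rw [cr_self2]
        · rw [cr_self3]
        all_goals rw [cr_flip]; linarith
      · rintro q ⟨hq, hne⟩ h0
        simp only [Finset.coe_insert, Finset.coe_singleton, Set.mem_insert_iff, Set.mem_singleton_iff] at hq hne
        rw [cr_flip] at h0
        rcases hq with rfl | rfl | rfl | rfl | rfl
        · exact absurd rfl hne
        · rfl
        all_goals linarith
    · intro hm
      refine hxy.symm (cr_face_single (a := t) (b := x) (u := x) ?_ hm (cr_self3 _ _).le ?_)
      · rintro q ⟨hq, -⟩
        simp only [Finset.coe_insert, Finset.coe_singleton, Set.mem_insert_iff, Set.mem_singleton_iff] at hq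
        rcases hq with rfl | rfl | rfl | rfl | rfl
        · rw [cr_self2]
        · rw [cr_self3]
        all_goals rw [cr_flip]; linarith
      · rintro q ⟨hq, hne⟩ h0
        simp only [Finset.coe_insert, Finset.coe_singleton, Set.mem_insert_iff, Set.mem_singleton_iff] at hq hne
        rw [cr_flip] at h0
        rcases hq with rfl | rfl | rfl | rfl | rfl
        · rfl
        · exact absurd rfl hne
        all_goals linarith
    · refine not_mem_aux hx hy (mem_lay.1 hu).2 cv cw ?_ h
      rintro q ⟨hq, hne⟩
      simp only [Finset.coe_insert, Finset.coe_singleton, Set.mem_insert_iff, Set.mem_singleton_iff] at hq hne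
      tauto
    · refine not_mem_aux hx hy (mem_lay.1 hv).2 cw cu ?_ (by rwa [cr_rot])
      rintro q ⟨hq, hne⟩
      simp only [Finset.coe_insert, Finset.coe_singleton, Set.mem_insert_iff, Set.mem_singleton_iff] at hq hne
      tauto
    · refine not_mem_aux hx hy (mem_lay.1 hw).2 cu cv ?_ (by rwa [← cr_rot])
      rintro q ⟨hq, hne⟩
      simp only [Finset.coe_insert, Finset.coe_singleton, Set.mem_insert_iff, Set.mem_singleton_iff] at hq hne
      tauto
  · intro q hq hqi
    have hqR := interior_mono (convexHull_mono (Finset.coe_subset.2 hsub)) hqi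
    have hqp : q ∈ peel R := mem_peel.2 ⟨hcl.2 q hq (interior_subset hqR), hqR⟩
    have h1 := cone_support' hz hco q (subset_convexHull ℝ _ hqp)
    have h2 := cr_lt_int (a := x) (b := y) (c := 0) hxy (cr_le_hull (fun t ht => by
      simp only [Finset.coe_insert, Finset.coe_singleton, Set.mem_insert_iff, Set.mem_singleton_iff] at ht
      rcases ht with rfl | rfl | rfl | rfl | rfl
      · rw [cr_self3]
      · rw [cr_self2]
      all_goals linarith)) hqi
    linarith

structure Cfg (P R : Finset Pt) (z x y p q : Pt) : Prop where
  hcl : ClosedIn P R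
  hz : z ∈ interior (convexHull ℝ (peel R : Set Pt))
  co : Cone z (lay (peel R)) x y
  hp : p ∈ lay R
  hq : q ∈ lay R
  p1 : 0 ≤ cr z x p
  q2 : 0 ≤ cr z q y
  pq : 0 < cr z p q
  q1 : 0 < cr z x q
  p2 : 0 < cr z p y

lemma Cfg.mk' {P R : Finset Pt} {z x y p q : Pt} (hcl : ClosedIn P R)
    (hz : z ∈ interior (convexHull ℝ (peel R : Set Pt)))
    (co : Cone z (lay (peel R)) x y) (hp : p ∈ lay R) (hq : q ∈ lay R)
    (p1 : 0 ≤ cr z x p) (p2 : 0 ≤ cr z p y) (q1 : 0 ≤ cr z x q) (q2 : 0 ≤ cr z q y)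
    (pq : 0 < cr z p q) : Cfg P R z x y p q := by
  have h := plu z x p q y
  have a := mul_nonneg p1 q2
  have b := mul_pos co.pos pq
  refine ⟨hcl, hz, co, hp, hq, p1, q2, pq, lt_of_le_of_ne q1 fun e => ?_,
    lt_of_le_of_ne p2 fun e => ?_⟩
  · rw [← e] at h; linarith
  · rw [← e] at h; linarith

namespace Cfg
variable {P R : Finset Pt} {z x y p q : Pt}
lemma bp (C : Cfg P R z x y p q) : cr x y p < 0 :=
  cone_beyond (int_hull_of_peel C.hz) (lay_peel_int C.co.hx) (lay_peel_int C.co.hy) C.co.pos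
    (mem_lay.1 C.hp).2 C.p1 C.p2.le
lemma bq (C : Cfg P R z x y p q) : cr x y q < 0 :=
  cone_beyond (int_hull_of_peel C.hz) (lay_peel_int C.co.hx) (lay_peel_int C.co.hy) C.co.pos
    (mem_lay.1 C.hq).2 C.q1.le C.q2
lemma xpq (C : Cfg P R z x y p q) : 0 < cr x p q := by
  by_contra! hn
  have e : cr x p q = cr z x p + cr z p q - cr z x q := by unfold cr; ring
  have hpos := C.q1
  refine (mem_lay.1 C.hp).2 (comb_interior (z := x) (u := z) (w := q)
    (α := (cr z x q - cr z p q - cr z x p) / cr z x q) (β := cr z x p / cr z x q)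
    (lay_peel_int C.co.hx) (interior_subset (int_hull_of_peel C.hz))
    (subset_convexHull ℝ _ (mem_lay.1 C.hq).1) (div_nonneg (by linarith) hpos.le)
    (div_nonneg C.p1 hpos.le) ?_ ?_ ?_)
  · rw [← add_div, div_lt_one hpos]; linarith [C.pq]
  · field_simp; unfold cr; ring
  · field_simp; unfold cr; ring
lemma pqy (C : Cfg P R z x y p q) : 0 < cr p q y := by
  by_contra! hn
  have e : cr p q y = cr z p q + cr z q y - cr z p y := by unfold cr; ring
  have hpos := C.p2
  refine (mem_lay.1 C.hq).2 (comb_interior (z := y) (u := z) (w := p)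
    (α := (cr z p y - cr z p q - cr z q y) / cr z p y) (β := cr z q y / cr z p y)
    (lay_peel_int C.co.hy) (interior_subset (int_hull_of_peel C.hz))
    (subset_convexHull ℝ _ (mem_lay.1 C.hp).1) (div_nonneg (by linarith) hpos.le)
    (div_nonneg C.q2 hpos.le) ?_ ?_ ?_)
  · rw [← add_div, div_lt_one hpos]; linarith [C.pq]
  · field_simp; unfold cr; ring
  · field_simp; unfold cr; ring

lemma pentB (C : Cfg P R z x y p q) {t : Pt} (ht : t ∈ R) (t1 : 0 < cr x y t) (t2 : 0 < cr x p t) (t3 : 0 < cr q y t) :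
    ∃ X : Finset Pt, IsHole P X 5 := by
  classical
  obtain ⟨s, hs, hmin⟩ := Finset.exists_min_image
    (R.filter (fun t => 0 < cr x y t ∧ 0 < cr x p t ∧ 0 < cr q y t)) (fun t => cr x y t)
    ⟨t, by simp [ht, t1, t2, t3]⟩
  simp only [Finset.mem_filter] at hs hmin
  clear t1 t2 t3 ht t
  obtain ⟨hsP, s1, s2, s3⟩ := hs
  have bp := C.bp
  have bq := C.bq
  have xpq := C.xpq
  have pqy := C.pqy
  have xpy : 0 < cr x p y := by rw [cr_swap]; linarith
  have qyx : 0 < cr q y x := by rw [cr_rot, cr_swap]; linarith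
  have qyp : 0 < cr q y p := by rw [cr_rot]; linarith
  have hxy : x ≠ y := by rintro rfl; rw [cr_self1] at bp; linarith
  have hxp : x ≠ p := by rintro rfl; rw [cr_self3] at bp; linarith
  have hxq : x ≠ q := by rintro rfl; rw [cr_self3] at bq; linarith
  have hyp : y ≠ p := by rintro rfl; rw [cr_self2] at bp; linarith
  have hyq : y ≠ q := by rintro rfl; rw [cr_self2] at bq; linarith
  have hpq : p ≠ q := by rintro rfl; rw [cr_self2] at xpq; linarith
  have hsx : s ≠ x := by rintro rfl; rw [cr_self3] at s1; linarith
  have hsy : s ≠ y := by rintro rfl; rw [cr_self2] at s1; linarith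
  have hsp : s ≠ p := by rintro rfl; linarith
  have hsq : s ≠ q := by rintro rfl; linarith
  have hXR : ({x, y, p, q, s} : Finset Pt) ⊆ R := by
    intro t ht
    simp only [Finset.mem_insert, Finset.mem_singleton] at ht
    rcases ht with rfl | rfl | rfl | rfl | rfl
    · exact (mem_peel.1 (mem_lay.1 C.co.hx).1).1
    · exact (mem_peel.1 (mem_lay.1 C.co.hy).1).1
    · exact (mem_lay.1 C.hp).1
    · exact (mem_lay.1 C.hq).1
    · exact hsP
  have Lxp : ∀ t ∈ ((({x, y, p, q, s} : Finset Pt)) : Set Pt), 0 ≤ cr x p t ∧ (cr x p t = 0 → t = x ∨ t = p) := by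
    intro t ht
    simp only [Finset.coe_insert, Finset.coe_singleton, Set.mem_insert_iff, Set.mem_singleton_iff] at ht
    rcases ht with rfl | rfl | rfl | rfl | rfl
    · rw [cr_self3]; simp
    · exact ⟨xpy.le, fun h => absurd h xpy.ne'⟩
    · rw [cr_self2]; simp
    · exact ⟨xpq.le, fun h => absurd h xpq.ne'⟩
    · exact ⟨s2.le, fun h => absurd h s2.ne'⟩
  have Lqy : ∀ t ∈ ((({x, y, p, q, s} : Finset Pt)) : Set Pt), 0 ≤ cr q y t ∧ (cr q y t = 0 → t = q ∨ t = y) := by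
    intro t ht
    simp only [Finset.coe_insert, Finset.coe_singleton, Set.mem_insert_iff, Set.mem_singleton_iff] at ht
    rcases ht with rfl | rfl | rfl | rfl | rfl
    · exact ⟨qyx.le, fun h => absurd h qyx.ne'⟩
    · rw [cr_self2]; simp
    · exact ⟨qyp.le, fun h => absurd h qyp.ne'⟩
    · rw [cr_self3]; simp
    · exact ⟨s3.le, fun h => absurd h s3.ne'⟩
  refine hole_of_SC P {x, y, p, q, s} (hXR.trans C.hcl.1) ?_ ?_ ?_
  · rw [Finset.card_insert_of_notMem, Finset.card_insert_of_notMem, Finset.card_insert_of_notMem,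
      Finset.card_insert_of_notMem, Finset.card_singleton]
    · simpa using hsq.symm
    · simp [hpq, hsp.symm]
    · simp [hyp, hyq, hsy.symm]
    · simp [hxy, hxp, hxq, hsx.symm]
  · intro t ht hm
    simp only [Finset.mem_insert, Finset.mem_singleton] at ht
    rcases ht with h | h | h | h | h
    · rw [h] at hm
      refine hxp (cr_face_single (a := x) (b := p) (fun t ht => (Lxp t ht.1).1) hm (cr_self3 _ _).le
        (fun t ht h0 => ((Lxp t ht.1).2 h0).resolve_left ht.2))
    · rw [h] at hm
      refine hyq (cr_face_single (a := q) (b := y) (fun t ht => (Lqy t ht.1).1) hm (cr_self2 _ _).le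
        (fun t ht h0 => ((Lqy t ht.1).2 h0).resolve_right ht.2))
    · rw [h] at hm
      refine hxp.symm (cr_face_single (a := x) (b := p) (fun t ht => (Lxp t ht.1).1) hm (cr_self2 _ _).le
        (fun t ht h0 => ((Lxp t ht.1).2 h0).resolve_right ht.2))
    · rw [h] at hm
      refine hyq.symm (cr_face_single (a := q) (b := y) (fun t ht => (Lqy t ht.1).1) hm (cr_self3 _ _).le
        (fun t ht h0 => ((Lqy t ht.1).2 h0).resolve_left ht.2))
    · rw [h] at hm
      have := cr_le_hull (a := x) (b := y) (c := 0) (fun t ht => by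
        obtain ⟨ht, hne⟩ := ht
        simp only [Finset.coe_insert, Finset.coe_singleton, Set.mem_insert_iff, Set.mem_singleton_iff] at ht hne
        rcases ht with rfl | rfl | rfl | rfl | rfl
        · rw [cr_self3]
        · rw [cr_self2]
        · exact bp.le
        · exact bq.le
        · exact absurd rfl hne) _ hm
      linarith
  · intro w hw hwi
    have hwR := interior_mono (convexHull_mono (Finset.coe_subset.2 hXR)) hwi
    have hwr := C.hcl.2 w hw (interior_subset hwR)
    have hwp : w ∈ peel R := mem_peel.2 ⟨hwr, hwR⟩
    have w0 := cone_support' C.hz C.co w (subset_convexHull ℝ _ hwp)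
    have w1 := cr_gt_int hxp (cr_ge_hull fun t ht => (Lxp t ht).1) hwi
    have w2 := cr_gt_int hyq.symm (cr_ge_hull fun t ht => (Lqy t ht).1) hwi
    have w3 := cr_lt_int (a := x) (b := y) (c := cr x y s) hxy (cr_le_hull (fun t ht => by
      simp only [Finset.coe_insert, Finset.coe_singleton, Set.mem_insert_iff, Set.mem_singleton_iff] at ht
      rcases ht with rfl | rfl | rfl | rfl | rfl
      · rw [cr_self3]; exact s1.le
      · rw [cr_self2]; exact s1.le
      · linarith
      · linarith
      · exact le_rfl)) hwi
    rcases w0.lt_or_eq with w0 | w0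
    · linarith [hmin w ⟨hwr, w0, w1, w2⟩]
    · have hwl : w ∈ lay (peel R) := mem_lay.2 ⟨hwp, fun hi => by
        have := cr_gt_int hxy (cone_support' C.hz C.co) hi
        linarith⟩
      have hpos := C.co.pos
      refine C.co.emp w hwl ?_ ?_
      · have e : cr z x y * cr x p w = cr z x w * cr x p y + cr x y w * cr z x p := by
          unfold cr; ring
        rw [← w0] at e
        have := mul_pos hpos w1
        exact pos_of_mul_pos_left (by linarith) xpy.le
      · have e : cr z x y * cr q y w = cr z w y * cr q y x + cr x y w * cr z q y := by
          unfold cr; ring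
        rw [← w0] at e
        have := mul_pos hpos w2
        exact pos_of_mul_pos_left (by linarith) qyx.le
end Cfg
noncomputable def Ps (R : Finset Pt) : ℕ → Finset Pt
  | 0 => R
  | n + 1 => peel (Ps R n)

lemma peel_sub (R : Finset Pt) : peel R ⊆ R := fun _ h => (mem_peel.1 h).1

lemma Ps_anti (R : Finset Pt) {n m : ℕ} (h : n ≤ m) : Ps R m ⊆ Ps R n := by
  induction h with
  | refl => exact subset_rfl
  | step _ ih => exact (peel_sub _).trans ih

lemma Ps_closed {P R : Finset Pt} (h : ClosedIn P R) (n : ℕ) : ClosedIn P (Ps R n) := by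
  induction n with
  | zero => exact h
  | succ n ih => exact closed_peel ih

lemma Ps_int {R : Finset Pt} {n m : ℕ} (h : n < m) {z : Pt} (hz : z ∈ Ps R m) :
    z ∈ interior (convexHull ℝ (Ps R n : Set Pt)) :=
  (mem_peel.1 (Ps_anti R (Nat.succ_le_of_lt h) hz)).2

def NoHole (P : Finset Pt) : Prop := ¬ ∃ X : Finset Pt, IsHole P X 5
def NoCol (P : Finset Pt) (l : ℕ) : Prop :=
  ∀ a b : Pt, a ≠ b → ∀ S ⊆ P, (∀ q ∈ S, cr a b q = 0) → S.card < l

namespace Cfg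
variable {P R : Finset Pt} {z x y p q : Pt}

lemma align (C : Cfg P R z x y p q) (NH : NoHole P) (hz : z ∈ R) :
    cr z x p = 0 ∨ cr z q y = 0 := by
  by_contra! h
  apply NH
  refine C.pentB hz ?_ ?_ ?_
  · rw [cr_rot]; exact C.co.pos
  · rw [cr_rot]; exact lt_of_le_of_ne C.p1 h.1.symm
  · rw [cr_rot]; exact lt_of_le_of_ne C.q2 h.2.symm

lemma noD (C : Cfg P R z x y p q) (NH : NoHole P) {w : Pt} (hw : w ∈ peel (peel R))
    (h1 : 0 ≤ cr z x w) (h1' : 0 < cr z x w ∨ 0 < cr z x p)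
    (h2 : 0 ≤ cr z w y) (h2' : 0 < cr z w y ∨ 0 < cr z q y) : False := by
  have hpos := C.co.pos
  have hxy : x ≠ y := by rintro rfl; rw [cr_self2] at hpos; linarith
  have w0 := cr_gt_int hxy (cone_support' C.hz C.co) (mem_peel.1 hw).2
  have bp := C.bp
  have bq := C.bq
  have p1 := C.p1
  have q2 := C.q2
  have e0 := cr_expand z x y w
  rw [cr_expand z] at bp bq
  apply NH
  refine C.pentB (peel_sub _ (peel_sub _ hw)) w0 ?_ ?_
  · have e : cr z x y * cr x p w = cr z x p * (cr x y w) + cr z x w * (cr z p y + cr z x p - cr z x y) := by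
      unfold cr; ring
    refine pos_of_mul_pos_right (a := cr z x y) ?_ hpos.le
    rw [e]
    rcases h1' with h | h
    · have := mul_nonneg p1 w0.le
      have := mul_pos h (by linarith : 0 < cr z p y + cr z x p - cr z x y)
      linarith
    · have := mul_pos h w0
      have := mul_nonneg h1 (by linarith : 0 ≤ cr z p y + cr z x p - cr z x y)
      linarith
  · have e : cr z x y * cr q y w = cr z q y * (cr x y w) + cr z w y * (cr z x q + cr z q y - cr z x y) := by
      unfold cr; ring
    refine pos_of_mul_pos_right (a := cr z x y) ?_ hpos.le
    rw [e]
    rcases h2' with h | h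
    · have := mul_nonneg q2 w0.le
      have := mul_pos h (by linarith : 0 < cr z x q + cr z q y - cr z x y)
      linarith
    · have := mul_pos h w0
      have := mul_nonneg h2 (by linarith : 0 ≤ cr z x q + cr z q y - cr z x y)
      linarith

lemma next (C : Cfg P R z x y p q) (NH : NoHole P)
    (hz : z ∈ interior (convexHull ℝ (peel (peel R) : Set Pt))) :
    ∃ x' y', Cfg P (peel R) z x' y' x y := by
  have hpos := C.co.pos
  set d : Pt := (1 / 2 : ℝ) • (x + y) with hd
  have hdz : d ≠ z := by
    intro h
    have e : cr z x d = cr z x y / 2 := by rw [hd]; simp [cr]; ring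
    rw [h, cr_self3] at e; linarith
  rw [← hull_lay] at hz
  obtain ⟨x', y', hco, h1, h2⟩ := exists_cone hz hdz
  rw [hull_lay] at hz
  have e1 : cr z x' d = (cr z x' y - cr z x x') / 2 := by rw [hd]; simp [cr]; ring
  have e2 : cr z d y' = (cr z x y' - cr z y' y) / 2 := by rw [hd]; simp [cr]; ring
  have e3 : cr z x y * cr z x' y' = cr z x' y * cr z x y' - cr z x x' * cr z y' y := by
    unfold cr; ring
  have e4 := mul_pos hpos hco.pos
  rw [e3] at e4
  rw [e1] at h1
  rw [e2] at h2
  have n1 := fun u v => C.noD NH (mem_lay.1 hco.hx).1 (le_of_lt u) (Or.inl u) (le_of_lt v) (Or.inl v)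
  have n2 := fun u v => C.noD NH (mem_lay.1 hco.hy).1 (le_of_lt u) (Or.inl u) (le_of_lt v) (Or.inl v)
  generalize ha : cr z x' y = a at *
  generalize hb : cr z x x' = b at *
  generalize hc : cr z y' y = c at *
  generalize he : cr z x y' = e at *
  have hb0 : b ≤ 0 := by
    by_contra! h; exact n1 h (by linarith)
  have hc0 : c ≤ 0 := by
    by_contra! h; exact n2 (by linarith) h
  have hbc := mul_nonneg_of_nonpos_of_nonpos hb0 hc0
  have ha0 : 0 ≤ a := by
    by_contra! h
    nlinarith [mul_nonneg_of_nonpos_of_nonpos (by linarith : b - a ≤ 0) hc0, mul_nonneg_of_nonpos_of_nonpos h.le (by linarith : c - e ≤ 0)]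
  have he0 : 0 ≤ e := by
    by_contra! h
    nlinarith [mul_nonneg ha0 (by linarith : 0 ≤ - e)]
  refine ⟨x', y', Cfg.mk' (closed_peel C.hcl) hz hco C.co.hx C.co.hy ?_ ?_ ?_ ?_ hpos⟩
  · rw [cr_swap, hb]; linarith
  · rw [he]; exact he0
  · rw [ha]; exact ha0
  · rw [cr_swap, hc]; linarith

end Cfg

def Chain (P R : Finset Pt) (z : Pt) (n : ℕ) (u : Pt) : Prop :=
  ∃ C ⊆ P, C.card = n + 1 ∧ ∀ c ∈ C, c ∉ Ps R (n + 1) ∧ cr z c u = 0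

def St (P R : Finset Pt) (z x y p q : Pt) (n : ℕ) : Prop :=
  (cr z x p = 0 ∧ Chain P R z n p ∧ 0 < cr z q y) ∨ (cr z q y = 0 ∧ Chain P R z n q ∧ 0 < cr z x p) ∨
  (cr z x p = 0 ∧ Chain P R z n p ∧ cr z q y = 0 ∧ Chain P R z n q)

lemma Chain.left {P R : Finset Pt} {z x y p q : Pt} {n : ℕ} (h : Chain P R z n p)
    (C : Cfg P (Ps R n) z x y p q) (h0 : cr z x p = 0) : Chain P R z (n + 1) x := by
  obtain ⟨S, hS, hc, h⟩ := h
  have hx : x ∈ lay (Ps R (n + 1)) := C.co.hx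
  refine ⟨insert x S, ?_, ?_, ?_⟩
  · exact Finset.insert_subset ((Ps_closed C.hcl 0).1 (peel_sub _ (mem_lay.1 hx).1)) hS
  · rw [Finset.card_insert_of_notMem, hc]
    intro hxS
    exact (h x hxS).1 (mem_lay.1 hx).1
  · intro c hcc
    rcases Finset.mem_insert.1 hcc with rfl | hcc
    · exact ⟨fun hh => (mem_lay.1 hx).2 (mem_peel.1 hh).2, cr_self2 _ _⟩
    · refine ⟨fun hh => (h c hcc).1 (peel_sub _ hh), ?_⟩
      have e := plu z c p x y
      rw [(h c hcc).2, cr_swap z x p, h0] at e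
      have := C.p2
      have : cr z c x * cr z p y = 0 := by linarith
      rcases mul_eq_zero.1 this with h | h
      · exact h
      · linarith

lemma Chain.right {P R : Finset Pt} {z x y p q : Pt} {n : ℕ} (h : Chain P R z n q)
    (C : Cfg P (Ps R n) z x y p q) (h0 : cr z q y = 0) : Chain P R z (n + 1) y := by
  obtain ⟨S, hS, hc, h⟩ := h
  have hx : y ∈ lay (Ps R (n + 1)) := C.co.hy
  refine ⟨insert y S, ?_, ?_, ?_⟩
  · exact Finset.insert_subset ((Ps_closed C.hcl 0).1 (peel_sub _ (mem_lay.1 hx).1)) hS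
  · rw [Finset.card_insert_of_notMem, hc]
    intro hxS
    exact (h y hxS).1 (mem_lay.1 hx).1
  · intro c hcc
    rcases Finset.mem_insert.1 hcc with rfl | hcc
    · exact ⟨fun hh => (mem_lay.1 hx).2 (mem_peel.1 hh).2, cr_self2 _ _⟩
    · refine ⟨fun hh => (h c hcc).1 (peel_sub _ hh), ?_⟩
      have e := plu z c q x y
      rw [(h c hcc).2, h0] at e
      have := C.q1
      rw [cr_swap z x q] at e
      have : cr z c y * cr z x q = 0 := by linarith
      rcases mul_eq_zero.1 this with h | h
      · exact h
      · linarith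

lemma step {P R : Finset Pt} (NH : NoHole P) {z x y p q : Pt} {n : ℕ}
    (C : Cfg P (Ps R n) z x y p q) (hS : St P R z x y p q n) (hz : z ∈ Ps R (n + 3)) :
    ∃ x' y', Cfg P (Ps R (n + 1)) z x' y' x y ∧ St P R z x' y' x y (n + 1) := by
  obtain ⟨x', y', C'⟩ := C.next NH (Ps_int (n := n + 2) (by omega) hz)
  refine ⟨x', y', C', ?_⟩
  have al := C'.align NH (Ps_anti R (n := n + 1) (by omega) hz)
  have hx' : x' ∈ peel (peel (Ps R n)) := (mem_lay.1 C'.co.hx).1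
  have hy' : y' ∈ peel (peel (Ps R n)) := (mem_lay.1 C'.co.hy).1
  rcases hS with ⟨h1, h2, h3⟩ | ⟨h1, h2, h3⟩ | ⟨h1, h2, h3, h4⟩
  · have hne : cr z y y' ≠ 0 := fun h => C.noD NH hy' C'.p2.le (Or.inl C'.p2)
      (by rw [cr_swap, h]; simp) (Or.inr h3)
    exact Or.inl ⟨al.resolve_right hne, h2.left C h1, lt_of_le_of_ne C'.q2 hne.symm⟩
  · have hne : cr z x' x ≠ 0 := fun h => C.noD NH hx' (by rw [cr_swap, h]; simp)
      (Or.inr h3) C'.q1.le (Or.inl C'.q1)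
    exact Or.inr (Or.inl ⟨al.resolve_left hne, h2.right C h1, lt_of_le_of_ne C'.p1 hne.symm⟩)
  · have k1 := h2.left C h1
    have k2 := h4.right C h3
    rcases C'.p1.lt_or_eq with a | a
    · exact Or.inr (Or.inl ⟨al.resolve_left a.ne', k2, a⟩)
    · rcases C'.q2.lt_or_eq with b | b
      · exact Or.inl ⟨a.symm, k1, b⟩
      · exact Or.inr (Or.inr ⟨a.symm, k1, b.symm, k2⟩)

lemma chain_end {P R : Finset Pt} {l : ℕ} (NC : NoCol P l) {z x : Pt} {n : ℕ}
    (h : Chain P R z (n + 1) x) (hl : l = n + 3) (hz : z ∈ Ps R (n + 2)) (hzP : z ∈ P)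
    (hxz : z ≠ x) : False := by
  obtain ⟨S, hS, hc, h⟩ := h
  have hzS : z ∉ S := fun hh => (h z hh).1 hz
  have := NC z x hxz (insert z S) (Finset.insert_subset hzP hS) (fun q hq => by
    rcases Finset.mem_insert.1 hq with rfl | hq
    · exact cr_self3 _ _
    · rw [cr_swap, (h q hq).2, neg_zero])
  rw [Finset.card_insert_of_notMem hzS, hc] at this
  omega

lemma propagate {P R : Finset Pt} {l : ℕ} (hl : 3 ≤ l) (NH : NoHole P) (NC : NoCol P l)
    {z x y p q : Pt} (hz : z ∈ Ps R (l - 1)) (C : Cfg P R z x y p q) : False := by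
  have key : ∀ n, n + 3 ≤ l → ∃ x y p q, Cfg P (Ps R n) z x y p q ∧ St P R z x y p q n := by
    intro n
    induction n with
    | zero =>
      intro _
      refine ⟨x, y, p, q, C, ?_⟩
      have ch : ∀ u ∈ lay R, Chain P R z 0 u := fun u hu =>
        ⟨{u}, by simpa using C.hcl.1 (mem_lay.1 hu).1, by simp, fun c hc => by
          rw [Finset.mem_singleton] at hc; subst hc
          exact ⟨fun h => (mem_lay.1 hu).2 (mem_peel.1 h).2, cr_self2 _ _⟩⟩
      have al := C.align NH (Ps_anti R (n := 0) (by omega) hz)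
      rcases C.p1.lt_or_eq with a | a
      · exact Or.inr (Or.inl ⟨al.resolve_left a.ne', ch _ C.hq, a⟩)
      · rcases C.q2.lt_or_eq with b | b
        · exact Or.inl ⟨a.symm, ch _ C.hp, b⟩
        · exact Or.inr (Or.inr ⟨a.symm, ch _ C.hp, b.symm, ch _ C.hq⟩)
    | succ n ih =>
      intro hn
      obtain ⟨x, y, p, q, C, S⟩ := ih (by omega)
      obtain ⟨x', y', h⟩ := step NH C S (Ps_anti R (by omega) hz)
      exact ⟨x', y', x, y, h⟩
  obtain ⟨n, rfl⟩ : ∃ n, l = n + 3 := ⟨l - 3, by omega⟩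
  obtain ⟨x, y, p, q, C', S⟩ := key n le_rfl
  have hzP : z ∈ P := C.hcl.1 (Ps_anti R (n := 0) (by omega) hz)
  have hx : z ≠ x := by rintro rfl; have := C'.co.pos; rw [cr_self1] at this; linarith
  have hy : z ≠ y := by rintro rfl; have := C'.co.pos; rw [cr_self3] at this; linarith
  rcases S with ⟨h1, h2, -⟩ | ⟨h1, h2, -⟩ | ⟨h1, h2, -, -⟩
  · exact chain_end NC (h2.left C' h1) rfl hz hzP hx
  · exact chain_end NC (h2.right C' h1) rfl hz hzP hy
  · exact chain_end NC (h2.left C' h1) rfl hz hzP hx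
lemma cone_p2 {R : Finset Pt} {z x y p : Pt}
    (hz : z ∈ interior (convexHull ℝ (peel R : Set Pt))) (co : Cone z (lay (peel R)) x y)
    (hp : p ∈ lay R) (p1 : 0 ≤ cr z x p) (p2 : 0 ≤ cr z p y) : cr z x y < cr z x p + cr z p y := by
  have := cone_beyond (int_hull_of_peel hz) (lay_peel_int co.hx) (lay_peel_int co.hy) co.pos
    (mem_lay.1 hp).2 p1 p2
  rw [cr_expand z] at this; linarith

lemma cone_sep {R : Finset Pt} {z x y p q : Pt}
    (hz : z ∈ interior (convexHull ℝ (peel R : Set Pt))) (co : Cone z (lay (peel R)) x y)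
    (hp : p ∈ lay R) (p1 : 0 ≤ cr z x p) (p2 : 0 ≤ cr z p y)
    (hq : q ∈ lay R) (q1 : 0 ≤ cr z x q) (q2 : 0 ≤ cr z q y) (h : cr z p q = 0) : p = q := by
  have hz' := int_hull_of_peel hz
  have cp := subset_convexHull ℝ _ (Finset.mem_coe.2 (mem_lay.1 hp).1)
  have cq := subset_convexHull ℝ _ (Finset.mem_coe.2 (mem_lay.1 hq).1)
  have bp := cone_p2 hz co hp p1 p2
  have bq := cone_p2 hz co hq q1 q2
  have hpos := co.pos
  have e := plu z x p q y
  rw [h] at e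
  have hy : ∀ t, cr z (z - (y - z)) t = cr z t y := by intro t; simp [cr]; ring
  have Y : 0 < cr z p y → 0 < cr z q y → p = q := fun h1 h2 =>
    ray_eq' (x := z - (y - z)) hz' cp cq (mem_lay.1 hp).2 (mem_lay.1 hq).2 (by rwa [hy]) (by rwa [hy]) h
  rcases p1.lt_or_eq with a | a
  · rcases q1.lt_or_eq with b | b
    · exact ray_eq' hz' cp cq (mem_lay.1 hp).2 (mem_lay.1 hq).2 a b h
    · have : 0 < cr z q y := by linarith
      nlinarith [mul_pos a this]
  · rcases q1.lt_or_eq with b | b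
    · have : 0 < cr z p y := by linarith
      nlinarith [mul_pos b this]
    · exact Y (by linarith) (by linarith)

lemma cone_fun {R : Finset Pt} {z : Pt} (hz : z ∈ interior (convexHull ℝ (peel R : Set Pt))) :
    ∃ f g : Pt → Pt, ∀ p ∈ lay R, Cone z (lay (peel R)) (f p) (g p) ∧ 0 ≤ cr z (f p) p ∧
      0 ≤ cr z p (g p) := by
  have : ∀ p, ∃ x y, p ∈ lay R → Cone z (lay (peel R)) x y ∧ 0 ≤ cr z x p ∧ 0 ≤ cr z p y := by
    intro p
    by_cases hp : p ∈ lay R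
    · have hpz : p ≠ z := by
        rintro rfl; exact (mem_lay.1 hp).2 (int_hull_of_peel hz)
      have hz2 := hz
      rw [← hull_lay] at hz2
      obtain ⟨x, y, h⟩ := exists_cone hz2 hpz
      exact ⟨x, y, fun _ => h⟩
    · exact ⟨0, 0, fun h => absurd h hp⟩
  choose f g h using this
  exact ⟨f, g, h⟩

lemma start {P R : Finset Pt} {l : ℕ} (hl : 3 ≤ l) (NH : NoHole P) (NC : NoCol P l)
    (hcl : ClosedIn P R) {z : Pt} (hz : z ∈ Ps R (l - 1)) :
    (lay R).card ≤ (lay (peel R)).card := by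
  by_contra! hlt
  have hzi : z ∈ interior (convexHull ℝ (peel R : Set Pt)) := Ps_int (n := 1) (by omega) hz
  obtain ⟨f, g, h⟩ := cone_fun hzi
  obtain ⟨p, hp, q, hq, hpq, he⟩ := Finset.exists_ne_map_eq_of_card_lt_of_maps_to hlt
    (f := f) (fun p hp => (h p hp).1.hx)
  obtain ⟨co, p1, p2⟩ := h p hp
  obtain ⟨co', q1, q2⟩ := h q hq
  rw [← he] at co' q1
  have hg := cone_unique hzi co co'
  rw [← hg] at q2
  rcases lt_trichotomy (cr z p q) 0 with h0 | h0 | h0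
  · exact propagate hl NH NC hz (Cfg.mk' hcl hzi co hq hp q1 q2 p1 p2 (by rw [cr_swap]; linarith))
  · exact hpq (cone_sep hzi co hp p1 p2 hq q1 q2 h0)
  · exact propagate hl NH NC hz (Cfg.mk' hcl hzi co hp hq p1 p2 q1 q2 h0)

lemma ratio {P R : Finset Pt} {l : ℕ} (hl : 3 ≤ l) (NH : NoHole P) (NC : NoCol P l)
    (hcl : ClosedIn P R) (hne : (interior (convexHull ℝ (peel R : Set Pt))).Nonempty) :
    (lay R).card ≤ (l - 1) * (lay (peel R)).card := by
  classical
  obtain ⟨z, hz⟩ := hne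
  obtain ⟨f, g, h⟩ := cone_fun hz
  refine Finset.card_le_mul_card_image_of_maps_to (f := f) (fun p hp => (h p hp).1.hx) _ ?_
  intro x hx
  by_contra! hlt
  have : 1 < ((lay R).filter (fun a => f a = x)).card := by omega
  obtain ⟨a, ha, b, hb, hab⟩ := Finset.one_lt_card.1 this
  have := NC a b hab ((lay R).filter (fun a => f a = x)) (fun t ht => hcl.1 (mem_lay.1 (Finset.mem_filter.1 ht).1).1) (by
    intro q hq
    rw [Finset.mem_filter] at ha hb hq
    by_contra hne
    obtain ⟨coa, a1, a2⟩ := h a ha.1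
    obtain ⟨cob, b1, b2⟩ := h b hb.1
    obtain ⟨coq, q1, q2⟩ := h q hq.1
    rw [ha.2] at coa a1
    rw [hb.2] at cob b1
    rw [hq.2] at coq q1
    rw [← cone_unique hz coa cob] at b2
    rw [← cone_unique hz coa coq] at q2
    exact NH (pentA hcl hz coa ha.1 hb.1 hq.1 a1 a2 b1 b2 q1 q2 hne))
  omega

lemma G5 {P T : Finset Pt} {l : ℕ} (hl : 3 ≤ l) (NC : NoCol P l) (hT : T ⊆ P)
    (h5 : ∀ X ⊆ T, X.card = 5 → ¬ ∀ u ∈ X, ∀ v ∈ X, ∀ w ∈ X, u ≠ v → v ≠ w → u ≠ w → cr u v w ≠ 0) :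
    T.card ≤ 4 + 12 * (l - 3) := by
  classical
  set GP : Finset Pt → Prop := fun X => ∀ u ∈ X, ∀ v ∈ X, ∀ w ∈ X, u ≠ v → v ≠ w → u ≠ w → cr u v w ≠ 0
  obtain ⟨S, hS, hmax⟩ := Finset.exists_max_image (T.powerset.filter GP) (fun X => X.card)
    ⟨∅, by simp [GP]⟩
  simp only [Finset.mem_filter, Finset.mem_powerset] at hS hmax
  have hS4 : S.card ≤ 4 := by
    by_contra! hc
    obtain ⟨X, hX, hXc⟩ := Finset.exists_subset_card_eq (show 5 ≤ S.card by omega)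
    exact h5 X (hX.trans hS.1) hXc (fun u hu v hv w hw => hS.2 u (hX hu) v (hX hv) w (hX hw))
  have hcov : T \ S ⊆ S.offDiag.biUnion (fun e => (T \ S).filter (fun t => cr e.1 e.2 t = 0)) := by
    intro t ht
    have ht' := Finset.mem_sdiff.1 ht
    by_contra hn
    have hn' : ∀ u ∈ S, ∀ v ∈ S, u ≠ v → cr u v t ≠ 0 := by
      intro u hu v hv huv h0
      apply hn
      rw [Finset.mem_biUnion]
      exact ⟨(u, v), Finset.mem_offDiag.2 ⟨hu, hv, huv⟩, Finset.mem_filter.2 ⟨ht, h0⟩⟩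
    have := hmax (insert t S) ⟨Finset.insert_subset ht'.1 hS.1, by
      intro u hu v hv w hw huv hvw huw
      rw [Finset.mem_insert] at hu hv hw
      rcases hu with rfl | hu
      · rcases hv with rfl | hv
        · exact absurd rfl huv
        · rcases hw with rfl | hw
          · exact absurd rfl huw
          · rw [← cr_rot]; exact hn' v hv w hw hvw
      · rcases hv with rfl | hv
        · rcases hw with rfl | hw
          · exact absurd rfl hvw
          · rw [cr_swap]; exact neg_ne_zero.2 (hn' u hu w hw huw)
        · rcases hw with rfl | hw
          · exact hn' u hu v hv huv
          · exact hS.2 u hu v hv w hw huv hvw huw⟩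
    rw [Finset.card_insert_of_notMem ht'.2] at this
    omega
  have hb := (Finset.card_le_card hcov).trans (Finset.card_biUnion_le_card_mul _ _ (l - 3) (by
    rintro ⟨u, v⟩ he
    obtain ⟨hu, hv, huv⟩ := Finset.mem_offDiag.1 he
    simp only at hu hv huv ⊢
    set F := (T \ S).filter (fun t => cr u v t = 0) with hF
    have huF : u ∉ F := by simp [hF, hu]
    have hvF : v ∉ F := by simp [hF, hv]
    have := NC u v huv (insert u (insert v F)) (by
      intro t ht
      simp only [Finset.mem_insert] at ht
      rcases ht with rfl | rfl | ht
      · exact hT (hS.1 hu)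
      · exact hT (hS.1 hv)
      · exact hT (Finset.mem_sdiff.1 (Finset.mem_filter.1 ht).1).1) (by
      intro t ht
      simp only [Finset.mem_insert] at ht
      rcases ht with rfl | rfl | ht
      · exact cr_self3 _ _
      · exact cr_self2 _ _
      · exact (Finset.mem_filter.1 ht).2)
    rw [Finset.card_insert_of_notMem (by simp [huv, huF]), Finset.card_insert_of_notMem hvF] at this
    omega))
  have ho : S.offDiag.card ≤ 12 := by
    rw [Finset.offDiag_card]
    interval_cases S.card <;> simp
  have h1 : S.offDiag.card * (l - 3) ≤ 12 * (l - 3) := Nat.mul_le_mul_right _ ho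
  have h2 := Finset.card_sdiff_add_card_eq_card hS.1
  omega

lemma side {P R : Finset Pt} {l : ℕ} (hl : 3 ≤ l) (NH : NoHole P) (NC : NoCol P l)
    (hcl : ClosedIn P R) (hne : (interior (convexHull ℝ (R : Set Pt))).Nonempty)
    {a b : Pt} (hab : a ≠ b) (h : ∀ q ∈ peel R, cr a b q = 0) (T : Finset Pt) (hT : T ⊆ lay R)
    (hT0 : ∀ t ∈ T, 0 ≤ cr a b t) : T.card ≤ 4 + 12 * (l - 3) := by
  have hTR : T ⊆ R := fun t ht => (mem_lay.1 (hT ht)).1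
  refine G5 hl NC (hTR.trans hcl.1) ?_
  intro X hX hc h3
  have hXR := hX.trans hTR
  apply NH
  refine hole_of_SC P X (hXR.trans hcl.1) hc (SC_of_boundary (R := R)
    (fun v hv => subset_convexHull ℝ _ (hXR hv)) hne (fun v hv => (mem_lay.1 (hT (hX hv))).2) h3) ?_
  intro w hw hwi
  have hwR := interior_mono (convexHull_mono (Finset.coe_subset.2 hXR)) hwi
  have h0 := h w (mem_peel.2 ⟨hcl.2 w hw (interior_subset hwR), hwR⟩)
  have := cr_gt_int hab (cr_ge_hull (fun t ht => hT0 t (hX ht))) hwi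
  linarith

lemma degen {P R : Finset Pt} {l : ℕ} (hl : 3 ≤ l) (NH : NoHole P) (NC : NoCol P l)
    (hcl : ClosedIn P R) (hne : ¬ (interior (convexHull ℝ (peel R : Set Pt))).Nonempty) :
    (lay R).card ≤ 2 * (4 + 12 * (l - 3)) := by
  classical
  by_cases hR : (interior (convexHull ℝ (R : Set Pt))).Nonempty
  · obtain ⟨a, b, hab, h⟩ := exists_line_of_interior_empty hne
    have h1 := side hl NH NC hcl hR hab h ((lay R).filter (fun t => 0 ≤ cr a b t))
      (Finset.filter_subset _ _) (fun t ht => (Finset.mem_filter.1 ht).2)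
    have h2 := side hl NH NC hcl hR hab.symm (fun q hq => by rw [cr_flip, h q hq, neg_zero])
      ((lay R).filter (fun t => ¬ 0 ≤ cr a b t))
      (Finset.filter_subset _ _) (fun t ht => by
        have := (Finset.mem_filter.1 ht).2
        rw [cr_flip]; linarith)
    have h3 := Finset.card_filter_add_card_filter_not (s := lay R) (fun t => 0 ≤ cr a b t)
    omega
  · obtain ⟨a, b, hab, h⟩ := exists_line_of_interior_empty hR
    have := NC a b hab (lay R) (fun t ht => hcl.1 (mem_lay.1 ht).1) (fun q hq => h q (mem_lay.1 hq).1)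
    omega

lemma Ps_peel (R : Finset Pt) (n : ℕ) : Ps (peel R) n = Ps R (n + 1) := by
  induction n with
  | zero => rfl
  | succ n ih => rw [Ps, ih]; rfl

lemma bound {P : Finset Pt} {l : ℕ} (hl : 3 ≤ l) (NH : NoHole P) (NC : NoCol P l) (m : ℕ) :
    ∀ R : Finset Pt, ClosedIn P R → Ps R (m + 1) = ∅ →
    (lay R).card ≤ 2 * (4 + 12 * (l - 3)) * (l - 1) ^ m := by
  induction m with
  | zero =>
    intro R hcl h
    have : peel R = ∅ := h
    have := degen hl NH NC hcl (by rw [this]; simp)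
    simpa using this
  | succ m ih =>
    intro R hcl h
    by_cases hne : (interior (convexHull ℝ (peel R : Set Pt))).Nonempty
    · have h1 := ratio hl NH NC hcl hne
      have h2 := ih (peel R) (closed_peel hcl) (by rw [Ps_peel]; exact h)
      calc _ ≤ (l - 1) * _ := h1
        _ ≤ (l - 1) * (2 * (4 + 12 * (l - 3)) * (l - 1) ^ m) := Nat.mul_le_mul_left _ h2
        _ = _ := by ring
    · have h1 := degen hl NH NC hcl hne
      exact h1.trans (Nat.le_mul_of_pos_right _ (pow_pos (by omega) _))

lemma arith {l : ℕ} (hl : 3 ≤ l) :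
    2 * (4 + 12 * (l - 3)) * (l - 1) ^ (l - 2) < ((2 * l - 1) ^ l - 1) / (2 * l - 2) := by
  have key : 2 * (4 + 12 * (l - 3)) * (l - 1) ^ (l - 2) < (2 * l - 1) ^ (l - 1) := by
    rcases Nat.lt_or_ge l 5 with h | h
    · interval_cases l <;> norm_num
    · obtain ⟨m, rfl⟩ : ∃ m, l = m + 5 := ⟨l - 5, by omega⟩
      have h1 : m + 1 ≤ 2 ^ m := Nat.lt_two_pow_self
      have e1 : m + 5 - 3 = m + 2 := by omega
      have e2 : m + 5 - 1 = m + 4 := by omega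
      have e3 : m + 5 - 2 = m + 3 := by omega
      have e4 : 2 * (m + 5) - 1 = 2 * (m + 4) + 1 := by omega
      rw [e1, e2, e3, e4]
      have a1 : (2 * (m + 4)) ^ (m + 4) < (2 * (m + 4) + 1) ^ (m + 4) :=
        Nat.pow_lt_pow_left (by omega) (by omega)
      refine lt_of_le_of_lt ?_ a1
      have : (2 * (m + 4)) ^ (m + 4) = (16 * 2 ^ m * (m + 4)) * (m + 4) ^ (m + 3) := by
        rw [mul_pow]; ring
      rw [this]
      apply Nat.mul_le_mul_right
      nlinarith
  refine key.trans_le ?_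
  rw [Nat.le_div_iff_mul_le (by omega)]
  obtain ⟨m, rfl⟩ : ∃ m, l = m + 3 := ⟨l - 3, by omega⟩
  have e1 : 2 * (m + 3) - 1 = 2 * m + 5 := by omega
  have e2 : 2 * (m + 3) - 2 = 2 * m + 4 := by omega
  have e3 : m + 3 - 1 = m + 2 := by omega
  rw [e1, e2, e3]
  have : (2 * m + 5) ^ (m + 3) = (2 * m + 5) ^ (m + 2) * (2 * m + 4) + (2 * m + 5) ^ (m + 2) := by ring
  have hp : 0 < (2 * m + 5) ^ (m + 2) := by positivity
  omega

lemma core {P R : Finset Pt} {l : ℕ} (hl : 3 ≤ l) (NH : NoHole P) (NC : NoCol P l)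
    (hcl : ClosedIn P R) (h1 : ((2 * l - 1) ^ l - 1) / (2 * l - 2) ≤ (lay R).card)
    (h2 : (lay (peel R)).card < ((2 * l - 1) ^ l - 1) / (2 * l - 2)) : False := by
  rcases (Ps R (l - 1)).eq_empty_or_nonempty with h | ⟨z, hz⟩
  · have e : l - 1 = (l - 2) + 1 := by omega
    rw [e] at h
    have := bound hl NH NC (l - 2) R hcl h
    have := arith hl
    omega
  · have := start hl NH NC hcl hz
    omega
lemma minim {P : Finset Pt} {l : ℕ} (hl : 3 ≤ l) (NH : NoHole P) (NC : NoCol P l)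
    {S0 : Finset Pt} (hS0 : S0 ⊆ P) (hc : ((2 * l - 1) ^ l - 1) / (2 * l - 2) ≤ S0.card)
    (hi : ∀ p ∈ S0, p ∉ interior (convexHull ℝ (S0 : Set Pt))) : False := by
  classical
  set k := ((2 * l - 1) ^ l - 1) / (2 * l - 2) with hk
  have hk0 : 0 < k := lt_of_le_of_lt (Nat.zero_le _) (arith hl)
  obtain ⟨S, hS, hmin⟩ := Finset.exists_min_image
    (P.powerset.filter (fun S : Finset Pt => k ≤ S.card ∧ ∀ p ∈ S, p ∉ interior (convexHull ℝ (S : Set Pt))))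
    (fun S : Finset Pt => (P.filter (fun p => p ∈ convexHull ℝ (S : Set Pt))).card)
    ⟨S0, by simp only [Finset.mem_filter, Finset.mem_powerset]; exact ⟨hS0, hc, hi⟩⟩
  simp only [Finset.mem_filter, Finset.mem_powerset] at hS hmin
  obtain ⟨hSP, hSk, hSi⟩ := hS
  set R := P.filter (fun p => p ∈ convexHull ℝ (S : Set Pt)) with hR
  have hSR : S ⊆ R := fun p hp => Finset.mem_filter.2 ⟨hSP hp, subset_convexHull ℝ _ hp⟩
  have hhull : convexHull ℝ (R : Set Pt) = convexHull ℝ (S : Set Pt) := by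
    apply subset_antisymm
    · exact convexHull_min (fun p hp => (Finset.mem_filter.1 hp).2) (convex_convexHull ℝ _)
    · exact convexHull_mono (Finset.coe_subset.2 hSR)
  have hcl : ClosedIn P R := ⟨Finset.filter_subset _ _, fun p hp h =>
    Finset.mem_filter.2 ⟨hp, hhull ▸ h⟩⟩
  have hlay : S ⊆ lay R := fun p hp => mem_lay.2 ⟨hSR hp, by rw [hhull]; exact hSi p hp⟩
  have h1 := hSk.trans (Finset.card_le_card hlay)
  refine core hl NH NC hcl h1 ?_
  by_contra! h2
  have := hmin (lay (peel R)) ⟨fun p hp => hcl.1 (peel_sub _ (mem_lay.1 hp).1), h2, fun p hp => by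
    rw [hull_lay]; exact (mem_lay.1 hp).2⟩
  apply absurd this
  push Not
  apply Finset.card_lt_card
  rw [hull_lay]
  obtain ⟨p, hp⟩ := Finset.card_pos.1 (lt_of_lt_of_le hk0 h1)
  refine Finset.ssubset_iff_subset_ne.2 ⟨?_, ?_⟩
  · intro q hq
    rw [Finset.mem_filter] at hq
    exact hcl.2 q hq.1 (interior_subset (hull_peel R hq.2))
  · intro he
    have hpR := (mem_lay.1 hp).1
    rw [← he, Finset.mem_filter] at hpR
    exact (mem_lay.1 hp).2 (hull_peel R hpR.2)

lemma noCol_of {P : Finset Pt} {l : ℕ} (h : ¬ HasCollinear P l) : NoCol P l := by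
  intro a b hab S hS h0
  by_contra! hc
  obtain ⟨X, hX, hXc⟩ := Finset.exists_subset_card_eq hc
  exact h ⟨X, hX.trans hS, hXc, collinear_of_cr hab (fun q hq => h0 q (hX hq))⟩
def crs (a b c d : Pt) : ℝ := (b 0 - a 0) * (d 1 - c 1) - (b 1 - a 1) * (d 0 - c 0)

lemma exists_u (P : Finset Pt) : ∃ ε : ℝ, ∀ p ∈ P, ∀ q ∈ P, p 0 + ε * p 1 = q 0 + ε * q 1 → p = q := by
  classical
  obtain ⟨ε, hε⟩ := Infinite.exists_notMem_finset
    ((P ×ˢ P).image (fun e : Pt × Pt => (e.2 0 - e.1 0) / (e.1 1 - e.2 1)))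
  refine ⟨ε, fun p hp q hq h => ?_⟩
  by_cases h1 : p 1 = q 1
  · rw [h1] at h
    exact pt_ext (by linarith) h1
  · exfalso
    apply hε
    rw [Finset.mem_image]
    refine ⟨(p, q), Finset.mem_product.2 ⟨hp, hq⟩, ?_⟩
    have : p 1 - q 1 ≠ 0 := sub_ne_zero.2 h1
    simp only
    field_simp
    linarith

structure Cup (σ ε : ℝ) (C : Finset Pt) (a b : Pt) (n : ℕ) : Prop where
  card : C.card = n
  ha : a ∈ C
  hb : b ∈ C
  lt : a 0 + ε * a 1 < b 0 + ε * b 1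
  le : ∀ p ∈ C, p 0 + ε * p 1 ≤ b 0 + ε * b 1
  sup : ∀ p ∈ C, 0 ≤ σ * cr a b p
  all : ∀ p ∈ C, ∃ e f : Pt, e 0 + ε * e 1 < f 0 + ε * f 1 ∧ (∀ q ∈ C, 0 ≤ σ * cr e f q) ∧
    cr e f p = 0 ∧ 0 ≤ σ * crs e f a b

lemma Cup.base {σ ε : ℝ} {a b : Pt} (h : a 0 + ε * a 1 < b 0 + ε * b 1) :
    Cup σ ε {a, b} a b 2 := by
  have hab : a ≠ b := by rintro rfl; exact lt_irrefl _ h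
  refine ⟨Finset.card_pair hab, by simp, by simp, h, ?_, ?_, ?_⟩
  · intro p hp
    simp only [Finset.mem_insert, Finset.mem_singleton] at hp
    rcases hp with rfl | rfl
    · exact h.le
    · exact le_rfl
  · intro p hp
    simp only [Finset.mem_insert, Finset.mem_singleton] at hp
    rcases hp with rfl | rfl
    · rw [cr_self3]; simp
    · rw [cr_self2]; simp
  · intro p hp
    refine ⟨a, b, h, ?_, ?_, ?_⟩
    · intro q hq
      simp only [Finset.mem_insert, Finset.mem_singleton] at hq
      rcases hq with rfl | rfl
      · rw [cr_self3]; simp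
      · rw [cr_self2]; simp
    · simp only [Finset.mem_insert, Finset.mem_singleton] at hp
      rcases hp with rfl | rfl
      · exact cr_self3 _ _
      · exact cr_self2 _ _
    · have : crs a b a b = 0 := by unfold crs; ring
      rw [this]; simp

lemma Cup.extend {σ ε : ℝ} {C : Finset Pt} {a b c : Pt} {n : ℕ} (h : Cup σ ε C a b n)
    (hbc : b 0 + ε * b 1 < c 0 + ε * c 1) (hc : 0 < σ * cr a b c) :
    Cup σ ε (insert c C) b c (n + 1) := by
  have hcC : c ∉ C := fun hh => by linarith [h.le c hh]
  have hab := h.lt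
  have hs : ∀ p ∈ C, 0 ≤ σ * cr b c p := by
    intro p hp
    have h1 := h.sup p hp
    have h2 := h.le p hp
    have e : (b 0 + ε * b 1 - (a 0 + ε * a 1)) * (σ * cr b c p) =
      (c 0 + ε * c 1 - (b 0 + ε * b 1)) * (σ * cr a b p) +
      (b 0 + ε * b 1 - (p 0 + ε * p 1)) * (σ * cr a b c) := by unfold cr; ring
    have : 0 ≤ (b 0 + ε * b 1 - (a 0 + ε * a 1)) * (σ * cr b c p) := by
      rw [e]
      have := mul_nonneg (by linarith : 0 ≤ c 0 + ε * c 1 - (b 0 + ε * b 1)) h1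
      have := mul_nonneg (by linarith : 0 ≤ b 0 + ε * b 1 - (p 0 + ε * p 1)) hc.le
      linarith
    exact nonneg_of_mul_nonneg_right this (by linarith)
  have hs' : ∀ p ∈ insert c C, 0 ≤ σ * cr b c p := by
    intro p hp
    rcases Finset.mem_insert.1 hp with rfl | hp
    · rw [cr_self2]; simp
    · exact hs p hp
  refine ⟨by rw [Finset.card_insert_of_notMem hcC, h.card], Finset.mem_insert_of_mem h.hb,
    Finset.mem_insert_self _ _, hbc, ?_, hs', ?_⟩
  · intro p hp
    rcases Finset.mem_insert.1 hp with rfl | hp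
    · exact le_rfl
    · linarith [h.le p hp]
  · intro p hp
    rcases Finset.mem_insert.1 hp with rfl | hp
    · refine ⟨b, p, hbc, hs', cr_self2 _ _, ?_⟩
      have : crs b p b p = 0 := by unfold crs; ring
      rw [this]; simp
    · obtain ⟨e, f, hef, h1, h2, h3⟩ := h.all p hp
      have key : 0 ≤ σ * crs e f b c := by
        have e1 : (b 0 + ε * b 1 - (a 0 + ε * a 1)) * (σ * crs e f b c) =
          (c 0 + ε * c 1 - (b 0 + ε * b 1)) * (σ * crs e f a b) +
          (f 0 + ε * f 1 - (e 0 + ε * e 1)) * (σ * cr a b c) := by unfold cr crs; ring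
        have : 0 ≤ (b 0 + ε * b 1 - (a 0 + ε * a 1)) * (σ * crs e f b c) := by
          rw [e1]
          have := mul_nonneg (by linarith : 0 ≤ c 0 + ε * c 1 - (b 0 + ε * b 1)) h3
          have := mul_nonneg (by linarith : 0 ≤ f 0 + ε * f 1 - (e 0 + ε * e 1)) hc.le
          linarith
        exact nonneg_of_mul_nonneg_right this (by linarith)
      refine ⟨e, f, hef, ?_, h2, key⟩
      intro q hq
      rcases Finset.mem_insert.1 hq with rfl | hq
      · have e2 : σ * cr e f q = σ * cr e f b + σ * crs e f b q := by unfold cr crs; ring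
        rw [e2]
        linarith [h1 b h.hb]
      · exact h1 q hq

lemma Cup.not_int {σ ε : ℝ} (hσ : σ ≠ 0) {C : Finset Pt} {a b : Pt} {n : ℕ} (h : Cup σ ε C a b n) :
    ∀ p ∈ C, p ∉ interior (convexHull ℝ (C : Set Pt)) := by
  intro p hp hi
  obtain ⟨e, f, hef, h1, h2, -⟩ := h.all p hp
  have hne : e ≠ f := by rintro rfl; exact lt_irrefl _ hef
  rcases lt_or_gt_of_ne hσ with hs | hs
  · have := cr_gt_int hne.symm (cr_ge_hull (S := C) (a := f) (b := e) (fun q hq => by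
      rw [cr_flip]
      have := h1 q hq
      nlinarith)) hi
    rw [cr_flip, h2] at this; simp at this
  · have := cr_gt_int hne (cr_ge_hull (S := C) (a := e) (b := f) (fun q hq => by
      exact nonneg_of_mul_nonneg_right (h1 q hq) hs)) hi
    linarith

lemma frontier_of_not_int {S : Finset Pt} (h : ∀ p ∈ S, p ∉ interior (convexHull ℝ (S : Set Pt))) :
    ConvexPos S := fun p hp =>
  ⟨subset_closure (subset_convexHull ℝ _ hp), h p hp⟩

lemma ES_exists (k : ℕ) (hk : 2 ≤ k) (P : Finset Pt) (hG : GenPos P) (hn : 2 ^ (k * k) + 1 ≤ P.card) :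
    HasConvex P k := by
  classical
  by_contra hno
  obtain ⟨ε, hε⟩ := exists_u P
  set u : Pt → ℝ := fun p => p 0 + ε * p 1 with hu
  have hno' : ∀ σ : ℝ, σ ≠ 0 → ∀ a b, ¬ ∃ C ⊆ P, Cup σ ε C a b k := by
    rintro σ hσ a b ⟨C, hC, h⟩
    exact hno ⟨C, hC, h.card, frontier_of_not_int (h.not_int hσ)⟩
  set F : ℝ → Pt → Pt → ℕ := fun σ a b => Nat.findGreatest (fun n => ∃ C ⊆ P, Cup σ ε C a b n) k with hF
  have F1 : ∀ σ a b, a ∈ P → b ∈ P → u a < u b → ∃ C ⊆ P, Cup σ ε C a b (F σ a b) := by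
    intro σ a b ha hb hab
    exact Nat.findGreatest_spec (P := fun n => ∃ C ⊆ P, Cup σ ε C a b n) hk
      ⟨{a, b}, by intro t ht; simp at ht; rcases ht with rfl | rfl <;> assumption, Cup.base hab⟩
  have F2 : ∀ σ, σ ≠ 0 → ∀ a b, a ∈ P → b ∈ P → u a < u b → F σ a b < k := by
    intro σ hσ a b ha hb hab
    refine lt_of_le_of_ne (Nat.findGreatest_le _) fun h => ?_
    have := F1 σ a b ha hb hab
    rw [h] at this
    exact hno' σ hσ a b this
  have F3 : ∀ σ, σ ≠ 0 → ∀ a b c, a ∈ P → b ∈ P → c ∈ P → u a < u b → u b < u c →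
      0 < σ * cr a b c → F σ a b < F σ b c := by
    intro σ hσ a b c ha hb hc hab hbc h
    obtain ⟨C, hC, hcup⟩ := F1 σ a b ha hb hab
    exact Nat.le_findGreatest (F2 σ hσ a b ha hb hab)
      ⟨insert c C, Finset.insert_subset hc hC, hcup.extend hbc h⟩
  have key : ∀ a b c, a ∈ P → b ∈ P → c ∈ P → u a < u b → u b < u c →
      (F 1 a b, F (-1) a b) ≠ (F 1 b c, F (-1) b c) := by
    intro a b c ha hb hc hab hbc he
    rw [Prod.mk.injEq] at he
    have h1 : a ≠ b := by rintro rfl; exact lt_irrefl _ hab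
    have h2 : b ≠ c := by rintro rfl; exact lt_irrefl _ hbc
    have h3 : a ≠ c := by rintro rfl; exact lt_irrefl _ (hab.trans hbc)
    rcases lt_trichotomy (cr a b c) 0 with h | h | h
    · have := F3 (-1) (by norm_num) a b c ha hb hc hab hbc (by linarith)
      omega
    · refine hG {a, b, c} ?_ (Finset.card_eq_three.2 ⟨a, b, c, h1, h3, h2, rfl⟩)
        (collinear_of_cr h1 ?_)
      · intro t ht; simp at ht; rcases ht with rfl | rfl | rfl <;> assumption
      · intro t ht
        simp at ht
        rcases ht with rfl | rfl | rfl
        · exact cr_self3 _ _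
        · exact cr_self2 _ _
        · exact h
    · have := F3 1 (by norm_num) a b c ha hb hc hab hbc (by linarith)
      omega
  set G : Pt → Finset (ℕ × ℕ) := fun b => (P.filter (fun a => u a < u b)).image
    (fun a => (F 1 a b, F (-1) a b)) with hGdef
  have hmaps : ∀ b ∈ P, G b ∈ (Finset.range k ×ˢ Finset.range k).powerset := by
    intro b hb
    rw [Finset.mem_powerset]
    intro e he
    obtain ⟨a, ha, rfl⟩ := Finset.mem_image.1 he
    rw [Finset.mem_filter] at ha
    rw [Finset.mem_product, Finset.mem_range, Finset.mem_range]
    exact ⟨F2 1 (by norm_num) a b ha.1 hb ha.2, F2 (-1) (by norm_num) a b ha.1 hb ha.2⟩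
  have hlt : ∀ b ∈ P, ∀ c ∈ P, u b < u c → G b ≠ G c := by
    intro b hb c hc hbc he
    have : (F 1 b c, F (-1) b c) ∈ G c := Finset.mem_image.2 ⟨b, Finset.mem_filter.2 ⟨hb, hbc⟩, rfl⟩
    rw [← he] at this
    obtain ⟨a, ha, h⟩ := Finset.mem_image.1 this
    rw [Finset.mem_filter] at ha
    exact key a b c ha.1 hb hc ha.2 hbc h
  have hcard : (Finset.range k ×ˢ Finset.range k).powerset.card < P.card := by
    rw [Finset.card_powerset, Finset.card_product, Finset.card_range]; omega
  obtain ⟨b, hb, c, hc, hbc, he⟩ := Finset.exists_ne_map_eq_of_card_lt_of_maps_to hcard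
    (f := G) hmaps
  rcases lt_trichotomy (u b) (u c) with h | h | h
  · exact hlt b hb c hc h he
  · exact hbc (hε b hb c hc h)
  · exact hlt c hc b hb h he.symm

lemma ES_spec (k : ℕ) (hk : 2 ≤ k) (P : Finset Pt) (hG : GenPos P) (hn : ES k ≤ P.card) :
    HasConvex P k :=
  Nat.sInf_mem (s := {n : ℕ | ∀ P : Finset Pt, GenPos P → n ≤ P.card → HasConvex P k})
    ⟨2 ^ (k * k) + 1, fun P hG hn => ES_exists k hk P hG hn⟩ P hG hn
open Filter Topology in
lemma quad_ev {A B C : ℝ} (hC : C ≠ 0) : ∀ᶠ ε in 𝓝[>] (0:ℝ), A + ε * B + ε ^ 2 * C ≠ 0 := by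
  have hpos : ∀ᶠ ε in 𝓝[>] (0:ℝ), 0 < ε := eventually_mem_nhdsWithin
  by_cases hA : A = 0
  · by_cases hB : B = 0
    · filter_upwards [hpos] with ε h
      rw [hA, hB]; simp [h.ne', hC]
    · have hc : ContinuousAt (fun ε : ℝ => B + ε * C) 0 := by fun_prop
      have h1 := (hc.eventually_ne (y := 0) (by simpa using hB)).filter_mono (nhdsWithin_le_nhds (s := Set.Ioi 0))
      filter_upwards [hpos, h1] with ε h h2
      have : A + ε * B + ε ^ 2 * C = ε * (B + ε * C) := by rw [hA]; ring
      rw [this]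
      exact mul_ne_zero h.ne' h2
  · have hc : ContinuousAt (fun ε : ℝ => A + ε * B + ε ^ 2 * C) 0 := by fun_prop
    exact (hc.eventually_ne (y := 0) (by simpa using hA)).filter_mono nhdsWithin_le_nhds

lemma norm_le_abs (a b : ℝ) : ‖(!₂[a, b] : Pt)‖ ≤ |a| + |b| := by
  rw [EuclideanSpace.norm_eq]
  apply Real.sqrt_le_iff.2
  refine ⟨by positivity, ?_⟩
  simp [Fin.sum_univ_two]
  nlinarith [abs_nonneg a, abs_nonneg b, sq_abs a, sq_abs b, mul_nonneg (abs_nonneg a) (abs_nonneg b)]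

lemma exists_box {S : Set Pt} {p : Pt} (hp : p ∈ interior S) :
    ∃ r : ℝ, 0 < r ∧ ∀ a b : ℝ, |a| ≤ r → |b| ≤ r → p + (!₂[a, b] : Pt) ∈ S := by
  obtain ⟨r, hr, h⟩ := Metric.isOpen_iff.1 isOpen_interior p hp
  refine ⟨r / 3, by positivity, fun a b ha hb => interior_subset (h ?_)⟩
  rw [Metric.mem_ball, dist_eq_norm]
  have := norm_le_abs a b
  have e : p + (!₂[a, b] : Pt) - p = !₂[a, b] := by abel
  rw [e]; linarith

lemma weak_support {S : Set Pt} {p : Pt} (hpS : p ∈ S) (hp : p ∉ interior (convexHull ℝ S)) :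
    ∃ a b : ℝ, (a ≠ 0 ∨ b ≠ 0) ∧ ∀ q ∈ S, a * q 0 + b * q 1 ≤ a * p 0 + b * p 1 := by
  by_cases hne : (interior (convexHull ℝ S)).Nonempty
  · obtain ⟨a, b, h, -, h2⟩ := support hne hp
    exact ⟨a, b, h, fun q hq => h2 q (subset_convexHull ℝ _ hq)⟩
  · obtain ⟨a, b, hab, h⟩ := exists_line_of_interior_empty hne
    refine ⟨-(b 1 - a 1), b 0 - a 0, ?_, fun q hq => ?_⟩
    · rcases pt_ne hab.symm with h | h
      · right; exact h
      · left; exact neg_ne_zero.2 h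
    · have h1 := h q hq
      have h2 := h p hpS
      rw [cr_lin] at h1 h2
      linarith

lemma stable {S : Finset Pt} {p : Pt} (v : Pt → Pt) (hpS : p ∈ S)
    (hp : p ∈ interior (convexHull ℝ (S : Set Pt))) :
    ∃ δ : ℝ, 0 < δ ∧ ∀ ε : ℝ, 0 < ε → ε < δ →
      p + ε • v p ∈ interior (convexHull ℝ ((fun q => q + ε • v q) '' (S : Set Pt))) := by
  obtain ⟨r, hr, hbox⟩ := exists_box hp
  set M : ℝ := ∑ q ∈ S, (|v q 0| + |v q 1|) with hM
  have hMq : ∀ q ∈ S, |v q 0| + |v q 1| ≤ M := fun q hq =>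
    Finset.single_le_sum (f := fun q => |v q 0| + |v q 1|) (fun q _ => by positivity) hq
  have hM0 : 0 ≤ M := Finset.sum_nonneg (fun q _ => by positivity)
  refine ⟨r / (2 * M + 1), by positivity, fun ε hε hεδ => ?_⟩
  rw [lt_div_iff₀ (by positivity)] at hεδ
  by_contra hn
  obtain ⟨a, b, hab, h⟩ := weak_support (Set.mem_image_of_mem _ hpS) hn
  have hpos : 0 < |a| + |b| := by
    rcases hab with h | h
    · have := abs_pos.2 h; positivity
    · have := abs_pos.2 h; positivity
  have hle : ∀ q ∈ S, a * q 0 + b * q 1 ≤ a * p 0 + b * p 1 + ε * (2 * M) * (|a| + |b|) := by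
    intro q hq
    have h1 := h _ (Set.mem_image_of_mem _ hq)
    simp only [PiLp.add_apply, PiLp.smul_apply, smul_eq_mul] at h1
    have bd : ∀ q ∈ S, |a * v q 0 + b * v q 1| ≤ M * (|a| + |b|) := by
      intro q hq
      have h0 := hMq q hq
      calc _ ≤ |a * v q 0| + |b * v q 1| := abs_add_le _ _
        _ = |a| * |v q 0| + |b| * |v q 1| := by rw [abs_mul, abs_mul]
        _ ≤ |a| * M + |b| * M := by
          have := abs_nonneg (v q 0); have := abs_nonneg (v q 1)
          gcongr <;> linarith
        _ = _ := by ring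
    have b1 := abs_le.1 (bd p hpS)
    have b2 := abs_le.1 (bd q hq)
    nlinarith [mul_le_mul_of_nonneg_left b1.2 hε.le, mul_le_mul_of_nonneg_left b2.1 hε.le]
  have hq := hbox (r * SignType.sign a) (r * SignType.sign b) (by
      rw [abs_mul, abs_of_pos hr]
      rcases lt_trichotomy a 0 with h | h | h <;> simp [h, hr.le]) (by
      rw [abs_mul, abs_of_pos hr]
      rcases lt_trichotomy b 0 with h | h | h <;> simp [h, hr.le])
  have h3 := lin_ge_hull (S := S) (a := -a) (b := -b)
    (c := -(a * p 0 + b * p 1 + ε * (2 * M) * (|a| + |b|))) (fun q hq => by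
      have := hle q hq; linarith) _ hq
  simp at h3
  have e1 : a * (SignType.sign a : ℝ) = |a| := by rw [mul_comm]; exact sign_mul_self a
  have e2 : b * (SignType.sign b : ℝ) = |b| := by rw [mul_comm]; exact sign_mul_self b
  have e3 : r * (|a| + |b|) ≤ ε * (2 * M) * (|a| + |b|) := by
    rw [← e1, ← e2] at h3 ⊢; nlinarith
  have := le_of_mul_le_mul_right e3 hpos
  linarith

open Filter Topology in
lemma weakES (k : ℕ) (hk : 2 ≤ k) (P : Finset Pt) (hn : ES k ≤ P.card) :
    ∃ S ⊆ P, S.card = k ∧ ∀ p ∈ S, p ∉ interior (convexHull ℝ (S : Set Pt)) := by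
  classical
  by_contra! hno
  obtain ⟨θ, hθ⟩ := exists_u P
  set u : Pt → ℝ := fun p => p 0 + θ * p 1 with hu
  set v : Pt → Pt := fun p => !₂[u p, u p ^ 2] with hv
  have v0 : ∀ p, v p 0 = u p := fun p => by simp [hv]
  have v1 : ∀ p, v p 1 = u p ^ 2 := fun p => by simp [hv]
  have E1 : ∀ S ∈ P.powerset, S.card = k → ∀ᶠ ε in 𝓝[>] (0:ℝ), ∃ p ∈ S,
      p + ε • v p ∈ interior (convexHull ℝ ((fun q => q + ε • v q) '' (S : Set Pt))) := by
    intro S hS hc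
    obtain ⟨p, hp, hpi⟩ := hno S (Finset.mem_powerset.1 hS) hc
    obtain ⟨δ, hδ, h⟩ := stable v hp hpi
    filter_upwards [Ioo_mem_nhdsGT hδ] with ε hε
    exact ⟨p, hp, h ε hε.1 hε.2⟩
  have E2 : ∀ a ∈ P, ∀ b ∈ P, ∀ c ∈ P, a ≠ b → b ≠ c → a ≠ c →
      ∀ᶠ ε in 𝓝[>] (0:ℝ), cr (a + ε • v a) (b + ε • v b) (c + ε • v c) ≠ 0 := by
    intro a ha b hb c hc hab hbc hac
    have n1 : u b - u a ≠ 0 := fun h => hab (hθ a ha b hb (by simp only [hu] at h; linarith))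
    have n2 : u c - u b ≠ 0 := fun h => hbc (hθ b hb c hc (by simp only [hu] at h; linarith))
    have n3 : u c - u a ≠ 0 := fun h => hac (hθ a ha c hc (by simp only [hu] at h; linarith))
    have := quad_ev (A := cr a b c) (B := (b 0 - a 0) * (u c ^ 2 - u a ^ 2) + (u b - u a) * (c 1 - a 1)
      - (b 1 - a 1) * (u c - u a) - (u b ^ 2 - u a ^ 2) * (c 0 - a 0))
      (C := (u b - u a) * (u c - u a) * (u c - u b)) (mul_ne_zero (mul_ne_zero n1 n3) n2)
    filter_upwards [this] with ε h
    convert h using 1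
    unfold cr
    simp only [PiLp.add_apply, PiLp.smul_apply, smul_eq_mul, v0, v1]
    ring
  have E3 : ∀ a ∈ P, ∀ b ∈ P, a ≠ b → ∀ᶠ ε in 𝓝[>] (0:ℝ), a + ε • v a ≠ b + ε • v b := by
    intro a _ b _ hab
    have ca : Tendsto (fun ε : ℝ => a + ε • v a) (𝓝[>] 0) (𝓝 a) := by
      have : ContinuousAt (fun ε : ℝ => a + ε • v a) 0 := by fun_prop
      have := this.tendsto
      simp only [zero_smul, add_zero] at this
      exact this.mono_left nhdsWithin_le_nhds
    have cb : Tendsto (fun ε : ℝ => b + ε • v b) (𝓝[>] 0) (𝓝 b) := by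
      have : ContinuousAt (fun ε : ℝ => b + ε • v b) 0 := by fun_prop
      have := this.tendsto
      simp only [zero_smul, add_zero] at this
      exact this.mono_left nhdsWithin_le_nhds
    have h0 := (ca.sub cb).eventually_ne (sub_ne_zero.2 hab)
    filter_upwards [h0] with ε h
    exact sub_ne_zero.1 h
  have E1' := (Filter.eventually_all_finset P.powerset).2 (fun S hS =>
    eventually_imp_distrib_left.2 (E1 S hS))
  have E2' := (Filter.eventually_all_finset P).2 (fun a ha =>
    (Filter.eventually_all_finset P).2 (fun b hb => (Filter.eventually_all_finset P).2 (fun c hc =>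
    eventually_imp_distrib_left.2 fun h1 => eventually_imp_distrib_left.2 fun h2 =>
    eventually_imp_distrib_left.2 fun h3 => E2 a ha b hb c hc h1 h2 h3)))
  have E3' := (Filter.eventually_all_finset P).2 (fun a ha =>
    (Filter.eventually_all_finset P).2 (fun b hb => 
    eventually_imp_distrib_left.2 fun h1 => E3 a ha b hb h1))
  obtain ⟨ε, h1, h2, h3⟩ := (E1'.and (E2'.and E3')).exists
  set φ : Pt → Pt := fun q => q + ε • v q with hφ
  have hinj : Set.InjOn φ (P : Set Pt) := by
    intro a ha b hb he
    by_contra hab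
    exact h3 a ha b hb hab he
  obtain ⟨S', hS', hc, hconv⟩ := ES_spec k hk (P.image φ) (by
    intro X hX hXc hcol
    obtain ⟨x, y, z, hxy, hxz, hyz, rfl⟩ := Finset.card_eq_three.1 hXc
    obtain ⟨a, ha, rfl⟩ := Finset.mem_image.1 (hX (show x ∈ _ by simp))
    obtain ⟨b, hb, rfl⟩ := Finset.mem_image.1 (hX (show y ∈ _ by simp))
    obtain ⟨c, hc, rfl⟩ := Finset.mem_image.1 (hX (show z ∈ _ by simp))
    exact h2 a ha b hb c hc (fun h => hxy (by rw [h])) (fun h => hyz (by rw [h]))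
      (fun h => hxz (by rw [h])) (cr_of_collinear hcol (by simp [hφ]) (by simp [hφ]) (by simp [hφ])))
    (by rw [Finset.card_image_of_injOn hinj]; exact hn)
  obtain ⟨S, hS, rfl⟩ := Finset.subset_image_iff.1 hS'
  rw [Finset.card_image_of_injOn (hinj.mono (by exact_mod_cast hS))] at hc
  obtain ⟨p, hp, hpi⟩ := h1 S (Finset.mem_powerset.2 (by exact_mod_cast hS)) hc
  have := hconv (φ p) (Finset.mem_image_of_mem _ hp)
  rw [Finset.coe_image] at this
  exact this.2 hpi

theorem stmt2 (l : ℕ) (hl : 2 ≤ l) (P : Finset Pt)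
    (hP : ES (((2 * l - 1) ^ l - 1) / (2 * l - 2)) ≤ P.card) :
    HasCollinear P l ∨ ∃ X : Finset Pt, IsHole P X 5 := by
  rcases hl.eq_or_lt with rfl | hl3
  · left
    obtain ⟨S, hS, hc, -⟩ := weakES _ (by norm_num) P hP
    norm_num at hc
    obtain ⟨X, hX, hXc⟩ := Finset.exists_subset_card_eq (show 2 ≤ S.card by omega)
    refine ⟨X, hX.trans hS, hXc, ?_⟩
    obtain ⟨a, b, -, rfl⟩ := Finset.card_eq_two.1 hXc
    rw [Finset.coe_pair]
    exact collinear_pair ℝ a b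
  · by_contra! h
    have hk := arith hl3
    have h2 : 2 ≤ ((2 * l - 1) ^ l - 1) / (2 * l - 2) := by
      have : 1 ≤ 2 * (4 + 12 * (l - 3)) * (l - 1) ^ (l - 2) :=
        Nat.mul_pos (by omega) (pow_pos (by omega) _)
      omega
    obtain ⟨S, hS, hc, hi⟩ := weakES _ h2 P hP
    exact minim hl3 (fun ⟨X, hX⟩ => h.2 X hX) (noCol_of h.1) hS hc.ge hi
end

section
/- For every integer ℓ there exists an integer n such that every finite set of at least n points in the plane contains ℓ collinear points or 5 pairwise visible points (that is, the visibility graph of the set contains a 5-clique). -/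
namespace BLBC
open Finset
open scoped Classical

abbrev E := ℝ × ℝ

noncomputable section

/-- cross product relative to a base point -/
def cr (z a b : E) : ℝ := (a.1 - z.1) * (b.2 - z.2) - (a.2 - z.2) * (b.1 - z.1)

def dt (n a : E) : ℝ := n.1 * a.1 + n.2 * a.2

def mix (t : ℝ) (a b : E) : E := ((1 - t) * a.1 + t * b.1, (1 - t) * a.2 + t * b.2)

def IsBd (S : Finset E) (b : E) : Prop := ∃ n : E, n ≠ 0 ∧ ∀ s ∈ S, dt n s ≤ dt n b

def bd (S : Finset E) : Finset E := S.filter (fun b => IsBd S b)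

def inr (S : Finset E) : Finset E := S.filter (fun b => ¬ IsBd S b)

def Vis (S : Finset E) (a b : E) : Prop := ∀ s ∈ S, ∀ t : ℝ, 0 < t → t < 1 → s = mix t a b → False

def OnLine (o d : E) (T : Finset E) : Prop := ∀ s ∈ T, ∃ t : ℝ, s = mix t o d

def NoCol (l : ℕ) (S : Finset E) : Prop := ∀ T ⊆ S, ∀ o d : E, OnLine o d T → T.card < l

def NoK5 (S : Finset E) : Prop :=
  ∀ T ⊆ S, T.card = 5 → ∃ v ∈ T, ∃ w ∈ T, v ≠ w ∧ ¬ Vis S v w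

lemma dt_mix (n : E) (t : ℝ) (a b : E) : dt n (mix t a b) = (1 - t) * dt n a + t * dt n b := by
  simp only [dt, mix]; ring

lemma cr_mix_left (z : E) (t : ℝ) (a b c : E) :
    cr z (mix t a b) c = (1 - t) * cr z a c + t * cr z b c := by
  simp only [cr, mix]; ring

lemma cr_mix_right (z : E) (t : ℝ) (a b c : E) :
    cr z c (mix t a b) = (1 - t) * cr z c a + t * cr z c b := by
  simp only [cr, mix]; ring

lemma cr_self (z a : E) : cr z a a = 0 := by simp only [cr]; ring
lemma cr_zl (z a : E) : cr z z a = 0 := by simp only [cr]; ring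
lemma cr_zr (z a : E) : cr z a z = 0 := by simp only [cr]; ring
lemma cr_swap (z a b : E) : cr z a b = - cr z b a := by simp only [cr]; ring

lemma cramer (n z p q s : E) :
    cr z p q * (dt n s - dt n z) = cr z s q * (dt n p - dt n z) + cr z p s * (dt n q - dt n z) := by
  simp only [cr, dt]; ring

lemma plucker (z a b c d : E) :
    cr z a c * cr z b d = cr z a b * cr z c d + cr z a d * cr z b c := by
  simp only [cr]; ring

lemma vis_symm {S : Finset E} {a b : E} (h : Vis S a b) : Vis S b a := by
  intro s hs t h0 h1 he
  refine h s hs (1 - t) (by linarith) (by linarith) ?_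
  rw [he]; ext <;> simp [mix] <;> ring

lemma mem_bd {S : Finset E} {b : E} : b ∈ bd S ↔ b ∈ S ∧ IsBd S b := by simp [bd]
lemma mem_inr {S : Finset E} {b : E} : b ∈ inr S ↔ b ∈ S ∧ ¬ IsBd S b := by simp [inr]
lemma inr_sub (S : Finset E) : inr S ⊆ S := filter_subset _ _
lemma bd_sub (S : Finset E) : bd S ⊆ S := filter_subset _ _

lemma inr_lt {S : Finset E} {z : E} (hz : z ∈ inr S) {n : E} (hn : n ≠ 0) :
    ∃ b ∈ bd S, dt n z < dt n b := by
  obtain ⟨hzS, hz⟩ := mem_inr.1 hz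
  obtain ⟨b, hb, hmax⟩ := S.exists_max_image (dt n) ⟨z, hzS⟩
  refine ⟨b, mem_bd.2 ⟨hb, n, hn, hmax⟩, ?_⟩
  by_contra hcon
  exact hz ⟨n, hn, fun s hs => (hmax s hs).trans (not_lt.1 hcon)⟩

lemma inr_strict {S : Finset E} {b n : E} (hn : n ≠ 0) (h : ∀ s ∈ S, dt n s ≤ dt n b)
    {t : E} (ht : t ∈ inr S) : dt n t < dt n b := by
  obtain ⟨c, hc, hlt⟩ := inr_lt ht hn
  exact hlt.trans_le (h c (bd_sub S hc))

/-- outward normal of the line pq -/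
def nrm (p q : E) : E := (q.2 - p.2, p.1 - q.1)

lemma nrm_dt (z p q s : E) : dt (nrm p q) s - dt (nrm p q) z = cr z s q + cr z p s := by
  simp only [dt, nrm, cr]; ring

lemma nrm_ne {z p q : E} (h : cr z p q ≠ 0) : nrm p q ≠ 0 := by
  intro h0
  apply h
  have h1 : q.2 - p.2 = 0 := congrArg Prod.fst h0
  have h2 : p.1 - q.1 = 0 := congrArg Prod.snd h0
  have e1 : q.2 = p.2 := by linarith
  have e2 : q.1 = p.1 := by linarith
  simp only [cr, e1, e2]; ring

lemma support {T : Finset E} {z p q : E} (hz : z ∈ inr T) (hp : p ∈ bd T) (hq : q ∈ bd T)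
    (hpq : 0 < cr z p q) (hfree : ∀ c ∈ bd T, 0 < cr z p c → 0 < cr z c q → False) :
    ∀ s ∈ T, cr z s q + cr z p s ≤ cr z p q := by
  obtain ⟨hzT, hzi⟩ := mem_inr.1 hz
  obtain ⟨hpT, np, hnp, hp⟩ := mem_bd.1 hp
  obtain ⟨hqT, nq, hnq, hq⟩ := mem_bd.1 hq
  obtain ⟨s0, hs0, hmax⟩ := T.exists_max_image (dt (nrm p q)) ⟨z, hzT⟩
  have hs0b : s0 ∈ bd T := mem_bd.2 ⟨hs0, _, nrm_ne hpq.ne', hmax⟩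
  suffices h : cr z s0 q + cr z p s0 ≤ cr z p q by
    intro s hs
    have := hmax s hs
    linarith [nrm_dt z p q s, nrm_dt z p q s0]
  by_contra hcon
  push Not at hcon
  have hp0 := inr_strict hnp hp hz
  have hq0 := inr_strict hnq hq hz
  by_cases hβ : 0 < cr z p s0
  · by_cases hα : 0 < cr z s0 q
    · exact hfree s0 hs0b hβ hα
    · push Not at hα
      have h1 := cramer nq z p q s0
      have h2 := hq s0 hs0
      have h3 := hq p hpT
      nlinarith
  · push Not at hβ
    have h1 := cramer np z p q s0
    have h2 := hp s0 hs0
    have h3 := hp q hqT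
    nlinarith

lemma on_support {T : Finset E} {z p q s : E} (hpq : 0 < cr z p q)
    (hsup : ∀ s ∈ T, cr z s q + cr z p s ≤ cr z p q) (hs : s ∈ T)
    (he : cr z s q + cr z p s = cr z p q) : s ∈ bd T := by
  refine mem_bd.2 ⟨hs, _, nrm_ne hpq.ne', fun r hr => ?_⟩
  have := hsup r hr
  linarith [nrm_dt z p q s, nrm_dt z p q r]

def dz (z a b : E) : ℝ := (a.1 - z.1) * (b.1 - z.1) + (a.2 - z.2) * (b.2 - z.2)

lemma dz_pos {z v : E} (h : v ≠ z) : 0 < dz z v v := by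
  have : v.1 - z.1 ≠ 0 ∨ v.2 - z.2 ≠ 0 := by
    by_contra hc
    push Not at hc
    exact h (Prod.ext (by linarith [hc.1]) (by linarith [hc.2]))
  rcases this with h | h
  · have := mul_self_pos.2 h
    simp only [dz]; nlinarith [mul_self_nonneg (v.2 - z.2)]
  · have := mul_self_pos.2 h
    simp only [dz]; nlinarith [mul_self_nonneg (v.1 - z.1)]

lemma next_ccw {T : Finset E} {z v : E} (hz : z ∈ inr T) (hv : v ≠ z) :
    ∃ q ∈ bd T, 0 < cr z v q ∧ ∀ c ∈ bd T, 0 < cr z v c → 0 < cr z c q → False := by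
  have hvv := dz_pos hv
  obtain ⟨b, hb, hlt⟩ := inr_lt hz (n := (-(v.2 - z.2), v.1 - z.1)) (by
    intro h0
    have h1 : -(v.2 - z.2) = 0 := congrArg Prod.fst h0
    have h2 : v.1 - z.1 = 0 := congrArg Prod.snd h0
    exact hv (Prod.ext (by linarith) (by linarith)))
  obtain ⟨q, hq, hmax⟩ := ((bd T).filter (fun c => 0 < cr z v c)).exists_max_image
    (fun c => dz z v c / cr z v c) ⟨b, mem_filter.2 ⟨hb, by simp only [dt] at hlt; simp only [cr]; linarith⟩⟩
  obtain ⟨hq, hq0⟩ := mem_filter.1 hq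
  refine ⟨q, hq, hq0, fun c hc h1 h2 => ?_⟩
  have := hmax c (mem_filter.2 ⟨hc, h1⟩)
  rw [div_le_div_iff₀ h1 hq0] at this
  have id1 : dz z v v * cr z c q = dz z v c * cr z v q - dz z v q * cr z v c := by
    simp only [dz, cr]; ring
  nlinarith

lemma next_cw {T : Finset E} {z v : E} (hz : z ∈ inr T) (hv : v ≠ z) :
    ∃ q ∈ bd T, 0 < cr z q v ∧ ∀ c ∈ bd T, 0 < cr z q c → 0 < cr z c v → False := by
  have hvv := dz_pos hv
  obtain ⟨b, hb, hlt⟩ := inr_lt hz (n := (v.2 - z.2, -(v.1 - z.1))) (by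
    intro h0
    have h1 : v.2 - z.2 = 0 := congrArg Prod.fst h0
    have h2 : -(v.1 - z.1) = 0 := congrArg Prod.snd h0
    exact hv (Prod.ext (by linarith) (by linarith)))
  obtain ⟨q, hq, hmax⟩ := ((bd T).filter (fun c => 0 < cr z c v)).exists_max_image
    (fun c => dz z v c / cr z c v) ⟨b, mem_filter.2 ⟨hb, by simp only [dt] at hlt; simp only [cr]; linarith⟩⟩
  obtain ⟨hq, hq0⟩ := mem_filter.1 hq
  refine ⟨q, hq, hq0, fun c hc h2 h1 => ?_⟩
  have := hmax c (mem_filter.2 ⟨hc, h1⟩)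
  rw [div_le_div_iff₀ h1 hq0] at this
  have id1 : dz z v v * cr z q c = dz z v c * cr z q v - dz z v q * cr z c v := by
    simp only [dz, cr]; ring
  nlinarith

lemma sector {T : Finset E} {z x : E} (hz : z ∈ inr T) (hx : x ≠ z) :
    ∃ p ∈ bd T, ∃ q ∈ bd T, 0 < cr z p q ∧ 0 ≤ cr z p x ∧ 0 < cr z x q ∧
      ∀ c ∈ bd T, 0 < cr z p c → 0 < cr z c q → False := by
  obtain ⟨q, hq, hxq, hf⟩ := next_ccw hz hx
  have hqz : q ≠ z := by
    rintro rfl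
    rw [cr_zr] at hxq; exact lt_irrefl _ hxq
  obtain ⟨p, hp, hpq, hf2⟩ := next_cw hz hqz
  refine ⟨p, hp, q, hq, hpq, ?_, hxq, hf2⟩
  by_contra hcon
  push Not at hcon
  rw [cr_swap] at hcon
  exact hf p hp (by linarith) hpq

lemma outside {S : Finset E} {z p q x : E} (hz : z ∈ inr S) (hp : p ∈ inr S) (hq : q ∈ inr S)
    (hx : x ∈ bd S) (hpq : 0 < cr z p q) (hxq : 0 ≤ cr z x q) (hpx : 0 ≤ cr z p x) :
    cr z p q < cr z x q + cr z p x := by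
  obtain ⟨hxS, n, hn, hx⟩ := mem_bd.1 hx
  have h1 := inr_strict hn hx hz
  have h2 := inr_strict hn hx hp
  have h3 := inr_strict hn hx hq
  have h4 := cramer n z p q x
  by_contra hcon
  push Not at hcon
  have h5 : 0 < cr z p q * (dt n x - dt n z) := mul_pos hpq (by linarith)
  have h6 : (cr z x q + cr z p x) * (dt n x - dt n z) ≤ cr z p q * (dt n x - dt n z) :=
    mul_le_mul_of_nonneg_right hcon (by linarith)
  have h7 : 0 ≤ cr z x q * (dt n x - dt n p) := mul_nonneg hxq (by linarith)
  have h8 : 0 ≤ cr z p x * (dt n x - dt n q) := mul_nonneg hpx (by linarith)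
  have h9 : cr z x q * (dt n x - dt n p) = 0 := by nlinarith
  have h10 : cr z p x * (dt n x - dt n q) = 0 := by nlinarith
  have h11 : cr z x q = 0 := by
    rcases mul_eq_zero.1 h9 with h | h
    · exact h
    · linarith
  have h12 : cr z p x = 0 := by
    rcases mul_eq_zero.1 h10 with h | h
    · exact h
    · linarith
  rw [h11, h12] at h4
  linarith

lemma mix_inr {S : Finset E} {a b : E} {t : ℝ} (ha : a ∈ S) (hb : b ∈ inr S) (h0 : 0 < t)
    (h1 : t < 1) (hs : mix t a b ∈ S) : mix t a b ∈ inr S := by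
  refine mem_inr.2 ⟨hs, ?_⟩
  rintro ⟨n, hn, h⟩
  have h2 := inr_strict hn h hb
  have h3 := h a ha
  have h4 := dt_mix n t a b
  nlinarith

end
end BLBC

namespace BLBC
open Finset
open scoped Classical
noncomputable section

lemma k5_false {S : Finset E} (hS : NoK5 S) {a b c d e : E}
    (ha : a ∈ S) (hb : b ∈ S) (hc : c ∈ S) (hd : d ∈ S) (he : e ∈ S)
    (ab : a ≠ b) (ac : a ≠ c) (ad : a ≠ d) (ae : a ≠ e) (bc : b ≠ c) (bd : b ≠ d) (be : b ≠ e)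
    (cd : c ≠ d) (ce : c ≠ e) (de : d ≠ e)
    (vab : Vis S a b) (vac : Vis S a c) (vad : Vis S a d) (vae : Vis S a e)
    (vbc : Vis S b c) (vbd : Vis S b d) (vbe : Vis S b e)
    (vcd : Vis S c d) (vce : Vis S c e) (vde : Vis S d e) : False := by
  obtain ⟨v, hv, w, hw, hne, hvis⟩ := hS {a, b, c, d, e}
    (by intro s; simp only [mem_insert, mem_singleton]; rintro (rfl | rfl | rfl | rfl | rfl) <;> assumption)
    (by
      rw [card_insert_of_notMem, card_insert_of_notMem, card_insert_of_notMem,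
        card_insert_of_notMem, card_singleton] <;> simp [*])
  apply hvis
  simp only [mem_insert, mem_singleton] at hv hw
  rcases hv with rfl | rfl | rfl | rfl | rfl <;> rcases hw with rfl | rfl | rfl | rfl | rfl <;>
    first
    | exact absurd rfl hne
    | assumption
    | (apply vis_symm; assumption)

/-- State of the walk towards `z`. -/
def St (S : Finset E) (z x y : E) : Prop :=
  x ∈ bd S ∧ y ∈ bd S ∧ 0 < cr z x y ∧ (∀ c ∈ bd S, 0 < cr z x c → 0 < cr z c y → False) ∧
    ∀ c ∈ bd (inr S), 0 < cr z x c → 0 ≤ cr z c y → False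

lemma step {S : Finset E} (hS : NoK5 S) {z x y : E} (hz : z ∈ inr (inr S)) (h : St S z x y) :
    ∃ p q, St (inr S) z p q ∧ cr z p x = 0 := by
  obtain ⟨hx, hy, hxy, hfr, hfr2⟩ := h
  have hzS : z ∈ inr S := inr_sub _ hz
  have hxz : x ≠ z := by rintro rfl; rw [cr_zl] at hxy; exact lt_irrefl _ hxy
  obtain ⟨p, hp, q, hq, hpq, hpx, hxq, hf⟩ := sector hz hxz
  have hyq : 0 < cr z y q := by
    by_contra hcon
    rw [cr_swap] at hcon
    exact hfr2 q hq hxq (by linarith)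
  have hpy : 0 < cr z p y := by
    have := plucker z p x y q
    have h2 : 0 < cr z p y * cr z x q := by
      rw [this]
      have := mul_pos hpq hxy
      have := mul_nonneg hpx hyq.le
      linarith
    exact pos_of_mul_pos_left h2 hxq.le
  have hpS := bd_sub _ hp
  have hqS := bd_sub _ hq
  have ox := outside hzS hpS hqS hx hpq hxq.le hpx
  have oy := outside hzS hpS hqS hy hpq hyq.le hpy.le
  have hsup := support hz hp hq hpq hf
  have hsup2 := support hzS hx hy hxy hfr
  -- the crucial claim
  have key : ∀ w0 ∈ S, 0 ≤ cr z w0 q → 0 ≤ cr z p w0 → cr z w0 q + cr z p w0 < cr z p q →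
      (0 < cr z p x ∨ 0 < cr z p w0) → False := by
    intro w0 hw0 a1 a2 a3 a4
    obtain ⟨w, hw, hmax⟩ := (S.filter (fun w => 0 ≤ cr z w q ∧ 0 ≤ cr z p w ∧
      cr z w q + cr z p w < cr z p q ∧ (0 < cr z p x ∨ 0 < cr z p w))).exists_max_image
      (fun w => cr z w q + cr z p w) ⟨w0, mem_filter.2 ⟨hw0, a1, a2, a3, a4⟩⟩
    obtain ⟨hwS, w1, w2, w3, w4⟩ := mem_filter.1 hw
    have hmax' : ∀ s ∈ S, 0 ≤ cr z s q → 0 ≤ cr z p s → cr z s q + cr z p s < cr z p q →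
        (0 < cr z p x ∨ 0 < cr z p s) → cr z s q + cr z p s ≤ cr z w q + cr z p w :=
      fun s hs b1 b2 b3 b4 => hmax s (mem_filter.2 ⟨hs, b1, b2, b3, b4⟩)
    have hwI : w ∈ inr S := by
      refine mem_inr.2 ⟨hwS, fun hb => ?_⟩
      have := outside hzS hpS hqS (mem_bd.2 ⟨hwS, hb⟩) hpq w1 w2
      linarith
    have F1 : ∀ s ∈ inr S, 0 < cr z p s → 0 < cr z s q → cr z s q + cr z p s = cr z p q → False :=
      fun s hs b1 b2 b3 => hf s (on_support hpq hsup hs b3) b1 b2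
    have hpp : cr z p p = 0 := cr_self _ _
    have hqq : cr z q q = 0 := cr_self _ _
    -- outer to inner
    have V1 : ∀ a ∈ bd S, cr z p q < cr z a q + cr z p a → ∀ b ∈ inr S,
        cr z b q + cr z p b = cr z p q → Vis S a b := by
      intro a ha oa b hb ob s hs t t0 t1 he
      subst he
      have hi := mix_inr (bd_sub _ ha) hb t0 t1 hs
      have := hsup _ hi
      rw [cr_mix_left, cr_mix_right] at this
      nlinarith
    have V2 : ∀ a ∈ bd S, cr z p q < cr z a q + cr z p a → 0 < cr z a q → 0 ≤ cr z p a →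
        (0 < cr z p a ∨ 0 < cr z p w) → Vis S a w := by
      intro a ha oa oaq opa hor s hs t t0 t1 he
      subst he
      have hi := mix_inr (bd_sub _ ha) hwI t0 t1 hs
      have h1 := hsup _ hi
      have e1 := cr_mix_left z t a w q
      have e2 := cr_mix_right z t a w p
      have t1' : 0 < 1 - t := by linarith
      have q1 : 0 < cr z (mix t a w) q := by
        rw [e1]; have := mul_pos t1' oaq; have := mul_nonneg t0.le w1; linarith
      have q2 : 0 < cr z p (mix t a w) := by
        rw [e2]
        rcases hor with h | h
        · have := mul_pos t1' h; have := mul_nonneg t0.le w2; linarith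
        · have := mul_nonneg t1'.le opa; have := mul_pos t0 h; linarith
      rcases h1.lt_or_eq with h1 | h1
      · have := hmax' _ hs q1.le q2.le h1 (Or.inr q2)
        rw [e1, e2] at this
        nlinarith
      · exact F1 _ hi q2 q1 h1
    have V3 : ∀ b, cr z b q + cr z p b = cr z p q → 0 ≤ cr z b q → 0 ≤ cr z p b → Vis S w b := by
      intro b ob b1 b2 s hs t t0 t1 he
      subst he
      have e1 := cr_mix_left z t w b q
      have e2 := cr_mix_right z t w b p
      have t1' : 0 < 1 - t := by linarith
      have := hmax' _ hs (by rw [e1]; have := mul_nonneg t1'.le w1; have := mul_nonneg t0.le b1; linarith)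
        (by rw [e2]; have := mul_nonneg t1'.le w2; have := mul_nonneg t0.le b2; linarith)
        (by rw [e1, e2]; nlinarith)
        (by
          rcases w4 with h | h
          · exact Or.inl h
          · refine Or.inr ?_
            rw [e2]; have := mul_pos t1' h; have := mul_nonneg t0.le b2; linarith)
      rw [e1, e2] at this
      nlinarith
    have Vpq : Vis S p q := by
      intro s hs t t0 t1 he
      subst he
      have hi := mix_inr (inr_sub _ hpS) hqS t0 t1 hs
      have e1 := cr_mix_left z t p q q
      have e2 := cr_mix_right z t p q p
      rw [hqq] at e1
      rw [hpp] at e2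
      have t1' : 0 < 1 - t := by linarith
      have := mul_pos t1' hpq
      have := mul_pos t0 hpq
      exact F1 _ hi (by linarith) (by linarith) (by linarith)
    have Vxy : Vis S x y := by
      intro s hs t t0 t1 he
      subst he
      have e1 := cr_mix_left z t x y y
      have e2 := cr_mix_right z t x y x
      rw [cr_self] at e1 e2
      have t1' : 0 < 1 - t := by linarith
      have := mul_pos t1' hxy
      have := mul_pos t0 hxy
      exact hfr _ (on_support hxy hsup2 hs (by linarith)) (by linarith) (by linarith)
    have sp : cr z p q + cr z p p = cr z p q := by rw [hpp, add_zero]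
    have sq : cr z q q + cr z p q = cr z p q := by rw [hqq, zero_add]
    have nxp : x ≠ p := by rintro rfl; linarith
    have nxq : x ≠ q := by rintro rfl; linarith
    have nyp : y ≠ p := by rintro rfl; linarith
    have nyq : y ≠ q := by rintro rfl; linarith
    have nxw : x ≠ w := by rintro rfl; linarith
    have nyw : y ≠ w := by rintro rfl; linarith
    have nwp : w ≠ p := by rintro rfl; linarith
    have nwq : w ≠ q := by rintro rfl; linarith
    have nxy : x ≠ y := by rintro rfl; rw [cr_self] at hxy; exact lt_irrefl _ hxy
    have npq : p ≠ q := by rintro rfl; rw [cr_self] at hpq; exact lt_irrefl _ hpq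
    exact k5_false hS (bd_sub _ hx) (bd_sub _ hy) hwS (inr_sub _ hpS) (inr_sub _ hqS)
      nxy nxw nxp nxq nyw nyp nyq nwp nwq npq
      Vxy (V2 x hx ox hxq hpx w4) (V1 x hx ox p hpS sp) (V1 x hx ox q hqS sq)
      (V2 y hy oy hyq hpy.le (Or.inl hpy)) (V1 y hy oy p hpS sp) (V1 y hy oy q hqS sq)
      (V3 p sp hpq.le hpp.ge) (V3 q sq hqq.ge hpq.le) Vpq
  refine ⟨p, q, ⟨hp, hq, hpq, hf, ?_⟩, ?_⟩
  · intro s hs h1 h2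
    have hsI : s ∈ inr (inr S) := bd_sub _ hs
    have hs1 := inr_sub _ hsI
    rcases (hsup s hs1).lt_or_eq with h3 | h3
    · exact key s (inr_sub _ hs1) h2 h1.le h3 (Or.inr h1)
    · exact (mem_inr.1 hsI).2 (mem_bd.1 (on_support hpq hsup hs1 h3)).2
  · by_contra hne
    exact key z (inr_sub _ hzS) (cr_zl _ _).ge (cr_zr _ _).ge (by rw [cr_zl, cr_zr]; linarith)
      (Or.inl (lt_of_le_of_ne hpx (Ne.symm hne)))

lemma ray_unique {S : Finset E} {z w y y' : E} (hz : z ∈ inr S) (hy : y ∈ bd S) (hy' : y' ∈ bd S)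
    (h1 : 0 < cr z w y) (h2 : 0 < cr z w y') (h3 : cr z y y' = 0) : y = y' := by
  obtain ⟨hyS, n, hn, hy⟩ := mem_bd.1 hy
  obtain ⟨hyS', n', hn', hy'⟩ := mem_bd.1 hy'
  have k1 := inr_strict hn hy hz
  have k2 := inr_strict hn' hy' hz
  have e : ∀ m, cr z w y * (dt m y' - dt m z) = cr z w y' * (dt m y - dt m z) := by
    intro m
    have := cramer m z w y y'
    rw [cr_swap z y' y, h3] at this
    linarith
  have m1 := hy y' hyS'
  have m2 := hy' y hyS
  have e1 := e n
  have e2 := e n'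
  have l1 : cr z w y' ≤ cr z w y := by
    by_contra hc
    nlinarith
  have l2 : cr z w y ≤ cr z w y' := by
    by_contra hc
    nlinarith
  have l3 := le_antisymm l1 l2
  have x1 := e (1, 0)
  have x2 := e (0, 1)
  rw [l3] at x1 x2
  have x1 := mul_left_cancel₀ h1.ne' x1
  have x2 := mul_left_cancel₀ h1.ne' x2
  simp only [dt] at x1 x2
  exact Prod.ext (by linarith) (by linarith)

lemma start {S : Finset E} {z : E} (hz : z ∈ inr (inr S))
    (hcard : (bd (inr S)).card < (bd S).card) : ∃ x y, St S z x y := by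
  have hzS : z ∈ inr S := inr_sub _ hz
  by_contra hcon
  have H : ∀ y ∈ bd S, ∃ c ∈ bd (inr S), ∃ x ∈ bd S, 0 < cr z x y ∧
      (∀ b ∈ bd S, 0 < cr z x b → 0 < cr z b y → False) ∧ 0 < cr z x c ∧ 0 ≤ cr z c y := by
    intro y hy
    have hyz : y ≠ z := by
      rintro rfl
      exact (mem_inr.1 hzS).2 (mem_bd.1 hy).2
    obtain ⟨x, hx, hxy, hf⟩ := next_cw hzS hyz
    by_contra hc
    apply hcon
    refine ⟨x, y, hx, hy, hxy, hf, fun c hc1 h1 h2 => hc ⟨c, hc1, x, hx, hxy, hf, h1, h2⟩⟩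
  choose! c hc x hx hxy hf hxc hcy using H
  have key : ∀ y ∈ bd S, ∀ y' ∈ bd S, c y = c y' → ¬ 0 < cr z y' y := by
    intro y hy y' hy' he hlt
    have a1 := hxc y hy
    have a2 := hcy y hy
    have a3 := hcy y' hy'
    rw [← he] at a3
    have a4 := hxy y hy
    have pl := plucker z (x y) (c y) y' y
    have : 0 < cr z (x y) y' * cr z (c y) y := by
      rw [pl]
      have := mul_pos a1 hlt
      have := mul_nonneg a4.le a3
      linarith
    exact hf y hy y' hy' (pos_of_mul_pos_left this a2) hlt
  refine absurd (card_le_card_of_injOn c hc ?_) (not_le.2 hcard)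
  intro y hy y' hy' he
  have hy : y ∈ bd S := hy
  have hy' : y' ∈ bd S := hy'
  have he : c y = c y' := he
  have k1 := key y hy y' hy' he
  have k2 := key y' hy' y hy he.symm
  have k3 : cr z y y' = 0 := by
    rw [cr_swap] at k1
    linarith
  have a1 := hxc y hy
  have a2 := hcy y hy
  have a3 := hcy y' hy'
  have a4 := hxy y hy
  have a1' := hxc y' hy'
  have a4' := hxy y' hy'
  rw [← he] at a3 a1'
  -- positivity of cr (x y) y'
  have b1 := plucker z (x y) (c y) y' y
  have b2 := plucker z (x y') (c y) y y'
  rw [cr_swap z y' y, k3] at b1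
  rw [k3] at b2
  have b3 : 0 < cr z (x y) y' := by
    rcases a2.lt_or_eq with h | h
    · have h' : cr z (c y) y' ≠ 0 := by
        intro h0
        rw [h0] at b2
        have := mul_pos a4' h
        linarith
      have : 0 < cr z (x y) y' * cr z (c y) y := by
        rw [b1]
        have := mul_pos a4 (lt_of_le_of_ne a3 (Ne.symm h'))
        linarith
      exact pos_of_mul_pos_left this h.le
    · have h0 : cr z (c y) y' = 0 := by
        rw [← h] at b1
        have : cr z (x y) y * cr z (c y) y' = 0 := by linarith
        exact (mul_eq_zero.1 this).resolve_left a4.ne'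
      have b5 := plucker z (x y') (x y) (c y) y'
      rw [h0] at b5
      have : 0 < cr z (x y) y' * cr z (x y') (c y) := by
        have := mul_pos a4' a1
        linarith
      exact pos_of_mul_pos_left this a1'.le
  exact ray_unique hzS hy hy' a4 b3 k3

lemma onray {z x s : E} (hx : x ≠ z) (h : cr z s x = 0) : ∃ t, s = mix t z x := by
  have hp := dz_pos hx
  refine ⟨dz z s x / dz z x x, ?_⟩
  have h1 : dz z x x ≠ 0 := hp.ne'
  ext
  · have : dz z x x * s.1 = dz z x x * z.1 + dz z s x * (x.1 - z.1) := by
      simp only [cr] at h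
      simp only [dz]; linear_combination (x.2 - z.2) * h
    simp only [mix]; field_simp; linarith
  · have : dz z x x * s.2 = dz z x x * z.2 + dz z s x * (x.2 - z.2) := by
      simp only [cr] at h
      simp only [dz]; linear_combination (-(x.1 - z.1)) * h
    simp only [mix]; field_simp; linarith

end
end BLBC

namespace BLBC
open Finset
open scoped Classical
noncomputable section

def Bad (l : ℕ) (S : Finset E) : Prop := NoCol l S ∧ NoK5 S

lemma bad_sub {l : ℕ} {S S' : Finset E} (h : Bad l S) (hsub : S' ⊆ S)
    (hcl : ∀ a ∈ S', ∀ b ∈ S', ∀ t : ℝ, 0 < t → t < 1 → mix t a b ∈ S → mix t a b ∈ S') :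
    Bad l S' := by
  refine ⟨fun T hT o d hl => h.1 T (hT.trans hsub) o d hl, fun T hT hc => ?_⟩
  obtain ⟨v, hv, w, hw, hne, hvis⟩ := h.2 T (hT.trans hsub) hc
  refine ⟨v, hv, w, hw, hne, fun hv' => hvis ?_⟩
  intro s hs t t0 t1 he
  subst he
  exact hv' _ (hcl v (hT hv) w (hT hw) t t0 t1 hs) t t0 t1 rfl

lemma bad_inr {l : ℕ} {S : Finset E} (h : Bad l S) : Bad l (inr S) :=
  bad_sub h (inr_sub S) fun _ ha _ hb _ t0 t1 hs => mix_inr (inr_sub S ha) hb t0 t1 hs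

lemma iter_sub (n : ℕ) : ∀ S : Finset E, inr^[n] S ⊆ S := by
  induction n with
  | zero => intro S; exact Subset.refl _
  | succ n ih => intro S; exact (ih (inr S)).trans (inr_sub S)

lemma chain {l : ℕ} {z : E} : ∀ (m : ℕ) (S : Finset E) (x y : E), Bad l S → z ∈ inr^[m+1] S →
    St S z x y → ∃ X ⊆ S, X.card = m + 2 ∧ OnLine z x X := by
  intro m
  induction m with
  | zero =>
    intro S x y _ hz h
    have hxz : x ≠ z := by
      rintro rfl
      have := h.2.2.1
      rw [cr_zl] at this; exact lt_irrefl _ this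
    refine ⟨{x, z}, ?_, card_pair hxz, ?_⟩
    · intro s hs
      simp only [mem_insert, mem_singleton] at hs
      rcases hs with rfl | rfl
      · exact bd_sub _ h.1
      · exact inr_sub _ hz
    · intro s hs
      simp only [mem_insert, mem_singleton] at hs
      rcases hs with rfl | rfl
      · exact ⟨1, by ext <;> simp [mix]⟩
      · exact ⟨0, by ext <;> simp [mix]⟩
  | succ m ih =>
    intro S x y hB hz h
    have hz2 : z ∈ inr (inr S) := iter_sub m _ hz
    obtain ⟨p, q, hst, hpx⟩ := step hB.2 hz2 h
    have hxz : x ≠ z := by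
      rintro rfl
      have := h.2.2.1
      rw [cr_zl] at this; exact lt_irrefl _ this
    obtain ⟨X, hX, hc, hl⟩ := ih (inr S) p q (bad_inr hB) hz hst
    have hxX : x ∉ X := fun hx => (mem_inr.1 (hX hx)).2 (mem_bd.1 h.1).2
    refine ⟨insert x X, ?_, by rw [card_insert_of_notMem hxX, hc], ?_⟩
    · intro s hs
      rcases mem_insert.1 hs with rfl | hs
      · exact bd_sub _ h.1
      · exact inr_sub _ (hX hs)
    · intro s hs
      rcases mem_insert.1 hs with rfl | hs
      · exact ⟨1, by ext <;> simp [mix]⟩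
      · obtain ⟨t, rfl⟩ := hl s hs
        obtain ⟨u, rfl⟩ := onray hxz hpx
        exact ⟨t * u, by ext <;> simp only [mix] <;> ring⟩

lemma mix_bd {S : Finset E} {a b : E} {t : ℝ} (ha : a ∈ S) (hb : b ∈ S) (h0 : 0 < t)
    (h1 : t < 1) (hs : mix t a b ∈ bd S) :
    ∃ n : E, n ≠ 0 ∧ dt n a = dt n b ∧ ∀ s ∈ S, dt n s ≤ dt n a := by
  obtain ⟨_, n, hn, h⟩ := mem_bd.1 hs
  have k1 := h a ha
  have k2 := h b hb
  have e := dt_mix n t a b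
  rw [e] at k1 k2
  have k3 : dt n a = dt n b := by
    apply le_antisymm <;> nlinarith
  refine ⟨n, hn, k3, fun s hs => ?_⟩
  have := h s hs
  rw [e, ← k3] at this
  linarith

lemma flag {S : Finset E} {a b n : E} (hn : n ≠ 0) (h1 : dt n a = dt n b)
    (h2 : ∀ s ∈ S, dt n s ≤ dt n a) : ∀ s ∈ S, ∀ r ∈ S, 0 ≤ cr a b s * cr a b r := by
  intro s hs r hr
  have hp : 0 < n.1 * n.1 + n.2 * n.2 := by
    have := dz_pos hn
    simpa [dz] using this
  set μ := (n.1 * (b.2 - a.2) - n.2 * (b.1 - a.1)) with hμ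
  have e : ∀ v : E, (n.1 * n.1 + n.2 * n.2) * cr a b v = - μ * (dt n v - dt n a) := by
    intro v
    simp only [dt] at h1
    simp only [cr, dt, hμ]
    linear_combination ((v.1 - a.1) * n.2 - (v.2 - a.2) * n.1) * h1
  have k : (n.1 * n.1 + n.2 * n.2) * (n.1 * n.1 + n.2 * n.2) * (cr a b s * cr a b r)
      = μ * μ * ((dt n a - dt n s) * (dt n a - dt n r)) := by
    linear_combination ((n.1 * n.1 + n.2 * n.2) * cr a b r) * e s - μ * (dt n s - dt n a) * e r
  have k2 : 0 ≤ μ * μ * ((dt n a - dt n s) * (dt n a - dt n r)) :=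
    mul_nonneg (mul_self_nonneg _) (mul_nonneg (by linarith [h2 s hs]) (by linarith [h2 r hr]))
  rw [← k] at k2
  exact nonneg_of_mul_nonneg_right k2 (mul_pos hp hp)

lemma line_card {l : ℕ} {S : Finset E} (h : NoCol l S) {a b : E} (hab : b ≠ a) :
    (S.filter (fun s => cr a b s = 0)).card ≤ l := by
  refine (h _ (filter_subset _ _) a b ?_).le
  intro s hs
  refine onray hab ?_
  rw [cr_swap, (mem_filter.1 hs).2, neg_zero]

/-- neighbours on supporting lines -/
def Nb (S : Finset E) (a : E) : Finset E :=
  S.filter (fun b => b ≠ a ∧ ∃ n : E, n ≠ 0 ∧ dt n a = dt n b ∧ ∀ s ∈ S, dt n s ≤ dt n a)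

lemma nb_card {l : ℕ} {S : Finset E} (h : NoCol l S) (a : E) : (Nb S a).card ≤ 2 * l := by
  by_cases h1 : ∃ b1, b1 ∈ Nb S a
  swap
  · push Not at h1
    rw [eq_empty_of_forall_notMem h1]; simp
  obtain ⟨b1, hb1⟩ := h1
  obtain ⟨hS1, hne1, n1, hn1, e1, m1⟩ := mem_filter.1 hb1
  have c1 := line_card h hne1
  by_cases h2 : ∃ b2 ∈ Nb S a, cr a b1 b2 ≠ 0
  swap
  · push Not at h2
    have : Nb S a ⊆ S.filter (fun s => cr a b1 s = 0) := fun s hs =>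
      mem_filter.2 ⟨(mem_filter.1 hs).1, h2 s hs⟩
    have := card_le_card this
    omega
  obtain ⟨b2, hb2, h12⟩ := h2
  obtain ⟨hS2, hne2, n2, hn2, e2, m2⟩ := mem_filter.1 hb2
  have c2 := line_card h hne2
  have : Nb S a ⊆ S.filter (fun s => cr a b1 s = 0) ∪ S.filter (fun s => cr a b2 s = 0) := by
    intro b3 hb3
    obtain ⟨hS3, hne3, n3, hn3, e3, m3⟩ := mem_filter.1 hb3
    by_contra hcon
    simp only [mem_union, mem_filter, not_or, not_and, hS3, true_imp_iff] at hcon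
    obtain ⟨h13, h23⟩ := hcon
    have f1 := flag hn1 e1 m1 b2 hS2 b3 hS3
    have f2 := flag hn2 e2 m2 b1 hS1 b3 hS3
    have f3 := flag hn3 e3 m3 b1 hS1 b2 hS2
    rw [cr_swap a b2 b1] at f2
    rw [cr_swap a b3 b1, cr_swap a b3 b2] at f3
    have g1 : 0 < cr a b1 b2 * cr a b1 b3 := lt_of_le_of_ne f1 (Ne.symm (mul_ne_zero h12 h13))
    have g3 : 0 < cr a b1 b3 * cr a b2 b3 :=
      lt_of_le_of_ne (by linarith) (Ne.symm (mul_ne_zero h13 h23))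
    have g4 := mul_pos g1 g3
    have g5 : cr a b1 b2 * cr a b1 b3 * (cr a b1 b3 * cr a b2 b3)
      = (cr a b1 b3 * cr a b1 b3) * (cr a b1 b2 * cr a b2 b3) := by ring
    have g6 : 0 < cr a b1 b3 * cr a b1 b3 := mul_self_pos.2 h13
    have g7 : cr a b1 b2 * cr a b2 b3 ≤ 0 := by linarith
    have := mul_nonpos_of_nonneg_of_nonpos g6.le g7
    linarith
  have := card_le_card this
  have := card_union_le (S.filter (fun s => cr a b1 s = 0)) (S.filter (fun s => cr a b2 s = 0))
  omega

lemma cell {l : ℕ} {S : Finset E} (h : Bad l S) (B : Finset E) (hB : B ⊆ bd S)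
    (hfree : ∀ a ∈ B, ∀ b ∈ B, ∀ t : ℝ, 0 < t → t < 1 → mix t a b ∈ inr S → False) :
    B.card ≤ 4 * (2 * l + 1) := by
  by_contra hcon
  push Not at hcon
  have main : ∀ k, k ≤ 5 → ∃ T ⊆ B, T.card = k ∧ ∀ v ∈ T, ∀ w ∈ T, v ≠ w → v ∉ Nb S w := by
    intro k
    induction k with
    | zero => intro _; exact ⟨∅, by simp, rfl, by simp⟩
    | succ k ih =>
      intro hk
      obtain ⟨T, hT, hc, hi⟩ := ih (by omega)
      have hle : (T.biUnion (fun a => insert a (Nb S a))).card ≤ T.card * (2 * l + 1) := by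
        refine card_biUnion_le_card_mul _ _ _ fun a _ => ?_
        exact (card_insert_le _ _).trans (by have := nb_card h.1 a; omega)
      have hlt : (T.biUnion (fun a => insert a (Nb S a))).card < B.card := by
        refine lt_of_le_of_lt hle (lt_of_le_of_lt ?_ hcon)
        exact Nat.mul_le_mul_right _ (by omega)
      obtain ⟨b, hb, hbn⟩ := exists_mem_notMem_of_card_lt_card hlt
      simp only [mem_biUnion, mem_insert, not_exists, not_and, not_or] at hbn
      have hbT : b ∉ T := fun hbT => (hbn b hbT).1 rfl
      refine ⟨insert b T, insert_subset hb hT, by rw [card_insert_of_notMem hbT, hc], ?_⟩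
      intro v hv w hw hne
      rcases mem_insert.1 hv with ev | hv1
      · rcases mem_insert.1 hw with ew | hw1
        · exact absurd (ev.trans ew.symm) hne
        · rw [ev]; exact (hbn w hw1).2
      · rcases mem_insert.1 hw with ew | hw1
        · intro hvn
          rw [ew] at hvn
          apply (hbn v hv1).2
          obtain ⟨hS1, hne1, n1, hn1, e1, m1⟩ := mem_filter.1 hvn
          exact mem_filter.2 ⟨bd_sub _ (hB hb), hne1.symm, n1, hn1, e1.symm,
            fun s hs => (m1 s hs).trans e1.le⟩
        · exact hi v hv1 w hw1 hne
  obtain ⟨T, hT, hc, hi⟩ := main 5 le_rfl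
  obtain ⟨v, hv, w, hw, hne, hvis⟩ := h.2 T (hT.trans (hB.trans (bd_sub S))) hc
  apply hvis
  intro s hs t t0 t1 he
  subst he
  by_cases hbd : IsBd S (mix t v w)
  · obtain ⟨n, hn, e, m⟩ := mix_bd (bd_sub _ (hB (hT hv))) (bd_sub _ (hB (hT hw))) t0 t1
      (mem_bd.2 ⟨hs, hbd⟩)
    exact hi v hv w hw hne (mem_filter.2 ⟨bd_sub _ (hB (hT hv)), hne, n, hn, e.symm,
      fun s hs => (m s hs).trans e.le⟩)
  · exact hfree v (hT hv) w (hT hw) t t0 t1 (mem_inr.2 ⟨hs, hbd⟩)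

def gg (l N : ℕ) : ℕ := 4 * (2 * l + 1) * (N * N + 2 ^ N * (2 ^ N * (2 ^ N * 2 ^ N)))

lemma gg_mono (l : ℕ) : Monotone (gg l) := by
  intro a b h
  unfold gg
  have : 2 ^ a ≤ 2 ^ b := Nat.pow_le_pow_right (by norm_num) h
  gcongr

lemma shrink {l : ℕ} {S : Finset E} (h : Bad l S) : (bd S).card ≤ gg l (bd (inr S)).card := by
  set C := bd (inr S) with hC
  by_cases hI : ∃ z, z ∈ inr (inr S)
  · obtain ⟨z, hz⟩ := hI
    have hzS := inr_sub _ hz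
    have H : ∀ x ∈ bd S, ∃ pq : E × E, pq ∈ C ×ˢ C ∧ 0 < cr z pq.1 pq.2 ∧ 0 ≤ cr z pq.1 x ∧
        0 < cr z x pq.2 ∧ ∀ c ∈ C, 0 < cr z pq.1 c → 0 < cr z c pq.2 → False := by
      intro x hx
      have hxz : x ≠ z := by
        rintro rfl
        exact (mem_inr.1 hzS).2 (mem_bd.1 hx).2
      obtain ⟨p, hp, q, hq, h1, h2, h3, h4⟩ := sector hz hxz
      exact ⟨(p, q), mem_product.2 ⟨hp, hq⟩, h1, h2, h3, h4⟩
    choose! f hf h1 h2 h3 h4 using H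
    have := card_le_mul_card_image_of_maps_to (s := bd S) (t := C ×ˢ C) (f := f) hf
      (4 * (2 * l + 1)) ?_
    · rw [card_product] at this
      refine this.trans ?_
      unfold gg
      gcongr
      exact Nat.le_add_right _ _
    · intro pq hpq
      refine cell h _ (filter_subset _ _) ?_
      intro a ha b hb t t0 t1 hs
      obtain ⟨ha, ea⟩ := mem_filter.1 ha
      obtain ⟨hb, eb⟩ := mem_filter.1 hb
      obtain ⟨hp, hq⟩ := mem_product.1 hpq
      have k1 := h1 a ha
      have k4 := h4 a ha
      have a2 := h2 a ha
      have a3 := h3 a ha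
      have b2 := h2 b hb
      have b3 := h3 b hb
      rw [ea] at k1 k4 a2 a3
      rw [eb] at b2 b3
      have oa := outside hzS (bd_sub _ hp) (bd_sub _ hq) ha k1 a3.le a2
      have ob := outside hzS (bd_sub _ hp) (bd_sub _ hq) hb k1 b3.le b2
      have hsup := support hz hp hq k1 k4 _ hs
      rw [cr_mix_left, cr_mix_right] at hsup
      nlinarith
  · have hCI : inr S ⊆ C := by
      intro s hs
      refine mem_bd.2 ⟨hs, ?_⟩
      by_contra hb
      exact hI ⟨s, mem_inr.2 ⟨hs, hb⟩⟩
    let f : E → Finset E × Finset E × Finset E × Finset E := fun b =>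
      (C.filter (fun c => b.1 < c.1), C.filter (fun c => c.1 < b.1),
        C.filter (fun c => b.2 < c.2), C.filter (fun c => c.2 < b.2))
    have := card_le_mul_card_image_of_maps_to (s := bd S)
      (t := C.powerset ×ˢ C.powerset ×ˢ C.powerset ×ˢ C.powerset) (f := f)
      (fun b _ => by simp [f]) (4 * (2 * l + 1)) ?_
    · simp only [card_product, card_powerset] at this
      refine this.trans ?_
      unfold gg
      gcongr
      exact Nat.le_add_left _ _
    · intro v _
      refine cell h _ (filter_subset _ _) ?_
      intro a ha b hb t t0 t1 hs
      obtain ⟨ha, ea⟩ := mem_filter.1 ha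
      obtain ⟨hb, eb⟩ := mem_filter.1 hb
      have e := ea.trans eb.symm
      simp only [f, Prod.mk.injEq] at e
      obtain ⟨e1, e2, e3, e4⟩ := e
      have hsC := hCI hs
      have i1 := Finset.ext_iff.1 e1 (mix t a b)
      have i2 := Finset.ext_iff.1 e2 (mix t a b)
      have i3 := Finset.ext_iff.1 e3 (mix t a b)
      have i4 := Finset.ext_iff.1 e4 (mix t a b)
      simp only [mem_filter, hsC, true_and] at i1 i2 i3 i4
      have m1 : (mix t a b).1 = (1 - t) * a.1 + t * b.1 := rfl
      have m2 : (mix t a b).2 = (1 - t) * a.2 + t * b.2 := rfl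
      have aux : ∀ x y m : ℝ, m = (1 - t) * x + t * y → (x < m ↔ y < m) → (m < x ↔ m < y) →
          x = m := by
        intro x y m hm j1 j2
        rcases lt_trichotomy x m with hx | hx | hx
        · have := j1.1 hx; nlinarith
        · exact hx
        · have := j2.1 hx; nlinarith
      have : a = mix t a b := Prod.ext (aux _ _ _ m1 i1 i2) (aux _ _ _ m2 i3 i4)
      rw [← this] at hs
      exact (mem_inr.1 hs).2 (mem_bd.1 ha).2

lemma depth {l : ℕ} : ∀ (j : ℕ) (S : Finset E), Bad l S → (gg l)^[j] 0 < (bd S).card →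
    ∃ z, z ∈ inr^[j] S := by
  intro j
  induction j with
  | zero =>
    intro S _ h
    obtain ⟨z, hz⟩ := card_pos.1 h
    exact ⟨z, bd_sub _ hz⟩
  | succ j ih =>
    intro S hB h
    refine ih (inr S) (bad_inr hB) ?_
    rw [Function.iterate_succ_apply'] at h
    by_contra hcon
    have := gg_mono l (not_lt.1 hcon)
    have := shrink hB
    omega

lemma bounded {l : ℕ} : ∀ (N : ℕ) (S : Finset E), S.card ≤ N → Bad l S →
    (bd S).card ≤ (gg l)^[l + 2] 0 := by
  intro N
  induction N with
  | zero =>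
    intro S hc _
    have := card_le_card (bd_sub S)
    omega
  | succ N ih =>
    intro S hc hB
    by_contra hcon
    push Not at hcon
    have hpos : 0 < (bd S).card := by omega
    have hlt : (inr S).card < S.card := by
      obtain ⟨b, hb⟩ := card_pos.1 hpos
      refine card_lt_card ⟨inr_sub S, fun hs => ?_⟩
      exact (mem_inr.1 (hs (bd_sub _ hb))).2 (mem_bd.1 hb).2
    have h1 := ih (inr S) (by omega) (bad_inr hB)
    obtain ⟨z, hz⟩ := depth (l + 2) S hB hcon
    have hz2 : z ∈ inr (inr S) := iter_sub l _ hz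
    obtain ⟨x, y, hst⟩ := start hz2 (by omega)
    obtain ⟨X, hX, hXc, hl⟩ := chain (l + 1) S x y hB hz hst
    have := hB.1 X hX z x hl
    omega

end
end BLBC

namespace BLBC
open Finset
open scoped Classical
noncomputable section

def sl (u v : E) : ℝ := (v.2 - u.2) / (v.1 - u.1)

lemma sl_mul {u v : E} (h : u.1 < v.1) : v.2 - u.2 = sl u v * (v.1 - u.1) := by
  have : v.1 - u.1 ≠ 0 := by linarith
  unfold sl; field_simp

def Good (e : ℝ) (X : Finset E) (u v : E) : Prop :=
  v ∈ X ∧ (∀ s ∈ X, s.1 ≤ v.1) ∧ (∀ s ∈ X, 0 ≤ e * ((s.2 - v.2) - sl u v * (s.1 - v.1))) ∧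
  ∀ p ∈ X, ∃ a, e * a ≤ e * sl u v ∧ ∀ s ∈ X, 0 ≤ e * ((s.2 - p.2) - a * (s.1 - p.1))

lemma good_base (e : ℝ) {u v : E} (h : u.1 < v.1) : Good e {u, v} u v := by
  have hm := sl_mul h
  have z1 : (u.2 - v.2) - sl u v * (u.1 - v.1) = 0 := by linarith
  have z2 : (v.2 - u.2) - sl u v * (v.1 - u.1) = 0 := by linarith
  refine ⟨by simp, ?_, ?_, ?_⟩
  · simp [h.le]
  · simp [z1]
  · intro p hp
    refine ⟨sl u v, le_rfl, ?_⟩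
    simp only [mem_insert, mem_singleton] at hp
    rcases hp with rfl | rfl
    · simp [z2]
    · simp [z1]

lemma good_step {e : ℝ} {X : Finset E} {u v w : E} (h : Good e X u v) (hvw : v.1 < w.1)
    (hs : e * sl u v ≤ e * sl v w) : Good e (insert w X) v w := by
  obtain ⟨hv, h1, h2, h3⟩ := h
  have hm := sl_mul hvw
  have key : ∀ s ∈ X, 0 ≤ e * ((s.2 - w.2) - sl v w * (s.1 - w.1)) := by
    intro s hsX
    have k1 := h2 s hsX
    have k2 := mul_nonneg (sub_nonneg.2 hs) (sub_nonneg.2 (h1 s hsX))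
    have k3 : e * ((s.2 - w.2) - sl v w * (s.1 - w.1)) =
      e * ((s.2 - v.2) - sl u v * (s.1 - v.1)) + (e * sl v w - e * sl u v) * (v.1 - s.1) := by
      linear_combination (-e) * hm
    linarith
  have key' : ∀ s ∈ insert w X, 0 ≤ e * ((s.2 - w.2) - sl v w * (s.1 - w.1)) := by
    intro s hsX
    rcases mem_insert.1 hsX with rfl | hsX
    · simp
    · exact key s hsX
  refine ⟨mem_insert_self _ _, ?_, key', ?_⟩
  · intro s hsX
    rcases mem_insert.1 hsX with rfl | hsX
    · exact le_rfl
    · exact (h1 s hsX).trans hvw.le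
  · intro p hp
    rcases mem_insert.1 hp with rfl | hp
    · exact ⟨_, le_rfl, key'⟩
    · obtain ⟨a, ha, hs'⟩ := h3 p hp
      refine ⟨a, ha.trans hs, ?_⟩
      intro s hsX
      rcases mem_insert.1 hsX with rfl | hsX
      · have k1 := hs' v hv
        have k2 := mul_nonneg (sub_nonneg.2 (ha.trans hs)) (sub_nonneg.2 hvw.le)
        have k3 : e * ((s.2 - p.2) - a * (s.1 - p.1)) = e * ((v.2 - p.2) - a * (v.1 - p.1))
          + (e * sl v s - e * a) * (s.1 - v.1) := by
          linear_combination e * hm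
        linarith
      · exact hs' s hsX

lemma good_bd {e : ℝ} {X : Finset E} {u v : E} (he : e ≠ 0) (h : Good e X u v) :
    ∀ p ∈ X, IsBd X p := by
  intro p hp
  obtain ⟨a, _, ha⟩ := h.2.2.2 p hp
  refine ⟨(e * a, -e), ?_, ?_⟩
  · intro h0
    have : -e = 0 := congrArg Prod.snd h0
    exact he (by linarith)
  · intro s hs
    have := ha s hs
    simp only [dt]
    linarith

lemma es {m : ℕ} {V : Finset E} (hV : ∀ u ∈ V, ∀ v ∈ V, u.1 = v.1 → u = v)
    (hno : ∀ X ⊆ V, (∀ p ∈ X, IsBd X p) → X.card ≤ m) : V.card ≤ (m + 1) ^ (m + 1) := by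
  let Pc : E → E → ℕ → Prop := fun u v j => ∃ X ⊆ V, Good 1 X u v ∧ X.card = j
  let c : E → E → ℕ := fun u v => Nat.findGreatest (Pc u v) m
  have pair : ∀ u ∈ V, ∀ v ∈ V, u.1 < v.1 → ({u, v} : Finset E) ⊆ V ∧ ({u, v} : Finset E).card = 2 := by
    intro u hu v hv h
    refine ⟨?_, card_pair (by rintro rfl; exact lt_irrefl _ h)⟩
    intro s hs
    simp only [mem_insert, mem_singleton] at hs
    rcases hs with rfl | rfl <;> assumption
  have two : ∀ u ∈ V, ∀ v ∈ V, u.1 < v.1 → 2 ≤ m := by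
    intro u hu v hv h
    obtain ⟨h1, h2⟩ := pair u hu v hv h
    have := hno _ h1 (good_bd one_ne_zero (good_base 1 h))
    omega
  have ins : ∀ (e : ℝ) (X : Finset E) (u v w : E), e ≠ 0 → X ⊆ V → Good e X u v → w ∈ V → v.1 < w.1 →
      e * sl u v ≤ e * sl v w → insert w X ⊆ V ∧ Good e (insert w X) v w ∧
      (insert w X).card = X.card + 1 ∧ X.card + 1 ≤ m := by
    intro e X u v w he hX hg hw hvw hs
    have hwX : w ∉ X := fun h => by have := hg.2.1 w h; linarith
    have g := good_step hg hvw hs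
    have hsub := insert_subset hw hX
    have hc := card_insert_of_notMem hwX
    exact ⟨hsub, g, hc, hc ▸ hno _ hsub (good_bd he g)⟩
  have cap : ∀ u ∈ V, ∀ v ∈ V, ∀ w ∈ V, u.1 < v.1 → v.1 < w.1 → c u v = c v w → sl v w < sl u v := by
    intro u hu v hv w hw huv hvw he
    by_contra hcon
    push Not at hcon
    obtain ⟨h1, h2⟩ := pair u hu v hv huv
    have hsp : Pc u v (c u v) := Nat.findGreatest_spec (two u hu v hv huv)
      (show Pc u v 2 from ⟨_, h1, good_base 1 huv, h2⟩)
    obtain ⟨X, hX, hg, hc⟩ := hsp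
    obtain ⟨k1, k2, k3, k4⟩ := ins 1 X u v w one_ne_zero hX hg hw hvw (by linarith)
    have : X.card + 1 ≤ c v w := Nat.le_findGreatest k4 ⟨_, k1, k2, k3⟩
    omega
  let PL : ℕ → E → ℕ → Prop := fun j v t => t = 0 ∨ ∃ u ∈ V, u.1 < v.1 ∧ c u v = j ∧
    ∃ X ⊆ V, Good (-1) X u v ∧ X.card = t
  let L : ℕ → E → ℕ := fun j v => Nat.findGreatest (PL j v) m
  have inc : ∀ u ∈ V, ∀ v ∈ V, u.1 < v.1 → L (c u v) u < L (c u v) v := by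
    intro u hu v hv huv
    have hsp : PL (c u v) u (L (c u v) u) := Nat.findGreatest_spec (Nat.zero_le m)
      (show PL (c u v) u 0 from Or.inl rfl)
    rcases hsp with h0 | ⟨u', hu', hlt, hcc, X, hX, hg, hc⟩
    · obtain ⟨h1, h2⟩ := pair u hu v hv huv
      have : 2 ≤ L (c u v) v := Nat.le_findGreatest (two u hu v hv huv)
        (Or.inr ⟨u, hu, huv, rfl, _, h1, good_base (-1) huv, h2⟩)
      omega
    · have hs := cap u' hu' u hu v hv hlt huv hcc
      obtain ⟨k1, k2, k3, k4⟩ := ins (-1) X u' u v (by norm_num) hX hg hv huv (by linarith)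
      have : X.card + 1 ≤ L (c u v) v := Nat.le_findGreatest k4
        (Or.inr ⟨u, hu, huv, rfl, _, k1, k2, k3⟩)
      omega
  let F : E → (Fin (m + 1) → Fin (m + 1)) := fun v j =>
    ⟨L j v, Nat.lt_succ_of_le (Nat.findGreatest_le m)⟩
  have hF : ∀ u ∈ V, ∀ v ∈ V, u.1 < v.1 → F u ≠ F v := by
    intro u hu v hv huv he
    have h1 := congrFun he ⟨c u v, Nat.lt_succ_of_le (Nat.findGreatest_le m)⟩
    have h2 : L (c u v) u = L (c u v) v := congrArg Fin.val h1
    have := inc u hu v hv huv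
    omega
  have := card_le_card_of_injOn (s := V) (t := univ) F (fun _ _ => mem_univ _) (by
    intro u hu v hv he
    rcases lt_trichotomy u.1 v.1 with h | h | h
    · exact absurd he (hF u hu v hv h)
    · exact hV u hu v hv h
    · exact absurd he.symm (hF v hv u hu h))
  simpa using this

lemma main_plane (l : ℕ) : ∃ n, ∀ P : Finset E, Bad l P → P.card < n := by
  set m := (gg l)^[l + 2] 0 with hm
  refine ⟨l * (m + 1) ^ (m + 1) + 1, fun P hP => ?_⟩
  have H : ∀ r ∈ P.image Prod.fst, ∃ p ∈ P, p.1 = r := by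
    intro r hr
    obtain ⟨p, hp, he⟩ := mem_image.1 hr
    exact ⟨p, hp, he⟩
  choose! f hf hf1 using H
  set V := (P.image Prod.fst).image f with hVdef
  have hVP : V ⊆ P := by
    intro v hv
    obtain ⟨r, hr, rfl⟩ := mem_image.1 hv
    exact hf r hr
  have hVc : V.card = (P.image Prod.fst).card := by
    refine card_image_of_injOn ?_
    intro r hr r' hr' he
    have := hf1 r hr
    rw [← this, he, hf1 r' hr']
  have h1 : P.card ≤ l * (P.image Prod.fst).card := by
    refine card_le_mul_card_image _ _ fun r _ => ?_
    refine (hP.1 _ (filter_subset _ _) (r, 0) (r, 1) ?_).le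
    intro s hs
    refine ⟨s.2, ?_⟩
    ext
    · simp only [mix, (mem_filter.1 hs).2]; ring
    · simp only [mix]; ring
  have h2 : V.card ≤ (m + 1) ^ (m + 1) := by
    apply es
    · intro u hu v hv he
      obtain ⟨r, hr, rfl⟩ := mem_image.1 hu
      obtain ⟨r', hr', rfl⟩ := mem_image.1 hv
      rw [hf1 r hr, hf1 r' hr'] at he
      rw [he]
    · intro X hX hXb
      let S := P.filter (fun s => ∀ n : E, ∃ x ∈ X, dt n s ≤ dt n x)
      have hS : Bad l S := by
        refine bad_sub hP (filter_subset _ _) ?_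
        intro a ha b hb t t0 t1 hs
        refine mem_filter.2 ⟨hs, fun n => ?_⟩
        obtain ⟨x, hx, h1⟩ := (mem_filter.1 ha).2 n
        obtain ⟨y, hy, h2⟩ := (mem_filter.1 hb).2 n
        rw [dt_mix]
        rcases le_total (dt n x) (dt n y) with h | h
        · exact ⟨y, hy, by nlinarith⟩
        · exact ⟨x, hx, by nlinarith⟩
      refine le_trans (card_le_card ?_) (bounded _ S le_rfl hS)
      intro x hx
      refine mem_bd.2 ⟨mem_filter.2 ⟨hVP (hX hx), fun n => ⟨x, hx, le_rfl⟩⟩, ?_⟩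
      obtain ⟨n, hn, h⟩ := hXb x hx
      refine ⟨n, hn, fun s hs => ?_⟩
      obtain ⟨y, hy, h1⟩ := (mem_filter.1 hs).2 n
      exact h1.trans (h y hy)
  rw [← hVc] at h1
  have := h1.trans (Nat.mul_le_mul_left l h2)
  omega

end
end BLBC

namespace BLBC

def toE : Pt ≃ E where
  toFun p := (p 0, p 1)
  invFun q := !₂[q.1, q.2]
  left_inv p := by
    ext i
    fin_cases i <;> simp
  right_inv q := by simp

lemma toE_mix (t : ℝ) (a b : Pt) : toE ((1 - t) • a + t • b) = mix t (toE a) (toE b) := by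
  simp [toE, mix]

lemma toE_symm_mix (t : ℝ) (a b : E) :
    toE.symm (mix t a b) = (1 - t) • toE.symm a + t • toE.symm b := by
  apply toE.injective
  rw [toE_mix]
  simp

lemma pull_sub {P : Finset Pt} {T : Finset E} (h : T ⊆ P.map toE.toEmbedding) :
    T.map toE.symm.toEmbedding ⊆ P := by
  intro x hx
  obtain ⟨y, hy, rfl⟩ := Finset.mem_map.1 hx
  obtain ⟨z, hz, rfl⟩ := Finset.mem_map.1 (h hy)
  simpa using hz

lemma vis_transfer {P : Finset Pt} {v w : Pt} (hv : v ∈ P) (hw : w ∈ P) (hvw : v ≠ w)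
    (h : Vis (P.map toE.toEmbedding) (toE v) (toE w)) : Visible P v w := by
  refine ⟨hvw, ?_⟩
  ext s
  constructor
  · rintro ⟨hs, a, b, ha, hb, hab, rfl⟩
    obtain rfl : a = 1 - b := by linarith
    rcases hb.eq_or_lt with rfl | hb
    · left; simp
    · rcases ha.eq_or_lt with ha | ha
      · have : b = 1 := by linarith
        subst this
        right; simp
      · exact (h _ (Finset.mem_map_of_mem toE.toEmbedding (Finset.mem_coe.1 hs)) b hb (by linarith)
          (toE_mix _ _ _)).elim
  · rintro (rfl | rfl)
    · exact ⟨hv, left_mem_segment _ _ _⟩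
    · exact ⟨hw, right_mem_segment _ _ _⟩

end BLBC

theorem stmt3 (l : ℕ) :
    ∃ n : ℕ, ∀ P : Finset Pt, n ≤ P.card →
      HasCollinear P l ∨
        ∃ S ⊆ P, S.card = 5 ∧ ∀ v ∈ S, ∀ w ∈ S, v ≠ w → Visible P v w := by
  obtain ⟨n, hn⟩ := BLBC.main_plane l
  refine ⟨n, fun P hP => ?_⟩
  by_contra hcon
  rw [not_or] at hcon
  obtain ⟨h1, h2⟩ := hcon
  have := hn (P.map BLBC.toE.toEmbedding) ⟨?_, ?_⟩
  · rw [Finset.card_map] at this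
    omega
  · intro T hT o d hl
    by_contra hc
    obtain ⟨U, hU, hUc⟩ := Finset.exists_subset_card_eq (not_lt.1 hc)
    refine h1 ⟨U.map BLBC.toE.symm.toEmbedding, BLBC.pull_sub (hU.trans hT), by simpa using hUc, ?_⟩
    rw [collinear_iff_exists_forall_eq_smul_vadd]
    refine ⟨BLBC.toE.symm o, BLBC.toE.symm d - BLBC.toE.symm o, fun p hp => ?_⟩
    obtain ⟨y, hy, rfl⟩ := Finset.mem_map.1 (Finset.mem_coe.1 hp)
    obtain ⟨t, rfl⟩ := hl y (hU hy)
    refine ⟨t, ?_⟩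
    change BLBC.toE.symm _ = _
    rw [BLBC.toE_symm_mix, vadd_eq_add]
    module
  · intro T hT hc
    by_contra hcon
    push Not at hcon
    refine h2 ⟨T.map BLBC.toE.symm.toEmbedding, BLBC.pull_sub hT, by simpa using hc, ?_⟩
    intro v hv w hw hvw
    refine BLBC.vis_transfer (BLBC.pull_sub hT hv) (BLBC.pull_sub hT hw) hvw ?_
    obtain ⟨y, hy, rfl⟩ := Finset.mem_map.1 hv
    obtain ⟨z, hz, rfl⟩ := Finset.mem_map.1 hw
    have := hcon y hy z hz (fun h => hvw (by rw [h]))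
    simpa using this
end
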